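/- Consider the perturbed half-quasilinear problem −(φ_p(u'))' = λ a(x) φ_p(u) + α(x) φ_p(u⁺) + β(x) φ_p(u⁻) + g(x,u,λ) on (0,1), u(0) = u(1) = 0, where g is continuous and |g(x,u,λ)/φ_p(u)| → 0 as |u| → 0 uniformly in x ∈ (0,1) and for λ in bounded intervals. Then for each k ∈ ℕ and ν ∈ {+,−}, the point (λ_k^ν, 0) is a bifurcation point of this problem, and there exists an unbounded connected subset 𝒟_k^ν of the closure of the set of nontrivial solutions in ℝ × E with (λ_k^ν, 0) ∈ 𝒟_k^ν and 𝒟_k^ν ⊂ (ℝ × S_k^ν) ∪ {(λ_k^ν, 0)}. -/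

import Mathlib

open Set Filter Topology

/-- `φ_p(s) = |s|^{p-2} s`. -/
noncomputable def phip (p s : ℝ) : ℝ := |s| ^ (p - 2) * s

/-- membership in the space `E = {u ∈ C¹[0,1] : u 0 = u 1 = 0}`. -/
def MemE (u : ℝ → ℝ) : Prop := ContDiff ℝ 1 u ∧ u 0 = 0 ∧ u 1 = 0

/-- `u` is nontrivial on `[0,1]`. -/
def Nontriv (u : ℝ → ℝ) : Prop := ∃ x ∈ Set.Icc (0:ℝ) 1, u x ≠ 0

/-- `u ∈ S_k^ν` (ν = 1 or -1): u ∈ E, exactly k-1 interior zeros in (0,1), all zeros of u in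
[0,1] simple, and ν·u positive near 0. -/
def MemS (k : ℕ) (ν : ℝ) (u : ℝ → ℝ) : Prop :=
  MemE u ∧
  {x ∈ Ioo (0:ℝ) 1 | u x = 0}.Finite ∧
  {x ∈ Ioo (0:ℝ) 1 | u x = 0}.ncard = k - 1 ∧
  (∀ x ∈ Icc (0:ℝ) 1, u x = 0 → deriv u x ≠ 0) ∧
  ∃ δ > 0, ∀ x ∈ Ioo (0:ℝ) δ, 0 < ν * u x

/-- the `C¹` norm `‖u‖ = max_{[0,1]} |u| + max_{[0,1]} |u'|` of `E`. -/
noncomputable def normE (u : ℝ → ℝ) : ℝ :=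
  (⨆ x : Icc (0:ℝ) 1, |u x|) + (⨆ x : Icc (0:ℝ) 1, |deriv u x|)

/-- `u` solves `-(φ_p(u'))' = λ a φ_p(u) + α φ_p(u⁺) + β φ_p(u⁻)` on (0,1), u(0)=u(1)=0. -/
def IsHalfSol (p : ℝ) (a α β : ℝ → ℝ) (lam : ℝ) (u : ℝ → ℝ) : Prop :=
  MemE u ∧ ∀ x ∈ Set.Ioo (0:ℝ) 1,
    HasDerivAt (fun y => phip p (deriv u y))
      (-(lam * a x * phip p (u x) + α x * phip p (max (u x) 0)
         + β x * phip p (-min (u x) 0))) x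

/-- the ambient space `ℝ × E`, with `E` embedded into `C[0,1] × C[0,1]` via `u ↦ (u, u')`. -/
abbrev CI := ContinuousMap (Set.Icc (0:ℝ) 1) ℝ

abbrev Xsp := ℝ × CI × CI

/-- `w` represents the element `u` of `E` (i.e. `w = (u|_{[0,1]}, u'|_{[0,1]})`). -/
def ReprE (u : ℝ → ℝ) (w : CI × CI) : Prop :=
  (∀ x : Set.Icc (0:ℝ) 1, w.1 x = u x) ∧ (∀ x : Set.Icc (0:ℝ) 1, w.2 x = deriv u x)

/-- `u` solves the perturbed problem
`-(φ_p(u'))' = λ a φ_p(u) + α φ_p(u⁺) + β φ_p(u⁻) + g(x,u,λ)` on (0,1), u(0)=u(1)=0. -/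
def IsPertSol (p : ℝ) (a α β : ℝ → ℝ) (g : ℝ → ℝ → ℝ → ℝ) (lam : ℝ) (u : ℝ → ℝ) : Prop :=
  MemE u ∧ ∀ x ∈ Set.Ioo (0:ℝ) 1,
    HasDerivAt (fun y => phip p (deriv u y))
      (-(lam * a x * phip p (u x) + α x * phip p (max (u x) 0)
         + β x * phip p (-min (u x) 0) + g x (u x) lam)) x

namespace HalfEigen

section PhiP

variable {p q : ℝ}

lemma phip_zero (p : ℝ) : phip p 0 = 0 := by simp [phip]

lemma phip_neg (p s : ℝ) : phip p (-s) = -phip p s := by simp [phip]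

lemma phip_one (p : ℝ) : phip p 1 = 1 := by simp [phip]

lemma phip_of_pos {s : ℝ} (hs : 0 < s) : phip p s = s ^ (p - 1) := by
  rw [phip, abs_of_pos hs, ← Real.rpow_add_one hs.ne']
  ring_nf

lemma phip_of_nonneg (hp : 1 < p) {s : ℝ} (hs : 0 ≤ s) : phip p s = s ^ (p - 1) := by
  rcases hs.eq_or_lt with rfl | h
  · rw [phip_zero, Real.zero_rpow (by linarith)]
  · exact phip_of_pos h

lemma phip_mul (p s t : ℝ) : phip p (s * t) = phip p s * phip p t := by
  rw [phip, phip, phip, abs_mul, Real.mul_rpow (abs_nonneg _) (abs_nonneg _)]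
  ring

lemma phip_eq_sub (hp : 1 < p) (s : ℝ) :
    phip p s = (max s 0) ^ (p - 1) - (max (-s) 0) ^ (p - 1) := by
  have h0 : (0 : ℝ) ^ (p - 1) = 0 := Real.zero_rpow (by linarith)
  rcases le_total 0 s with h | h
  · rw [max_eq_left h, max_eq_right (by linarith), h0, sub_zero, phip_of_nonneg hp h]
  · rw [max_eq_right h, max_eq_left (by linarith), h0, zero_sub,
      ← phip_of_nonneg hp (by linarith), phip_neg, neg_neg]

lemma phip_continuous (hp : 1 < p) : Continuous (phip p) := by
  have : phip p = fun s => (max s 0) ^ (p - 1) - (max (-s) 0) ^ (p - 1) :=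
    funext (phip_eq_sub hp)
  rw [this]
  have h0 : 0 ≤ p - 1 := by linarith
  exact ((continuous_id.max continuous_const).rpow_const fun _ => Or.inr h0).sub
    ((continuous_neg.max continuous_const).rpow_const fun _ => Or.inr h0)

lemma phip_mono (hp : 1 < p) : Monotone (phip p) := by
  intro s t hst
  rw [phip_eq_sub hp, phip_eq_sub hp]
  have h0 : 0 ≤ p - 1 := by linarith
  gcongr

lemma abs_phip (hp : 1 < p) (s : ℝ) : |phip p s| = |s| ^ (p - 1) := by
  rcases le_total 0 s with h | h
  · rw [phip_of_nonneg hp h, abs_of_nonneg h, abs_of_nonneg (Real.rpow_nonneg h _)]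
  · rw [← abs_neg, ← phip_neg, phip_of_nonneg hp (by linarith), abs_of_nonpos h,
      abs_of_nonneg (Real.rpow_nonneg (by linarith) _)]

lemma phip_mul_self (hp : 1 < p) (s : ℝ) : phip p s * s = |s| ^ p := by
  rcases eq_or_ne s 0 with rfl | h
  · simp [Real.zero_rpow (by linarith : p ≠ 0)]
  · rw [phip, mul_assoc, ← abs_mul_abs_self, ← mul_assoc, ← Real.rpow_add_one (abs_pos.2 h).ne',
      ← Real.rpow_add_one (abs_pos.2 h).ne']
    ring_nf

lemma phip_conj (hpq : p.HolderConjugate q) (s : ℝ) : phip q (phip p s) = s := by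
  have key : ∀ t : ℝ, 0 ≤ t → phip q (phip p t) = t := by
    intro t ht
    rw [phip_of_nonneg hpq.lt ht, phip_of_nonneg hpq.symm.lt (Real.rpow_nonneg ht _),
      ← Real.rpow_mul ht]
    have : (p - 1) * (q - 1) = 1 := by
      have := hpq.mul_eq_add
      linarith
    rw [this, Real.rpow_one]
  rcases le_total 0 s with h | h
  · exact key s h
  · have := key (-s) (by linarith)
    rw [phip_neg, phip_neg] at this
    linarith

lemma phip_strictMono (hp : 1 < p) : StrictMono (phip p) :=
  (phip_mono hp).strictMono_of_injective
    (Function.LeftInverse.injective (phip_conj (Real.HolderConjugate.conjExponent hp)))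

lemma phip_pos_iff (hp : 1 < p) {s : ℝ} : 0 < phip p s ↔ 0 < s := by
  simpa [phip_zero] using (phip_strictMono hp).lt_iff_lt (a := 0) (b := s)

lemma phip_eq_zero_iff (hp : 1 < p) {s : ℝ} : phip p s = 0 ↔ s = 0 := by
  simpa [phip_zero] using (phip_strictMono hp).injective.eq_iff (a := s) (b := 0)

lemma phip_sign (p : ℝ) {ν : ℝ} (hν : ν = 1 ∨ ν = -1) : phip p ν = ν := by
  rcases hν with rfl | rfl
  · exact phip_one p
  · rw [phip_neg, phip_one]

lemma phip_sign_mul (p : ℝ) {ν : ℝ} (hν : ν = 1 ∨ ν = -1) (s : ℝ) :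
    phip p (ν * s) = ν * phip p s := by
  rw [phip_mul, phip_sign p hν]

lemma phip_max_zero_of_pos (p : ℝ) {c : ℝ} (hc : 0 < c) (s : ℝ) :
    phip p (max (c * s) 0) = phip p c * phip p (max s 0) := by
  rw [← phip_mul, mul_max_of_nonneg _ _ hc.le, mul_zero]

lemma phip_neg_min_zero_of_pos (p : ℝ) {c : ℝ} (hc : 0 < c) (s : ℝ) :
    phip p (-min (c * s) 0) = phip p c * phip p (-min s 0) := by
  rw [← phip_mul, mul_neg, mul_min_of_nonneg _ _ hc.le, mul_zero]

lemma abs_phip_conj_rpow (hpq : p.HolderConjugate q) (v : ℝ) : |phip q v| ^ p = |v| ^ q := by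
  rw [abs_phip hpq.symm.lt, ← Real.rpow_mul (abs_nonneg _)]
  congr 1
  have := hpq.mul_eq_add
  linarith

lemma rpow_mul_rpow_le (hpq : p.HolderConjugate q) (u v : ℝ) :
    |u| ^ (p - 1) * |v| ^ (q - 1) ≤ |u| ^ p + |v| ^ q := by
  have h := Real.young_inequality_of_nonneg (Real.rpow_nonneg (abs_nonneg u) (p - 1))
    (Real.rpow_nonneg (abs_nonneg v) (q - 1)) hpq.symm
  have e1 : (p - 1) * q = p := by have := hpq.mul_eq_add; linarith
  have e2 : (q - 1) * p = q := by have := hpq.mul_eq_add; linarith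
  rw [← Real.rpow_mul (abs_nonneg _), ← Real.rpow_mul (abs_nonneg _), e1, e2] at h
  have h1 : |u| ^ p / q ≤ |u| ^ p :=
    div_le_self (Real.rpow_nonneg (abs_nonneg _) _) hpq.symm.lt.le
  have h2 : |v| ^ q / p ≤ |v| ^ q :=
    div_le_self (Real.rpow_nonneg (abs_nonneg _) _) hpq.lt.le
  linarith

end PhiP

section Angle

lemma exists_continuous_log {X : Type*} [TopologicalSpace X] [SimplyConnectedSpace X]
    [LocallyPathConnectedSpace X] (f : C(X, ℂ)) (hf : ∀ x, f x ≠ 0) (x₀ : X) :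
    ∃ L : C(X, ℂ), L x₀ = Complex.log (f x₀) ∧ ∀ x, Complex.exp (L x) = f x := by
  obtain ⟨L, ⟨h0, h1⟩, -⟩ := Complex.isCoveringMapOn_exp.existsUnique_continuousMap_lifts f
    (a₀ := x₀) (e₀ := Complex.log (f x₀)) (Complex.exp_log (hf x₀)) (fun x => hf x)
  exact ⟨L, h0, fun x => congrFun h1 x⟩

lemma re_eq_of_exp_eq {z w : ℂ} (h : Complex.exp z = w) :
    w.re = Real.exp z.re * Real.cos z.im ∧ w.im = Real.exp z.re * Real.sin z.im := by
  rw [← h, Complex.exp_re, Complex.exp_im]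
  exact ⟨rfl, rfl⟩

lemma mem_Ioo_of_sin_pos {φ : ℝ → ℝ} {a b : ℝ} (hφ : ContinuousOn φ (uIcc a b))
    (hs : ∀ x ∈ uIcc a b, 0 < Real.sin (φ x)) (ha : φ a ∈ Ioo 0 Real.pi) :
    φ b ∈ Ioo 0 Real.pi := by
  have hivt := intermediate_value_uIcc hφ
  constructor
  · by_contra! h
    obtain ⟨x, hx, hx0⟩ := hivt (mem_uIcc.2 (Or.inr ⟨h, ha.1.le⟩))
    have := hs x hx
    rw [hx0, Real.sin_zero] at this
    exact lt_irrefl _ this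
  · by_contra! h
    obtain ⟨x, hx, hx0⟩ := hivt (mem_uIcc.2 (Or.inl ⟨ha.2.le, h⟩))
    have := hs x hx
    rw [hx0, Real.sin_pi] at this
    exact lt_irrefl _ this

/-- The Poincaré–Miranda theorem on a rectangle. -/
theorem exists_common_zero {a b c d : ℝ} (hab : a ≤ b) (hcd : c ≤ d) {k h : ℝ × ℝ → ℝ}
    (hk : ContinuousOn k (Icc a b ×ˢ Icc c d)) (hh : ContinuousOn h (Icc a b ×ˢ Icc c d))
    (hl : ∀ y ∈ Icc c d, k (a, y) < 0) (hr : ∀ y ∈ Icc c d, 0 < k (b, y))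
    (hb : ∀ x ∈ Icc a b, 0 < h (x, c)) (ht : ∀ x ∈ Icc a b, h (x, d) < 0) :
    ∃ z ∈ Icc a b ×ˢ Icc c d, k z = 0 ∧ h z = 0 := by
  by_contra! hne
  let P : ℝ × ℝ → ℝ × ℝ := fun z => (projIcc a b hab z.1, projIcc c d hcd z.2)
  have hPmem : ∀ z, P z ∈ Icc a b ×ˢ Icc c d := fun z =>
    ⟨(projIcc a b hab z.1).2, (projIcc c d hcd z.2).2⟩
  have hPc : Continuous P := by
    refine Continuous.prodMk ?_ ?_
    · exact continuous_subtype_val.comp (continuous_projIcc.comp continuous_fst)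
    · exact continuous_subtype_val.comp (continuous_projIcc.comp continuous_snd)
  have hPid : ∀ z ∈ Icc a b ×ˢ Icc c d, P z = z := by
    rintro ⟨x, y⟩ ⟨hx, hy⟩
    simp only [P, projIcc_of_mem hab hx, projIcc_of_mem hcd hy]
  have hkP : Continuous fun z => k (P z) := hk.comp_continuous hPc hPmem
  have hhP : Continuous fun z => h (P z) := hh.comp_continuous hPc hPmem
  let f : C(ℝ × ℝ, ℂ) := ⟨fun z => ⟨k (P z), h (P z)⟩, by
    have : (fun z => (⟨k (P z), h (P z)⟩ : ℂ)) =
        fun z => ((k (P z) : ℂ) + (h (P z) : ℂ) * Complex.I) := by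
      funext z
      apply Complex.ext <;> simp
    rw [this]
    exact (Complex.continuous_ofReal.comp hkP).add
      ((Complex.continuous_ofReal.comp hhP).mul continuous_const)⟩
  have hf : ∀ z, f z ≠ 0 := by
    intro z hz
    exact hne (P z) (hPmem z) (congrArg Complex.re hz) (congrArg Complex.im hz)
  obtain ⟨L, hL0, hL⟩ := exists_continuous_log f hf (a, c)
  set A : ℝ × ℝ → ℝ := fun z => (L z).im with hA
  have hAc : Continuous A := Complex.continuous_im.comp L.continuous
  have hcos : ∀ z ∈ Icc a b ×ˢ Icc c d, k z = Real.exp (L z).re * Real.cos (A z) := by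
    intro z hz
    have := (re_eq_of_exp_eq (hL z)).1
    rw [← this]
    change k z = k (P z)
    rw [hPid z hz]
  have hsin : ∀ z ∈ Icc a b ×ˢ Icc c d, h z = Real.exp (L z).re * Real.sin (A z) := by
    intro z hz
    have := (re_eq_of_exp_eq (hL z)).2
    rw [← this]
    change h z = h (P z)
    rw [hPid z hz]
  have hsp : ∀ z ∈ Icc a b ×ˢ Icc c d, 0 < h z → 0 < Real.sin (A z) := fun z hz h0 => by
    rw [hsin z hz] at h0; exact (pos_iff_pos_of_mul_pos h0).1 (Real.exp_pos _)
  have hcp : ∀ z ∈ Icc a b ×ˢ Icc c d, 0 < k z → 0 < Real.cos (A z) := fun z hz h0 => by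
    rw [hcos z hz] at h0; exact (pos_iff_pos_of_mul_pos h0).1 (Real.exp_pos _)
  have hsn : ∀ z ∈ Icc a b ×ˢ Icc c d, h z < 0 → Real.sin (A z) < 0 := fun z hz h0 => by
    rw [hsin z hz] at h0; by_contra! hc
    exact absurd h0 (not_lt.2 (mul_nonneg (Real.exp_pos _).le hc))
  have hcn : ∀ z ∈ Icc a b ×ˢ Icc c d, k z < 0 → Real.cos (A z) < 0 := fun z hz h0 => by
    rw [hcos z hz] at h0; by_contra! hc
    exact absurd h0 (not_lt.2 (mul_nonneg (Real.exp_pos _).le hc))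
  have ha : a ∈ Icc a b := left_mem_Icc.2 hab
  have hb' : b ∈ Icc a b := right_mem_Icc.2 hab
  have hc : c ∈ Icc c d := left_mem_Icc.2 hcd
  have hd : d ∈ Icc c d := right_mem_Icc.2 hcd
  have hpi := Real.pi_pos
  -- bottom left corner
  have h1 : A (a, c) ∈ Ioo 0 Real.pi := by
    have hs := hsp (a, c) ⟨ha, hc⟩ (hb a ha)
    have hrange : A (a, c) ∈ Ioc (-Real.pi) Real.pi := by
      rw [hA]
      simp only [hL0, Complex.log_im]
      exact Complex.arg_mem_Ioc _
    constructor
    · by_contra! hcon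
      exact absurd hs (not_lt.2 (Real.sin_nonpos_of_nonpos_of_neg_pi_le hcon hrange.1.le))
    · refine lt_of_le_of_ne hrange.2 fun he => ?_
      rw [he, Real.sin_pi] at hs
      exact lt_irrefl _ hs
  have h2 : A (b, c) ∈ Ioo 0 Real.pi := by
    refine mem_Ioo_of_sin_pos (φ := fun x => A (x, c)) (a := a) (b := b) ?_ ?_ h1
    · exact (hAc.comp (by fun_prop)).continuousOn
    · intro x hx
      rw [uIcc_of_le hab] at hx
      exact hsp _ ⟨hx, hc⟩ (hb x hx)
  have h3 : A (b, d) + Real.pi / 2 ∈ Ioo 0 Real.pi := by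
    refine mem_Ioo_of_sin_pos (φ := fun y => A (b, y) + Real.pi / 2) (a := c) (b := d) ?_ ?_ ?_
    · exact ((hAc.comp (by fun_prop)).add continuous_const).continuousOn
    · intro y hy
      rw [uIcc_of_le hcd] at hy
      rw [Real.sin_add_pi_div_two]
      exact hcp _ ⟨hb', hy⟩ (hr y hy)
    · have hcc := hcp _ ⟨hb', hc⟩ (hr c hc)
      refine ⟨by have := h2.1; linarith, ?_⟩
      by_contra! hcon
      exact absurd hcc (not_lt.2 (Real.cos_nonpos_of_pi_div_two_le_of_le (by linarith)
        (by have := h2.2; linarith)))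
  have h4 : A (a, d) + Real.pi ∈ Ioo 0 Real.pi := by
    refine mem_Ioo_of_sin_pos (φ := fun x => A (x, d) + Real.pi) (a := b) (b := a) ?_ ?_ ?_
    · exact ((hAc.comp (by fun_prop)).add continuous_const).continuousOn
    · intro x hx
      rw [uIcc_of_ge hab] at hx
      rw [Real.sin_add_pi]
      have := hsn _ ⟨hx, hd⟩ (ht x hx)
      linarith
    · have hcc := hsn _ ⟨hb', hd⟩ (ht b hb')
      refine ⟨by have := h3.1; linarith, ?_⟩
      by_contra! hcon
      exact absurd hcc (not_lt.2 (Real.sin_nonneg_of_nonneg_of_le_pi (by linarith)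
        (by have := h3.2; linarith)))
  have h5 : A (a, c) + Real.pi / 2 + Real.pi ∈ Ioo 0 Real.pi := by
    refine mem_Ioo_of_sin_pos (φ := fun y => A (a, y) + Real.pi / 2 + Real.pi)
      (a := d) (b := c) ?_ ?_ ?_
    · exact (((hAc.comp (by fun_prop)).add continuous_const).add continuous_const).continuousOn
    · intro y hy
      rw [uIcc_of_ge hcd] at hy
      rw [Real.sin_add_pi, Real.sin_add_pi_div_two]
      have := hcn _ ⟨ha, hy⟩ (hl y hy)
      linarith
    · have hcc := hcn _ ⟨ha, hd⟩ (hl d hd)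
      refine ⟨by have := h4.1; linarith, ?_⟩
      by_contra! hcon
      exact absurd hcc (not_lt.2 (Real.cos_nonneg_of_neg_pi_div_two_le_of_le (by linarith)
        (by have := h4.2; linarith)))
  have := h5.2
  have := h1.1
  linarith

/-- `θ` is a continuous polar angle on `[0,1]`, starting from `0`, of the curve `(c, s)`. -/
def IsAngle (c s θ : ℝ → ℝ) : Prop :=
  ContinuousOn θ (Icc 0 1) ∧ θ 0 = 0 ∧
    ∀ x ∈ Icc (0 : ℝ) 1, ∃ ρ > 0, c x = ρ * Real.cos (θ x) ∧ s x = ρ * Real.sin (θ x)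

lemma IsAngle.congr {c s c' s' θ : ℝ → ℝ} (h : IsAngle c s θ)
    (hc : ∀ x ∈ Icc (0 : ℝ) 1, c' x = c x) (hs : ∀ x ∈ Icc (0 : ℝ) 1, s' x = s x) :
    IsAngle c' s' θ :=
  ⟨h.1, h.2.1, fun x hx => by rw [hc x hx, hs x hx]; exact h.2.2 x hx⟩

lemma exists_isAngle {c s : ℝ → ℝ} (hc : ContinuousOn c (Icc 0 1)) (hs : ContinuousOn s (Icc 0 1))
    (hne : ∀ x ∈ Icc (0 : ℝ) 1, c x = 0 → s x ≠ 0) (hc0 : 0 < c 0) (hs0 : s 0 = 0) :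
    ∃ θ, IsAngle c s θ := by
  let P : ℝ → ℝ := fun x => projIcc (0 : ℝ) 1 zero_le_one x
  have hPmem : ∀ x, P x ∈ Icc (0 : ℝ) 1 := fun x => (projIcc (0 : ℝ) 1 zero_le_one x).2
  have hPc : Continuous P := continuous_subtype_val.comp continuous_projIcc
  have hPid : ∀ x ∈ Icc (0 : ℝ) 1, P x = x := fun x hx => by
    simp only [P, projIcc_of_mem zero_le_one hx]
  have hcP : Continuous fun x => c (P x) := hc.comp_continuous hPc hPmem
  have hsP : Continuous fun x => s (P x) := hs.comp_continuous hPc hPmem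
  let f : C(ℝ, ℂ) := ⟨fun z => ⟨c (P z), s (P z)⟩, by
    have : (fun z => (⟨c (P z), s (P z)⟩ : ℂ)) =
        fun z => ((c (P z) : ℂ) + (s (P z) : ℂ) * Complex.I) := by
      funext z
      apply Complex.ext <;> simp
    rw [this]
    exact (Complex.continuous_ofReal.comp hcP).add
      ((Complex.continuous_ofReal.comp hsP).mul continuous_const)⟩
  have hf : ∀ z, f z ≠ 0 := fun z hz =>
    hne (P z) (hPmem z) (congrArg Complex.re hz) (congrArg Complex.im hz)
  obtain ⟨L, hL0, hL⟩ := exists_continuous_log f hf 0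
  refine ⟨fun x => (L x).im, (Complex.continuous_im.comp L.continuous).continuousOn, ?_, ?_⟩
  · have h0 : P 0 = 0 := hPid 0 (by simp)
    simp only [hL0, Complex.log_im]
    rw [Complex.arg_eq_zero_iff]
    change 0 ≤ c (P 0) ∧ s (P 0) = 0
    rw [h0]
    exact ⟨hc0.le, hs0⟩
  · intro x hx
    have := re_eq_of_exp_eq (hL x)
    change c (P x) = _ ∧ s (P x) = _ at this
    rw [hPid x hx] at this
    exact ⟨_, Real.exp_pos _, this⟩

lemma IsAngle.sq_add_sq_pos {c s θ : ℝ → ℝ} (h : IsAngle c s θ) {x : ℝ}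
    (hx : x ∈ Icc (0 : ℝ) 1) : 0 < c x * c x + s x * s x := by
  obtain ⟨ρ, hρ, h1, h2⟩ := h.2.2 x hx
  rw [h1, h2]
  have : ρ * Real.cos (θ x) * (ρ * Real.cos (θ x)) + ρ * Real.sin (θ x) * (ρ * Real.sin (θ x))
      = ρ ^ 2 := by
    have := Real.sin_sq_add_cos_sq (θ x)
    linear_combination ρ ^ 2 * this
  rw [this]
  positivity

lemma IsAngle.sub_eq_arctan {c s θ c' s' θ' : ℝ → ℝ} (h : IsAngle c s θ) (h' : IsAngle c' s' θ')
    (hpos : ∀ x ∈ Icc (0 : ℝ) 1, 0 < c' x * c x + s' x * s x) {x : ℝ} (hx : x ∈ Icc (0 : ℝ) 1) :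
    θ' x - θ x = Real.arctan ((s' x * c x - c' x * s x) / (c' x * c x + s' x * s x)) := by
  have key : ∀ y ∈ Icc (0 : ℝ) 1, ∃ ρ > 0, c' y * c y + s' y * s y = ρ * Real.cos (θ' y - θ y) ∧
      s' y * c y - c' y * s y = ρ * Real.sin (θ' y - θ y) := by
    intro y hy
    obtain ⟨ρ, hρ, h1, h2⟩ := h.2.2 y hy
    obtain ⟨ρ', hρ', h1', h2'⟩ := h'.2.2 y hy
    refine ⟨ρ' * ρ, mul_pos hρ' hρ, ?_, ?_⟩
    · rw [Real.cos_sub, h1, h2, h1', h2']; ring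
    · rw [Real.sin_sub, h1, h2, h1', h2']; ring
  have hmem : θ' x - θ x + Real.pi / 2 ∈ Ioo 0 Real.pi := by
    have hsub : uIcc 0 x ⊆ Icc (0 : ℝ) 1 := by
      rw [uIcc_of_le hx.1]; exact Icc_subset_Icc_right hx.2
    refine mem_Ioo_of_sin_pos (φ := fun y => θ' y - θ y + Real.pi / 2) (a := 0) (b := x) ?_ ?_ ?_
    · exact ((h'.1.sub h.1).add continuousOn_const).mono hsub
    · intro y hy
      rw [Real.sin_add_pi_div_two]
      obtain ⟨ρ, hρ, h1, -⟩ := key y (hsub hy)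
      have := hpos y (hsub hy)
      rw [h1] at this
      exact (pos_iff_pos_of_mul_pos this).1 hρ
    · have := Real.pi_pos
      rw [h.2.1, h'.2.1]
      constructor <;> linarith
  obtain ⟨ρ, hρ, h1, h2⟩ := key x hx
  rw [h1, h2, mul_div_mul_left _ _ hρ.ne', ← Real.tan_eq_sin_div_cos, Real.arctan_tan]
  · linarith [hmem.1]
  · linarith [hmem.2]

/-- The final angle depends continuously on the curve. -/
lemma tendsto_angle {ι : Type*} {l : Filter ι} {F : ι → CI × CI} {f : CI × CI}
    (hF : Tendsto F l (𝓝 f)) {Θ : ι → ℝ → ℝ} {θ : ℝ → ℝ}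
    (hΘ : ∀ᶠ i in l, IsAngle (IccExtend zero_le_one (F i).1) (IccExtend zero_le_one (F i).2) (Θ i))
    (hθ : IsAngle (IccExtend zero_le_one f.1) (IccExtend zero_le_one f.2) θ) :
    Tendsto (fun i => Θ i 1) l (𝓝 (θ 1)) := by
  have hone : (1 : ℝ) ∈ Icc (0 : ℝ) 1 := by simp
  have hpos : ∀ᶠ i in l, ∀ x : Icc (0 : ℝ) 1, 0 < (F i).1 x * f.1 x + (F i).2 x * f.2 x := by
    have hcont : Continuous fun w : CI × CI => w.1 * f.1 + w.2 * f.2 := by fun_prop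
    have hopen : IsOpen {φ : CI | MapsTo φ univ (Ioi 0)} :=
      ContinuousMap.isOpen_setOfPred_mapsTo isCompact_univ isOpen_Ioi
    have hmem : f.1 * f.1 + f.2 * f.2 ∈ {φ : CI | MapsTo φ univ (Ioi 0)} := by
      intro x _
      have := hθ.sq_add_sq_pos x.2
      simpa [IccExtend_of_mem zero_le_one _ x.2] using this
    filter_upwards [((hcont.tendsto f).comp hF).eventually (hopen.mem_nhds hmem)] with i hi x
    exact hi (mem_univ x)
  have heq : ∀ᶠ i in l, Θ i 1 = θ 1 + Real.arctan
      (((F i).2 ⟨1, hone⟩ * f.1 ⟨1, hone⟩ - (F i).1 ⟨1, hone⟩ * f.2 ⟨1, hone⟩) /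
        ((F i).1 ⟨1, hone⟩ * f.1 ⟨1, hone⟩ + (F i).2 ⟨1, hone⟩ * f.2 ⟨1, hone⟩)) := by
    filter_upwards [hpos, hΘ] with i hi hΘi
    have := hθ.sub_eq_arctan hΘi (fun x hx => by
      simpa [IccExtend_of_mem zero_le_one _ hx] using hi ⟨x, hx⟩) hone
    rw [IccExtend_of_mem zero_le_one _ hone, IccExtend_of_mem zero_le_one _ hone,
      IccExtend_of_mem zero_le_one _ hone, IccExtend_of_mem zero_le_one _ hone] at this
    linarith
  have hlim : Tendsto (fun i => θ 1 + Real.arctan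
      (((F i).2 ⟨1, hone⟩ * f.1 ⟨1, hone⟩ - (F i).1 ⟨1, hone⟩ * f.2 ⟨1, hone⟩) /
        ((F i).1 ⟨1, hone⟩ * f.1 ⟨1, hone⟩ + (F i).2 ⟨1, hone⟩ * f.2 ⟨1, hone⟩))) l
      (𝓝 (θ 1 + Real.arctan
      ((f.2 ⟨1, hone⟩ * f.1 ⟨1, hone⟩ - f.1 ⟨1, hone⟩ * f.2 ⟨1, hone⟩) /
        (f.1 ⟨1, hone⟩ * f.1 ⟨1, hone⟩ + f.2 ⟨1, hone⟩ * f.2 ⟨1, hone⟩)))) := by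
    have e1 : Tendsto (fun i => (F i).1 ⟨1, hone⟩) l (𝓝 (f.1 ⟨1, hone⟩)) :=
      (((ContinuousEvalConst.continuous_eval_const (⟨1, hone⟩ : Icc (0 : ℝ) 1)).comp
        continuous_fst).tendsto f).comp hF
    have e2 : Tendsto (fun i => (F i).2 ⟨1, hone⟩) l (𝓝 (f.2 ⟨1, hone⟩)) :=
      (((ContinuousEvalConst.continuous_eval_const (⟨1, hone⟩ : Icc (0 : ℝ) 1)).comp
        continuous_snd).tendsto f).comp hF
    have hden : f.1 ⟨1, hone⟩ * f.1 ⟨1, hone⟩ + f.2 ⟨1, hone⟩ * f.2 ⟨1, hone⟩ ≠ 0 := by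
      have := hθ.sq_add_sq_pos hone
      rw [IccExtend_of_mem zero_le_one _ hone, IccExtend_of_mem zero_le_one _ hone] at this
      exact this.ne'
    refine tendsto_const_nhds.add ((Real.continuous_arctan.tendsto _).comp ?_)
    exact ((e2.mul_const _).sub (e1.mul_const _)).div ((e1.mul_const _).add (e2.mul_const _)) hden
  have hval : θ 1 + Real.arctan
      ((f.2 ⟨1, hone⟩ * f.1 ⟨1, hone⟩ - f.1 ⟨1, hone⟩ * f.2 ⟨1, hone⟩) /
        (f.1 ⟨1, hone⟩ * f.1 ⟨1, hone⟩ + f.2 ⟨1, hone⟩ * f.2 ⟨1, hone⟩)) = θ 1 := by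
    rw [mul_comm (f.2 ⟨1, hone⟩) (f.1 ⟨1, hone⟩), sub_self, zero_div, Real.arctan_zero, add_zero]
  rw [hval] at hlim
  exact hlim.congr' (heq.mono fun i hi => hi.symm)

end Angle

section Crossing

/-- A function all of whose zeros are strict upward crossings has at most one zero. -/
lemma pos_of_upcrossing {f : ℝ → ℝ} (hf : ContinuousOn f (Icc 0 1))
    (hup : ∀ x ∈ Icc (0 : ℝ) 1, f x = 0 →
      (x < 1 → ∀ᶠ y in 𝓝[>] x, 0 < f y) ∧ (0 < x → ∀ᶠ y in 𝓝[<] x, f y < 0))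
    {x₀ x : ℝ} (hx₀ : 0 ≤ x₀) (hf₀ : f x₀ = 0) (hlt : x₀ < x) (hx : x ≤ 1) : 0 < f x := by
  by_contra! hcon
  have h1 := (hup x₀ ⟨hx₀, by linarith⟩ hf₀).1 (by linarith)
  obtain ⟨y, hy, hy1⟩ := (h1.and (Ioo_mem_nhdsGT hlt)).exists
  have hcomp : IsCompact {w ∈ Icc y x | f w ≤ 0} := by
    have hc : ContinuousOn f (Icc y x) := hf.mono (Icc_subset_Icc (by linarith [hy1.1]) hx)
    have := hc.preimage_isClosed_of_isClosed isClosed_Icc (isClosed_Iic (a := (0 : ℝ)))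
    exact isCompact_Icc.of_isClosed_subset this inter_subset_left
  obtain ⟨z, ⟨hz, hfz⟩, hmin⟩ := hcomp.exists_isLeast ⟨x, ⟨hy1.2.le, le_rfl⟩, hcon⟩
  have hyz : y < z := lt_of_le_of_ne hz.1 fun h => by rw [← h] at hfz; linarith
  have hpos : ∀ w ∈ Ico y z, 0 < f w := fun w hw => by
    by_contra! hc
    exact absurd (hmin ⟨⟨hw.1, hw.2.le.trans hz.2⟩, hc⟩) (not_le.2 hw.2)
  have hzI : z ∈ Icc (0 : ℝ) 1 := ⟨by linarith [hy1.1], hz.2.trans hx⟩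
  have hfz0 : f z = 0 := by
    obtain ⟨w, hw, hw0⟩ := intermediate_value_Icc' hyz.le
      (hf.mono (Icc_subset_Icc (by linarith [hy1.1]) hzI.2)) ⟨hfz, hy.le⟩
    rcases hw.2.eq_or_lt with h | h
    · rw [← h, hw0]
    · have := hpos w ⟨hw.1, h⟩
      linarith
  obtain ⟨w, hw, hw1⟩ := (((hup z hzI hfz0).2 (by linarith [hy1.1])).and
    (Ioo_mem_nhdsLT hyz)).exists
  have := hpos w ⟨hw1.1.le, hw1.2⟩
  linarith

end Crossing

section Delay

/-- `(u, v)` solves `u' = b(v)`, `v' = -f(x,u)` on `[0,1]` with `u(0) = 0`, `v(0) = ν`. -/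
structure IsIVP (b : ℝ → ℝ) (f : ℝ → ℝ → ℝ) (ν : ℝ) (u v : ℝ → ℝ) : Prop where
  deriv_u : ∀ x ∈ Icc (0 : ℝ) 1, HasDerivAt u (b (v x)) x
  deriv_v : ∀ x ∈ Icc (0 : ℝ) 1, HasDerivAt v (-f x (u x)) x
  u_zero : u 0 = 0
  v_zero : v 0 = ν

/-- Extension of a continuous function on `[0,1]` to `ℝ` by constants. -/
noncomputable abbrev ext (w : CI) : ℝ → ℝ := IccExtend (zero_le_one (α := ℝ)) w

lemma ext_apply (w : CI) {x : ℝ} (hx : x ∈ Icc (0 : ℝ) 1) : ext w x = w ⟨x, hx⟩ :=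
  IccExtend_of_mem _ _ hx

lemma continuous_ext (w : CI) : Continuous (ext w) := w.continuous.Icc_extend'

lemma continuous_ext_uncurry : Continuous fun q : CI × ℝ => ext q.1 q.2 := by
  have : (fun q : CI × ℝ => ext q.1 q.2) =
      fun q : CI × ℝ => q.1 (projIcc (0 : ℝ) 1 zero_le_one q.2) := rfl
  rw [this]
  have hproj : Continuous (projIcc (0 : ℝ) 1 zero_le_one) := continuous_projIcc
  exact continuous_fst.eval (hproj.comp continuous_snd)

variable {P : Type*} [TopologicalSpace P]

/-- The integral operator, with delay `h`, of the initial value problem `IsIVP`. -/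
def IsDelayMap (b : ℝ → ℝ) (G : P × ℝ × ℝ → ℝ) (ν : ℝ)
    (T : C((ℝ × P) × (CI × CI), CI × CI)) : Prop :=
  ∀ (h : ℝ) (π : P) (w : CI × CI) (x : Icc (0 : ℝ) 1),
    (T ((h, π), w)).1 x = ∫ s in (0 : ℝ)..max (x - h) 0, b (ext w.2 s) ∧
    (T ((h, π), w)).2 x = ν - ∫ s in (0 : ℝ)..max (x - h) 0, G (π, s, ext w.1 s)

lemma exists_isDelayMap {b : ℝ → ℝ} {G : P × ℝ × ℝ → ℝ} (hb : Continuous b) (hG : Continuous G)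
    (ν : ℝ) : ∃ T, IsDelayMap b G ν T := by
  have hs : Continuous fun q : ((ℝ × P) × (CI × CI)) × Icc (0 : ℝ) 1 =>
      max ((q.2 : ℝ) - q.1.1.1) 0 := by fun_prop
  have h1 : Continuous fun q : ((ℝ × P) × (CI × CI)) × Icc (0 : ℝ) 1 =>
      ∫ s in (0 : ℝ)..max ((q.2 : ℝ) - q.1.1.1) 0, b (ext q.1.2.2 s) := by
    refine intervalIntegral.continuous_parametric_intervalIntegral_of_continuous ?_ hs
    refine hb.comp (continuous_ext_uncurry.comp (Continuous.prodMk ?_ continuous_snd))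
    fun_prop
  have h2 : Continuous fun q : ((ℝ × P) × (CI × CI)) × Icc (0 : ℝ) 1 =>
      ν - ∫ s in (0 : ℝ)..max ((q.2 : ℝ) - q.1.1.1) 0, G (q.1.1.2, s, ext q.1.2.1 s) := by
    refine continuous_const.sub ?_
    refine intervalIntegral.continuous_parametric_intervalIntegral_of_continuous ?_ hs
    refine hG.comp (Continuous.prodMk (by fun_prop) (Continuous.prodMk continuous_snd ?_))
    refine continuous_ext_uncurry.comp (Continuous.prodMk ?_ continuous_snd)
    fun_prop
  exact ⟨(ContinuousMap.curry ⟨_, h1⟩).prodMk (ContinuousMap.curry ⟨_, h2⟩),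
    fun h π w x => ⟨rfl, rfl⟩⟩

variable {b : ℝ → ℝ} {G : P × ℝ × ℝ → ℝ} {ν : ℝ} {T : C((ℝ × P) × (CI × CI), CI × CI)}

lemma IsDelayMap.exists_fixed (hT : IsDelayMap b G ν T) {h : ℝ} (hh : 0 < h) :
    ∃ S : P → CI × CI, Continuous S ∧ ∀ π, T ((h, π), S π) = S π := by
  let S : ℕ → P → CI × CI := fun n => Nat.rec (fun _ => 0) (fun _ R π => T ((h, π), R π)) n
  have hS : ∀ n π, S (n + 1) π = T ((h, π), S n π) := fun _ _ => rfl
  have hcont : ∀ n, Continuous (S n) := by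
    intro n
    induction n with
    | zero => exact continuous_const
    | succ n ih =>
      exact T.continuous.comp ((continuous_const.prodMk continuous_id).prodMk ih)
  have hagree : ∀ (n : ℕ) (π : P) (x : Icc (0 : ℝ) 1), (x : ℝ) < n * h →
      (S (n + 1) π).1 x = (S n π).1 x ∧ (S (n + 1) π).2 x = (S n π).2 x := by
    intro n π
    induction n with
    | zero =>
      intro x hx
      have := x.2.1
      simp only [Nat.cast_zero, zero_mul] at hx
      linarith
    | succ n ih =>
      intro x hx
      push_cast at hx
      have hext : ∀ s ∈ uIcc 0 (max ((x : ℝ) - h) 0),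
          s = 0 ∧ max ((x : ℝ) - h) 0 = 0 ∨
          (ext (S (n + 1) π).1 s = ext (S n π).1 s ∧ ext (S (n + 1) π).2 s = ext (S n π).2 s) := by
        intro s hs
        rw [uIcc_of_le (le_max_right _ _)] at hs
        rcases le_total ((x : ℝ) - h) 0 with hc | hc
        · rw [max_eq_right hc] at hs ⊢
          exact Or.inl ⟨le_antisymm hs.2 hs.1, rfl⟩
        · rw [max_eq_left hc] at hs
          right
          have hs1 : s ∈ Icc (0 : ℝ) 1 := ⟨hs.1, by have := x.2.2; linarith [hs.2]⟩
          rw [ext_apply _ hs1, ext_apply _ hs1, ext_apply _ hs1, ext_apply _ hs1]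
          exact ih ⟨s, hs1⟩ (by have := hs.2; simp only; linarith)
      rw [hS (n + 1), hS n, (hT _ _ _ _).1, (hT _ _ _ _).2, (hT _ _ _ _).1, (hT _ _ _ _).2]
      rcases eq_or_ne (max ((x : ℝ) - h) 0) 0 with h0 | h0
      · rw [h0]; simp
      · constructor
        · refine intervalIntegral.integral_congr fun s hs => ?_
          rw [((hext s hs).resolve_left fun hc => h0 hc.2).2]
        · congr 1
          refine intervalIntegral.integral_congr fun s hs => ?_
          rw [((hext s hs).resolve_left fun hc => h0 hc.2).1]
  obtain ⟨n, hn⟩ := exists_nat_gt (1 / h)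
  refine ⟨S n, hcont n, fun π => ?_⟩
  rw [div_lt_iff₀ hh] at hn
  rw [← hS n π]
  exact Prod.ext (ContinuousMap.ext fun x => (hagree n π x (x.2.2.trans_lt hn)).1)
    (ContinuousMap.ext fun x => (hagree n π x (x.2.2.trans_lt hn)).2)

/-- Arzelà–Ascoli for bounded sets of uniformly Lipschitz functions on `[0,1]`. -/
lemma isCompact_lipschitz_bounded (B : ℝ) :
    IsCompact {φ : CI | (∀ x y, |φ x - φ y| ≤ B * |(x : ℝ) - y|) ∧ ∀ x, |φ x| ≤ B} := by
  set A : Set CI := {φ : CI | (∀ x y, |φ x - φ y| ≤ B * |(x : ℝ) - y|) ∧ ∀ x, |φ x| ≤ B} with hA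
  have hcl : IsClosed A := by
    have e : A = (⋂ x, ⋂ y, {φ : CI | |φ x - φ y| ≤ B * |(x : ℝ) - y|}) ∩
        ⋂ x, {φ : CI | |φ x| ≤ B} := by
      ext φ
      simp only [mem_inter_iff, mem_iInter, mem_ofPred_eq, hA]
    rw [e]
    refine (isClosed_iInter fun x => isClosed_iInter fun y => isClosed_le ?_ continuous_const).inter
      (isClosed_iInter fun x => isClosed_le ?_ continuous_const)
    · exact ((ContinuousEvalConst.continuous_eval_const x).sub
        (ContinuousEvalConst.continuous_eval_const y)).abs
    · exact (ContinuousEvalConst.continuous_eval_const x).abs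
  let e := ContinuousMap.isometryEquivBoundedOfCompact (Icc (0 : ℝ) 1) ℝ
  have himg : IsCompact (e '' A) := by
    refine BoundedContinuousFunction.arzela_ascoli₂ (Icc (-B) B) isCompact_Icc _
      (e.toHomeomorph.isClosedMap _ hcl) ?_ ?_
    · rintro _ x ⟨φ, hφ, rfl⟩
      exact abs_le.1 (hφ.2 x)
    · refine Metric.equicontinuous_of_continuity_modulus (fun r => B * r) ?_ _ ?_
      · have : Continuous fun r : ℝ => B * r := by fun_prop
        simpa using this.tendsto 0
      · rintro x y ⟨_, φ, hφ, rfl⟩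
        exact hφ.1 x y
  exact e.toHomeomorph.isCompact_image.1 himg

lemma abs_delay_sub_le {f : ℝ → ℝ} (hf : Continuous f) {B : ℝ} (hB : ∀ s, |f s| ≤ B) (h x y : ℝ) :
    |(∫ s in (0 : ℝ)..max (x - h) 0, f s) - ∫ s in (0 : ℝ)..max (y - h) 0, f s| ≤ B * |x - y| := by
  rw [intervalIntegral.integral_interval_sub_left (hf.intervalIntegrable _ _)
    (hf.intervalIntegrable _ _)]
  have hB0 : 0 ≤ B := (abs_nonneg _).trans (hB 0)
  refine (intervalIntegral.norm_integral_le_of_norm_le_const (C := B) fun s _ => by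
    rw [Real.norm_eq_abs]; exact hB s).trans ?_
  refine mul_le_mul_of_nonneg_left ?_ hB0
  have := abs_max_sub_max_le_abs (x - h) (y - h) 0
  rwa [sub_sub_sub_cancel_right] at this

lemma IsDelayMap.exists_isCompact (hT : IsDelayMap b G ν T) (hb : Continuous b)
    (hG : Continuous G) {B : ℝ} (hbB : ∀ s, |b s| ≤ B) (hGB : ∀ z, |G z| ≤ B) :
    ∃ K : Set (CI × CI), IsCompact K ∧ ∀ h, 0 ≤ h → ∀ π w, T ((h, π), w) ∈ K := by
  have hB0 : 0 ≤ B := (abs_nonneg _).trans (hbB 0)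
  refine ⟨_, (isCompact_lipschitz_bounded (|ν| + B)).prod
    (isCompact_lipschitz_bounded (|ν| + B)), fun h hh π w => ?_⟩
  have hc1 : Continuous fun s => b (ext w.2 s) := hb.comp (continuous_ext _)
  have hc2 : Continuous fun s => G (π, s, ext w.1 s) :=
    hG.comp (continuous_const.prodMk (continuous_id.prodMk (continuous_ext _)))
  have hν := abs_nonneg ν
  have hLip : ∀ t : ℝ, B * |t| ≤ (|ν| + B) * |t| := fun t =>
    mul_le_mul_of_nonneg_right (by linarith) (abs_nonneg t)
  have hint : ∀ (f : ℝ → ℝ), Continuous f → (∀ s, |f s| ≤ B) → ∀ x : Icc (0 : ℝ) 1,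
      |∫ s in (0 : ℝ)..max ((x : ℝ) - h) 0, f s| ≤ B := by
    intro f hf hfB x
    refine (intervalIntegral.norm_integral_le_of_norm_le_const (C := B) fun s _ => by
      rw [Real.norm_eq_abs]; exact hfB s).trans ?_
    rw [sub_zero, abs_of_nonneg (le_max_right _ _)]
    have : max ((x : ℝ) - h) 0 ≤ 1 := max_le (by have := x.2.2; linarith) zero_le_one
    nlinarith
  refine ⟨⟨fun x y => ?_, fun x => ?_⟩, ⟨fun x y => ?_, fun x => ?_⟩⟩
  · rw [(hT h π w x).1, (hT h π w y).1]
    exact (abs_delay_sub_le hc1 (fun s => hbB _) h x y).trans (hLip _)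
  · rw [(hT h π w x).1]
    have := hint _ hc1 (fun s => hbB _) x
    linarith
  · rw [(hT h π w x).2, (hT h π w y).2, sub_sub_sub_cancel_left, abs_sub_comm (x : ℝ)]
    exact (abs_delay_sub_le hc2 (fun s => hGB _) h y x).trans (hLip _)
  · rw [(hT h π w x).2]
    have := hint _ hc2 (fun s => hGB _) x
    exact (abs_sub _ _).trans (by linarith)

lemma IsDelayMap.exists_isIVP (hT : IsDelayMap b G ν T) (hb : Continuous b) (hG : Continuous G)
    {π : P} {w : CI × CI} (hw : T ((0, π), w) = w) :
    ∃ u v, IsIVP b (fun x y => G (π, x, y)) ν u v ∧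
      ∀ x : Icc (0 : ℝ) 1, u x = w.1 x ∧ v x = w.2 x := by
  have hc1 : Continuous fun s => b (ext w.2 s) := hb.comp (continuous_ext _)
  have hc2 : Continuous fun s => G (π, s, ext w.1 s) :=
    hG.comp (continuous_const.prodMk (continuous_id.prodMk (continuous_ext _)))
  have hval : ∀ x : Icc (0 : ℝ) 1, (∫ s in (0 : ℝ)..x, b (ext w.2 s)) = w.1 x ∧
      ν - (∫ s in (0 : ℝ)..x, G (π, s, ext w.1 s)) = w.2 x := by
    intro x
    have h1 := hT 0 π w x
    rw [hw, sub_zero, max_eq_left x.2.1] at h1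
    exact ⟨h1.1.symm, h1.2.symm⟩
  refine ⟨fun x => ∫ s in (0 : ℝ)..x, b (ext w.2 s),
    fun x => ν - ∫ s in (0 : ℝ)..x, G (π, s, ext w.1 s), ⟨?_, ?_, ?_, ?_⟩, hval⟩
  · intro x hx
    have h1 := hc1.integral_hasStrictDerivAt 0 x
    have h2 := (hval ⟨x, hx⟩).2
    simp only at h2
    simp only [h2]
    rw [ext_apply _ hx] at h1
    exact h1.hasDerivAt
  · intro x hx
    have h1 := (hc2.integral_hasStrictDerivAt 0 x).hasDerivAt.const_sub ν
    have h2 := (hval ⟨x, hx⟩).1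
    simp only at h2
    simp only [h2]
    rwa [ext_apply _ hx] at h1
  · simp
  · simp

lemma IsDelayMap.fixed_of_hasDerivAt (hT : IsDelayMap b G ν T) (hb : Continuous b)
    (hG : Continuous G) {π : P} {u v : ℝ → ℝ} (hu : ContinuousOn u (Icc 0 1))
    (hv : ContinuousOn v (Icc 0 1)) (hu' : ∀ x ∈ Ioo (0 : ℝ) 1, HasDerivAt u (b (v x)) x)
    (hv' : ∀ x ∈ Ioo (0 : ℝ) 1, HasDerivAt v (-G (π, x, u x)) x) (hu0 : u 0 = 0) (hv0 : v 0 = ν)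
    {w : CI × CI} (hw : ∀ x : Icc (0 : ℝ) 1, u x = w.1 x ∧ v x = w.2 x) :
    T ((0, π), w) = w := by
  have hc1 : Continuous fun s => b (ext w.2 s) := hb.comp (continuous_ext _)
  have hc2 : Continuous fun s => G (π, s, ext w.1 s) :=
    hG.comp (continuous_const.prodMk (continuous_id.prodMk (continuous_ext _)))
  have hsub : ∀ x : Icc (0 : ℝ) 1, Icc (0 : ℝ) x ⊆ Icc 0 1 := fun x => Icc_subset_Icc_right x.2.2
  have hsub' : ∀ x : Icc (0 : ℝ) 1, Ioo (0 : ℝ) x ⊆ Ioo 0 1 := fun x => Ioo_subset_Ioo_right x.2.2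
  refine Prod.ext (ContinuousMap.ext fun x => ?_) (ContinuousMap.ext fun x => ?_)
  · rw [(hT 0 π w x).1, sub_zero, max_eq_left x.2.1, ← (hw x).1]
    rw [intervalIntegral.integral_eq_sub_of_hasDerivAt_of_le (f := u) x.2.1 (hu.mono (hsub x))
      (fun s hs => ?_) (hc1.intervalIntegrable _ _), hu0, sub_zero]
    have hs' := hsub' x hs
    rw [ext_apply _ (Ioo_subset_Icc_self hs'), ← (hw ⟨s, Ioo_subset_Icc_self hs'⟩).2]
    exact hu' s hs'
  · rw [(hT 0 π w x).2, sub_zero, max_eq_left x.2.1, ← (hw x).2]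
    rw [intervalIntegral.integral_eq_sub_of_hasDerivAt_of_le (f := fun s => -v s) x.2.1
      (hv.neg.mono (hsub x)) (fun s hs => ?_) (hc2.intervalIntegrable _ _), hv0]
    · ring
    have hs' := hsub' x hs
    rw [ext_apply _ (Ioo_subset_Icc_self hs'), ← (hw ⟨s, Ioo_subset_Icc_self hs'⟩).1]
    simpa using (hv' s hs').fun_neg

end Delay

section Sturm

variable {p q : ℝ} {b : ℝ → ℝ} {f : ℝ → ℝ → ℝ} {ν : ℝ} {u v θ : ℝ → ℝ}

lemma IsIVP.congr {b' : ℝ → ℝ} {f' : ℝ → ℝ → ℝ} (h : IsIVP b f ν u v)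
    (hb : ∀ x ∈ Icc (0 : ℝ) 1, b' (v x) = b (v x))
    (hf : ∀ x ∈ Icc (0 : ℝ) 1, f' x (u x) = f x (u x)) : IsIVP b' f' ν u v :=
  ⟨fun x hx => by rw [hb x hx]; exact h.deriv_u x hx,
    fun x hx => by rw [hf x hx]; exact h.deriv_v x hx, h.u_zero, h.v_zero⟩

/-- Grönwall estimate for the energy `|u|^p + |v|^q`. -/
lemma IsIVP.energy (hpq : p.HolderConjugate q) (h : IsIVP b f ν u v) (hν : |ν| = 1) {C : ℝ}
    (hC : 0 ≤ C) (hb : ∀ x ∈ Icc (0 : ℝ) 1, |b (v x)| ≤ |v x| ^ (q - 1))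
    (hf : ∀ x ∈ Icc (0 : ℝ) 1, |f x (u x)| ≤ C * |u x| ^ (p - 1)) {x : ℝ}
    (hx : x ∈ Icc (0 : ℝ) 1) :
    Real.exp (-(p + q * C)) ≤ |u x| ^ p + |v x| ^ q ∧
      |u x| ^ p + |v x| ^ q ≤ Real.exp (p + q * C) := by
  have hp := hpq.lt
  have hq := hpq.symm.lt
  set A := p + q * C with hA
  have hA0 : 0 ≤ A := by have := mul_nonneg hpq.symm.nonneg hC; have := hpq.nonneg; linarith
  set N : ℝ → ℝ := fun x => |u x| ^ p + |v x| ^ q with hN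
  have hderiv : ∀ y ∈ Icc (0 : ℝ) 1, ∃ d, HasDerivAt N d y ∧ |d| ≤ A * N y := by
    intro y hy
    refine ⟨_, (((hasDerivAt_abs_rpow (u y) hp).comp y (h.deriv_u y hy)).add
      ((hasDerivAt_abs_rpow (v y) hq).comp y (h.deriv_v y hy))), ?_⟩
    have h1 : p * |u y| ^ (p - 2) * u y = p * phip p (u y) := by rw [phip, mul_assoc]
    have h2 : q * |v y| ^ (q - 2) * v y = q * phip q (v y) := by rw [phip, mul_assoc]
    rw [h1, h2]
    have hY := rpow_mul_rpow_le hpq (u y) (v y)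
    have hu0 := Real.rpow_nonneg (abs_nonneg (u y)) (p - 1)
    have hv0 := Real.rpow_nonneg (abs_nonneg (v y)) (q - 1)
    have e1 : |p * phip p (u y) * b (v y)| ≤ p * (|u y| ^ (p - 1) * |v y| ^ (q - 1)) := by
      rw [abs_mul, abs_mul, abs_phip hp, abs_of_pos hpq.pos, mul_assoc]
      exact mul_le_mul_of_nonneg_left (mul_le_mul_of_nonneg_left (hb y hy) hu0) hpq.nonneg
    have e2 : |q * phip q (v y) * -f y (u y)| ≤ q * C * (|u y| ^ (p - 1) * |v y| ^ (q - 1)) := by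
      rw [abs_mul, abs_mul, abs_phip hq, abs_of_pos hpq.symm.pos, abs_neg]
      have := mul_le_mul_of_nonneg_left (hf y hy) (mul_nonneg hpq.symm.nonneg hv0)
      linarith
    refine (abs_add_le _ _).trans ((add_le_add e1 e2).trans ?_)
    rw [← add_mul]
    exact mul_le_mul_of_nonneg_left hY hA0
  choose! d hd hdle using hderiv
  have hN0 : N 0 = 1 := by
    simp only [hN, h.u_zero, h.v_zero, hν, abs_zero, Real.one_rpow, Real.zero_rpow hpq.ne_zero,
      zero_add]
  have h01 : (0 : ℝ) ∈ Icc (0 : ℝ) 1 := by simp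
  have hmono : ∀ s : ℝ, (∀ y ∈ Icc (0 : ℝ) 1, 0 ≤ s * N y + d y) →
      MonotoneOn (fun y => Real.exp (s * y) * N y) (Icc 0 1) := by
    intro s hs
    have hde : ∀ y ∈ Icc (0 : ℝ) 1, HasDerivAt (fun y => Real.exp (s * y) * N y)
        (Real.exp (s * y) * (s * N y + d y)) y := by
      intro y hy
      have := ((hasDerivAt_id' y).const_mul s).exp.fun_mul (hd y hy)
      exact this.congr_deriv (by ring)
    refine monotoneOn_of_deriv_nonneg (convex_Icc 0 1)
      (fun y hy => (hde y hy).continuousAt.continuousWithinAt)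
      (fun y hy => (hde y (interior_subset hy)).differentiableAt.differentiableWithinAt) ?_
    intro y hy
    rw [(hde y (interior_subset hy)).deriv]
    exact mul_nonneg (Real.exp_nonneg _) (hs y (interior_subset hy))
  have hNnn : ∀ y, 0 ≤ N y := fun y =>
    add_nonneg (Real.rpow_nonneg (abs_nonneg _) _) (Real.rpow_nonneg (abs_nonneg _) _)
  constructor
  · have := hmono A (fun y hy => by linarith [neg_le_of_abs_le (hdle y hy)]) h01 hx hx.1
    simp only [mul_zero, Real.exp_zero, one_mul, hN0] at this
    have h2 : Real.exp (A * x) * N x ≤ Real.exp A * N x :=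
      mul_le_mul_of_nonneg_right (Real.exp_le_exp.2 (by nlinarith [hx.2])) (hNnn x)
    rw [Real.exp_neg, inv_le_iff_one_le_mul₀' (Real.exp_pos _)]
    exact this.trans h2
  · have hm : MonotoneOn (fun y => -(Real.exp (-A * y) * N y)) (Icc 0 1) := by
      have hde : ∀ y ∈ Icc (0 : ℝ) 1, HasDerivAt (fun y => -(Real.exp (-A * y) * N y))
          (Real.exp (-A * y) * (A * N y - d y)) y := by
        intro y hy
        have := (((hasDerivAt_id' y).const_mul (-A)).exp.fun_mul (hd y hy)).fun_neg
        exact this.congr_deriv (by ring)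
      refine monotoneOn_of_deriv_nonneg (convex_Icc 0 1)
        (fun y hy => (hde y hy).continuousAt.continuousWithinAt)
        (fun y hy => (hde y (interior_subset hy)).differentiableAt.differentiableWithinAt) ?_
      intro y hy
      rw [(hde y (interior_subset hy)).deriv]
      exact mul_nonneg (Real.exp_nonneg _)
        (by linarith [le_of_abs_le (hdle y (interior_subset hy))])
    have := hm h01 hx hx.1
    simp only [mul_zero, Real.exp_zero, one_mul, hN0] at this
    have h2 : Real.exp (-A) * N x ≤ Real.exp (-A * x) * N x :=
      mul_le_mul_of_nonneg_right (Real.exp_le_exp.2 (by nlinarith [hx.2])) (hNnn x)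
    have h3 : Real.exp (-A) * N x ≤ 1 := by linarith
    rwa [Real.exp_neg, inv_mul_le_iff₀ (Real.exp_pos _), mul_one] at h3

lemma IsIVP.abs_le (hpq : p.HolderConjugate q) (h : IsIVP b f ν u v) (hν : |ν| = 1) {C : ℝ}
    (hC : 0 ≤ C) (hb : ∀ x ∈ Icc (0 : ℝ) 1, |b (v x)| ≤ |v x| ^ (q - 1))
    (hf : ∀ x ∈ Icc (0 : ℝ) 1, |f x (u x)| ≤ C * |u x| ^ (p - 1)) {x : ℝ}
    (hx : x ∈ Icc (0 : ℝ) 1) :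
    |u x| ≤ Real.exp (p + q * C) ∧ |v x| ≤ Real.exp (p + q * C) := by
  have hE := (h.energy hpq hν hC hb hf hx).2
  have hA0 : 0 ≤ p + q * C := by
    have := mul_nonneg hpq.symm.nonneg hC; have := hpq.nonneg; linarith
  have hu0 := Real.rpow_nonneg (abs_nonneg (u x)) p
  have hv0 := Real.rpow_nonneg (abs_nonneg (v x)) q
  have key : ∀ {t r : ℝ}, 1 < r → |t| ^ r ≤ Real.exp (p + q * C) → |t| ≤ Real.exp (p + q * C) := by
    intro t r hr ht
    by_contra! hlt
    have h1 : 1 ≤ |t| := (Real.one_le_exp hA0).trans hlt.le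
    have := Real.rpow_le_rpow_of_exponent_le h1 hr.le
    rw [Real.rpow_one] at this
    linarith
  exact ⟨key hpq.lt (by linarith), key hpq.symm.lt (by linarith)⟩

lemma IsIVP.ne_zero (hpq : p.HolderConjugate q) (h : IsIVP b f ν u v) (hν : |ν| = 1) {C : ℝ}
    (hC : 0 ≤ C) (hb : ∀ x ∈ Icc (0 : ℝ) 1, |b (v x)| ≤ |v x| ^ (q - 1))
    (hf : ∀ x ∈ Icc (0 : ℝ) 1, |f x (u x)| ≤ C * |u x| ^ (p - 1)) {x : ℝ}
    (hx : x ∈ Icc (0 : ℝ) 1) (hv : v x = 0) : u x ≠ 0 := by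
  intro hu
  have hE := (h.energy hpq hν hC hb hf hx).1
  rw [hu, hv, abs_zero, Real.zero_rpow hpq.ne_zero, Real.zero_rpow hpq.symm.ne_zero,
    add_zero] at hE
  exact absurd hE (not_le.2 (Real.exp_pos _))

lemma IsIVP.continuousOn_u (h : IsIVP b f ν u v) : ContinuousOn u (Icc 0 1) :=
  fun x hx => (h.deriv_u x hx).continuousAt.continuousWithinAt

lemma IsIVP.continuousOn_v (h : IsIVP b f ν u v) : ContinuousOn v (Icc 0 1) :=
  fun x hx => (h.deriv_v x hx).continuousAt.continuousWithinAt

lemma eventually_pos_right_of_sin {φ : ℝ → ℝ} (hφ : ContinuousOn φ (Icc 0 1)) {x : ℝ}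
    (hx : x ∈ Icc (0 : ℝ) 1) (h0 : φ x = 0) (h1 : x < 1)
    (hs : ∀ᶠ y in 𝓝[>] x, 0 < Real.sin (φ y)) : ∀ᶠ y in 𝓝[>] x, 0 < φ y := by
  have ht : Tendsto φ (𝓝[>] x) (𝓝 0) := by
    rw [← h0]
    refine (hφ x hx).mono_left (nhdsWithin_le_of_mem ?_)
    exact mem_of_superset (Ioo_mem_nhdsGT h1) fun y hy => ⟨by linarith [hx.1, hy.1], hy.2.le⟩
  have hπ := ht.eventually (Ioi_mem_nhds (neg_lt_zero.2 Real.pi_pos))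
  filter_upwards [hs, hπ] with y h2 h3
  by_contra! h4
  exact absurd h2 (not_lt.2 (Real.sin_nonpos_of_nonpos_of_neg_pi_le h4 (le_of_lt h3)))

lemma eventually_neg_left_of_sin {φ : ℝ → ℝ} (hφ : ContinuousOn φ (Icc 0 1)) {x : ℝ}
    (hx : x ∈ Icc (0 : ℝ) 1) (h0 : φ x = 0) (h1 : 0 < x)
    (hs : ∀ᶠ y in 𝓝[<] x, Real.sin (φ y) < 0) : ∀ᶠ y in 𝓝[<] x, φ y < 0 := by
  have ht : Tendsto φ (𝓝[<] x) (𝓝 0) := by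
    rw [← h0]
    refine (hφ x hx).mono_left (nhdsWithin_le_of_mem ?_)
    exact mem_of_superset (Ioo_mem_nhdsLT h1) fun y hy => ⟨hy.1.le, by linarith [hx.2, hy.2]⟩
  have hπ := ht.eventually (Iio_mem_nhds Real.pi_pos)
  filter_upwards [hs, hπ] with y h2 h3
  by_contra! h4
  exact absurd h2 (not_lt.2 (Real.sin_nonneg_of_nonneg_of_le_pi h4 (le_of_lt h3)))

lemma eventually_sign_of_hasDerivAt_pos {φ : ℝ → ℝ} {d x : ℝ} (h : HasDerivAt φ d x) (hd : 0 < d)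
    (h0 : φ x = 0) : (∀ᶠ y in 𝓝[>] x, 0 < φ y) ∧ ∀ᶠ y in 𝓝[<] x, φ y < 0 := by
  have ht := (hasDerivAt_iff_tendsto_slope.1 h).eventually (lt_mem_nhds hd)
  constructor
  · have h1 : ∀ᶠ y in 𝓝[>] x, 0 < slope φ x y :=
      ht.filter_mono (nhdsWithin_mono _ fun y (hy : x < y) => hy.ne')
    filter_upwards [h1, self_mem_nhdsWithin] with y h2 (h3 : x < y)
    rw [slope_def_field, h0, sub_zero] at h2
    exact (div_pos_iff_of_pos_right (sub_pos.2 h3)).1 h2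
  · have h1 : ∀ᶠ y in 𝓝[<] x, 0 < slope φ x y :=
      ht.filter_mono (nhdsWithin_mono _ fun y (hy : y < x) => hy.ne)
    filter_upwards [h1, self_mem_nhdsWithin] with y h2 (h3 : y < x)
    rw [slope_def_field, h0, sub_zero] at h2
    by_contra! h4
    exact absurd h2 (not_lt.2 (div_nonpos_of_nonneg_of_nonpos h4 (by linarith)))

/-- The angle crosses integer multiples of `π` only upwards. -/
lemma IsIVP.angle_upcrossing (hp : 1 < p) (hν : ν = 1 ∨ ν = -1) (h : IsIVP b f ν u v)
    (hb : ∀ x ∈ Icc (0 : ℝ) 1, v x ≠ 0 → 0 < b (v x) * v x)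
    (hθ : IsAngle (fun x => ν * v x) (fun x => ν * phip p (u x)) θ) (m : ℤ) {x : ℝ}
    (hx : x ∈ Icc (0 : ℝ) 1) (h0 : θ x - m * Real.pi = 0) :
    (x < 1 → ∀ᶠ y in 𝓝[>] x, 0 < θ y - m * Real.pi) ∧
      (0 < x → ∀ᶠ y in 𝓝[<] x, θ y - m * Real.pi < 0) := by
  set c := Real.cos (m * Real.pi) with hc
  have hc2 : c * c = 1 := by
    have := Real.cos_sq_add_sin_sq (m * Real.pi)
    rw [Real.sin_int_mul_pi] at this
    rw [hc]; linarith
  have hν2 : ν * ν = 1 := by rcases hν with rfl | rfl <;> norm_num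
  have hsin : ∀ y, Real.sin (θ y - m * Real.pi) = c * Real.sin (θ y) := by
    intro y
    rw [Real.sin_sub, Real.sin_int_mul_pi]; ring
  have hcν : c * ν = 1 ∨ c * ν = -1 := by
    have : (c * ν - 1) * (c * ν + 1) = 0 := by linear_combination c * c * hν2 + hc2
    rcases mul_eq_zero.1 this with h | h
    · left; linarith
    · right; linarith
  obtain ⟨ρ, hρ, e1, e2⟩ := hθ.2.2 x hx
  have hθx : θ x = m * Real.pi := by linarith
  have hux : u x = 0 := by
    rw [hθx, Real.sin_int_mul_pi, mul_zero] at e2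
    rcases mul_eq_zero.1 e2 with h | h
    · rw [h] at hν2; norm_num at hν2
    · exact (phip_eq_zero_iff hp).1 h
  have hcv : c * ν * v x = ρ := by
    simp only at e1
    rw [mul_assoc, e1, hθx, ← hc]; linear_combination ρ * hc2
  have hvne : v x ≠ 0 := by
    intro hv; rw [hv, mul_zero] at hcv; exact hρ.ne hcv
  have hcνsq : (c * ν) * (c * ν) = 1 := by linear_combination ν * ν * hc2 + hν2
  have hd : 0 < c * ν * b (v x) := by
    have h1 := hb x hx hvne
    have h2 : b (v x) * v x = c * ν * b (v x) * ρ := by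
      rw [← hcv]; linear_combination (-(b (v x) * v x)) * hcνsq
    rw [h2] at h1
    exact (pos_iff_pos_of_mul_pos h1).2 hρ
  have hev := eventually_sign_of_hasDerivAt_pos ((h.deriv_u x hx).const_mul (c * ν)) hd
    (by rw [hux, mul_zero])
  have hφ : ContinuousOn (fun y => θ y - m * Real.pi) (Icc 0 1) := hθ.1.sub continuousOn_const
  have hrel : ∀ y ∈ Icc (0 : ℝ) 1, ∃ r > 0,
      phip p (c * ν * u y) = r * Real.sin (θ y - m * Real.pi) := by
    intro y hy
    obtain ⟨r, hr, -, e⟩ := hθ.2.2 y hy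
    refine ⟨r, hr, ?_⟩
    simp only at e
    rw [phip_sign_mul p hcν, hsin, mul_assoc, e]; ring
  refine ⟨fun h1 => eventually_pos_right_of_sin hφ hx h0 h1 ?_,
    fun h1 => eventually_neg_left_of_sin hφ hx h0 h1 ?_⟩
  · filter_upwards [hev.1, Ioo_mem_nhdsGT h1] with y h2 h3
    obtain ⟨r, hr, e⟩ := hrel y ⟨by linarith [hx.1, h3.1], h3.2.le⟩
    rw [← phip_pos_iff hp, e] at h2
    exact (pos_iff_pos_of_mul_pos h2).1 hr
  · filter_upwards [hev.2, Ioo_mem_nhdsLT h1] with y h2 h3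
    obtain ⟨r, hr, e⟩ := hrel y ⟨h3.1.le, by linarith [hx.2, h3.2]⟩
    rw [← neg_pos, ← phip_pos_iff hp, phip_neg, e, neg_pos] at h2
    exact neg_of_mul_neg_right h2 hr.le

end Sturm

section Comparison

variable {p q : ℝ} {ν : ℝ}

/-- The right-hand side of the half-linear equation. -/
noncomputable def halfRHS (p : ℝ) (a α β : ℝ → ℝ) (lam x s : ℝ) : ℝ :=
  lam * a x * phip p s + α x * phip p (max s 0) + β x * phip p (-min s 0)

/-- Picone's identity, as positivity of a derivative. -/
lemma picone_of_pos (hpq : p.HolderConjugate q) {u₁ v₁ u₂ v₂ : ℝ → ℝ} {c₁ c₂ x : ℝ}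
    (hc : c₁ < c₂) (h1 : 0 < u₁ x) (h2 : 0 < u₂ x)
    (hu₁ : HasDerivAt u₁ (phip q (v₁ x)) x) (hv₁ : HasDerivAt v₁ (-(c₁ * phip p (u₁ x))) x)
    (hu₂ : HasDerivAt u₂ (phip q (v₂ x)) x) (hv₂ : HasDerivAt v₂ (-(c₂ * phip p (u₂ x))) x) :
    ∃ d > 0, HasDerivAt (fun y => u₁ y * v₁ y - u₁ y * phip p (u₁ y / u₂ y) * v₂ y) d x := by
  have hp := hpq.lt
  have hq := hpq.symm.lt
  set r := u₁ x / u₂ x with hr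
  have hr0 : 0 < r := div_pos h1 h2
  have hur : u₁ x = r * u₂ x := by rw [hr]; field_simp
  have hphi : HasDerivAt (phip p) ((p - 1) * r ^ (p - 1 - 1)) r := by
    refine (Real.hasDerivAt_rpow_const (Or.inl hr0.ne')).congr_of_eventuallyEq ?_
    filter_upwards [lt_mem_nhds hr0] with t ht using phip_of_pos ht
  have hdiv := hu₁.fun_div hu₂ h2.ne'
  have hcomp : HasDerivAt (fun y => phip p (u₁ y / u₂ y)) ((p - 1) * r ^ (p - 1 - 1) *
      ((phip q (v₁ x) * u₂ x - u₁ x * phip q (v₂ x)) / u₂ x ^ 2)) x :=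
    HasDerivAt.comp x (h₂ := phip p) (h := fun y => u₁ y / u₂ y) hphi hdiv
  have hD := (hu₁.fun_mul hv₁).fun_sub ((hu₁.fun_mul hcomp).fun_mul hv₂)
  refine ⟨_, ?_, hD⟩
  have hrp : r ^ (p - 1 - 1) * r = r ^ (p - 1) := by
    rw [← Real.rpow_add_one hr0.ne']; ring_nf
  have hrp2 : r ^ (p - 1) * r = r ^ p := by
    rw [← Real.rpow_add_one hr0.ne']; ring_nf
  have hphr : phip p r = r ^ (p - 1) := phip_of_pos hr0
  have hphu : phip p (u₁ x) = phip p r * phip p (u₂ x) := by rw [hur, phip_mul]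
  have hY := Real.young_inequality (phip q (v₁ x)) (r ^ (p - 1) * v₂ x) hpq
  rw [abs_phip_conj_rpow hpq, abs_mul, Real.mul_rpow (abs_nonneg _) (abs_nonneg _),
    abs_of_pos (Real.rpow_pos_of_pos hr0 _), ← Real.rpow_mul hr0.le] at hY
  have e1 : (p - 1) * q = p := by have := hpq.mul_eq_add; linarith
  rw [e1] at hY
  have hYp : p * (phip q (v₁ x) * (r ^ (p - 1) * v₂ x)) ≤
      |v₁ x| ^ q + (p - 1) * (r ^ p * |v₂ x| ^ q) := by
    have := mul_le_mul_of_nonneg_left hY hpq.nonneg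
    have e2 : p * (|v₁ x| ^ q / p + r ^ p * |v₂ x| ^ q / q) =
        |v₁ x| ^ q + (p - 1) * (r ^ p * |v₂ x| ^ q) := by
      have hq0 := hpq.symm.ne_zero
      have hp0 := hpq.ne_zero
      field_simp
      linear_combination (-(r ^ p * |v₂ x| ^ q)) * e1
    linarith
  have hv1 := phip_mul_self hq (v₁ x)
  have hv2 := phip_mul_self hq (v₂ x)
  have hpos : 0 < (c₂ - c₁) * (u₁ x * phip p (u₁ x)) :=
    mul_pos (sub_pos.2 hc) (mul_pos h1 ((phip_pos_iff hp).2 h1))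
  have hkey : u₁ x * ((p - 1) * r ^ (p - 1 - 1) *
      ((phip q (v₁ x) * u₂ x - u₁ x * phip q (v₂ x)) / u₂ x ^ 2)) =
      (p - 1) * (r ^ (p - 1) * phip q (v₁ x) - r ^ p * phip q (v₂ x)) := by
    rw [← hrp2, ← hrp, hur]
    field_simp
  rw [← hr, hphr]
  rw [hphr] at hphu
  have e3 : r ^ (p - 1) * v₂ x * phip q (v₁ x) + (p - 1) * (r ^ (p - 1) * phip q (v₁ x)
      - r ^ p * phip q (v₂ x)) * v₂ x = p * (phip q (v₁ x) * (r ^ (p - 1) * v₂ x))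
        - (p - 1) * (r ^ p * |v₂ x| ^ q) := by
    rw [← hv2]; ring
  have e4 : (u₁ x) * r ^ (p - 1) * -(c₂ * phip p (u₂ x)) = -(c₂ * (u₁ x * phip p (u₁ x))) := by
    rw [hphu]; ring
  have expand : phip q (v₁ x) * v₁ x + u₁ x * -(c₁ * phip p (u₁ x)) -
      ((phip q (v₁ x) * r ^ (p - 1) + u₁ x * ((p - 1) * r ^ (p - 1 - 1) *
      ((phip q (v₁ x) * u₂ x - u₁ x * phip q (v₂ x)) / u₂ x ^ 2))) * v₂ x +
      u₁ x * r ^ (p - 1) * -(c₂ * phip p (u₂ x))) =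
      |v₁ x| ^ q + (p - 1) * (r ^ p * |v₂ x| ^ q) - p * (phip q (v₁ x) * (r ^ (p - 1) * v₂ x))
        + (c₂ - c₁) * (u₁ x * phip p (u₁ x)) := by
    rw [hkey, e4, ← hv1]
    linear_combination (-1 : ℝ) * e3
  rw [expand]
  linarith

lemma halfRHS_sign (p : ℝ) (a α β : ℝ → ℝ) {σ : ℝ} (hσ : σ = 1 ∨ σ = -1) (x : ℝ) :
    ∃ γ, ∀ lam s, 0 < σ * s → σ * halfRHS p a α β lam x s = (lam * a x + γ) * phip p (σ * s) := by
  rcases hσ with rfl | rfl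
  · refine ⟨α x, fun lam s hs => ?_⟩
    rw [one_mul] at hs
    rw [one_mul, one_mul, halfRHS, max_eq_left hs.le, min_eq_right hs.le, neg_zero, phip_zero]
    ring
  · refine ⟨-β x, fun lam s hs => ?_⟩
    have hs' : s < 0 := by linarith
    rw [halfRHS, max_eq_right hs'.le, min_eq_left hs'.le, phip_zero, neg_one_mul s, phip_neg]
    ring

lemma picone (hpq : p.HolderConjugate q) {a α β : ℝ → ℝ} {lam₁ lam₂ : ℝ} (hlam : lam₁ < lam₂)
    {u₁ v₁ u₂ v₂ : ℝ → ℝ} {ν₁ ν₂ : ℝ}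
    (h₁ : IsIVP (phip q) (halfRHS p a α β lam₁) ν₁ u₁ v₁)
    (h₂ : IsIVP (phip q) (halfRHS p a α β lam₂) ν₂ u₂ v₂) {x σ : ℝ} (hx : x ∈ Icc (0 : ℝ) 1)
    (ha : 0 < a x) (hσ : σ = 1 ∨ σ = -1) (hs₁ : 0 < σ * u₁ x) (hs₂ : 0 < σ * u₂ x) :
    ∃ d > 0, HasDerivAt (fun y => u₁ y * v₁ y - u₁ y * phip p (u₁ y / u₂ y) * v₂ y) d x := by
  obtain ⟨γ, hγ⟩ := halfRHS_sign p a α β hσ x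
  have hc : lam₁ * a x + γ < lam₂ * a x + γ := by
    have := mul_lt_mul_of_pos_right hlam ha
    linarith
  have h := picone_of_pos hpq (u₁ := fun y => σ * u₁ y) (v₁ := fun y => σ * v₁ y)
    (u₂ := fun y => σ * u₂ y) (v₂ := fun y => σ * v₂ y) hc hs₁ hs₂
    (by simp only [phip_sign_mul q hσ]; exact (h₁.deriv_u x hx).const_mul σ)
    (by rw [← hγ _ _ hs₁, ← mul_neg]; exact (h₁.deriv_v x hx).const_mul σ)
    (by simp only [phip_sign_mul q hσ]; exact (h₂.deriv_u x hx).const_mul σ)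
    (by rw [← hγ _ _ hs₂, ← mul_neg]; exact (h₂.deriv_v x hx).const_mul σ)
  have e : (fun y => u₁ y * v₁ y - u₁ y * phip p (u₁ y / u₂ y) * v₂ y) =
      fun y => σ * u₁ y * (σ * v₁ y) - σ * u₁ y * phip p (σ * u₁ y / (σ * u₂ y)) * (σ * v₂ y) := by
    funext y
    rcases hσ with rfl | rfl
    · simp only [one_mul]
    · rw [neg_one_mul, neg_one_mul, neg_one_mul, neg_one_mul, neg_div_neg_eq]; ring
  rw [e]
  exact h

lemma pos_of_deriv_pos_of_tendsto {φ : ℝ → ℝ} {x z : ℝ}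
    (hd : ∀ y ∈ Ioo x z, ∃ d > 0, HasDerivAt φ d y) (ht : Tendsto φ (𝓝[>] x) (𝓝 0)) {y : ℝ}
    (hy : y ∈ Ioo x z) : 0 < φ y := by
  choose! d hd0 hd using hd
  have hm : StrictMonoOn φ (Ioo x z) := by
    refine strictMonoOn_of_deriv_pos (convex_Ioo x z)
      (fun w hw => (hd w hw).continuousAt.continuousWithinAt) fun w hw => ?_
    rw [interior_Ioo] at hw
    rw [(hd w hw).deriv]
    exact hd0 w hw
  obtain ⟨m, hm1, hm2⟩ := exists_between hy.1
  have hmz : m ∈ Ioo x z := ⟨hm1, hm2.trans hy.2⟩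
  have h0 : 0 ≤ φ m := by
    refine le_of_tendsto ht ?_
    filter_upwards [Ioo_mem_nhdsGT hm1] with w hw
    exact (hm ⟨hw.1, hw.2.trans hmz.2⟩ hmz hw.2).le
  exact h0.trans_lt (hm hmz hy hm2)

lemma neg_of_deriv_pos_of_tendsto {φ : ℝ → ℝ} {x z : ℝ}
    (hd : ∀ y ∈ Ioo z x, ∃ d > 0, HasDerivAt φ d y) (ht : Tendsto φ (𝓝[<] x) (𝓝 0)) {y : ℝ}
    (hy : y ∈ Ioo z x) : φ y < 0 := by
  choose! d hd0 hd using hd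
  have hm : StrictMonoOn φ (Ioo z x) := by
    refine strictMonoOn_of_deriv_pos (convex_Ioo z x)
      (fun w hw => (hd w hw).continuousAt.continuousWithinAt) fun w hw => ?_
    rw [interior_Ioo] at hw
    rw [(hd w hw).deriv]
    exact hd0 w hw
  obtain ⟨m, hm1, hm2⟩ := exists_between hy.2
  have hmz : m ∈ Ioo z x := ⟨hy.1.trans hm1, hm2⟩
  have h0 : φ m ≤ 0 := by
    refine ge_of_tendsto ht ?_
    filter_upwards [Ioo_mem_nhdsLT hm2] with w hw
    exact (hm hmz ⟨hmz.1.trans hw.1, hw.2⟩ hw.1).le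
  exact (hm hy hmz hm1).trans_le h0

/-- Two half-linear solutions with proportional data at `x` have a common sign on either side
of `x`, and the quotient of them has a limit at `x`. -/
lemma exists_local_sign (hp : 1 < p) {u₁ v₁ u₂ v₂ : ℝ → ℝ} {f₁ f₂ : ℝ → ℝ → ℝ}
    {ν₁ ν₂ x t : ℝ} (hq : 1 < q)
    (h₁ : IsIVP (phip q) f₁ ν₁ u₁ v₁) (h₂ : IsIVP (phip q) f₂ ν₂ u₂ v₂)
    (hx : x ∈ Icc (0 : ℝ) 1) (ht : 0 < t) (hv : v₂ x = t * v₁ x)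
    (hu : phip p (u₂ x) = t * phip p (u₁ x)) (hne : v₁ x = 0 → u₁ x ≠ 0) :
    (∃ σ, (σ = 1 ∨ σ = -1) ∧ ∀ᶠ y in 𝓝[>] x, 0 < σ * u₁ y ∧ 0 < σ * u₂ y) ∧
    (∃ σ, (σ = 1 ∨ σ = -1) ∧ ∀ᶠ y in 𝓝[<] x, 0 < σ * u₁ y ∧ 0 < σ * u₂ y) ∧
    Tendsto (fun y => u₁ y * v₁ y - u₁ y * phip p (u₁ y / u₂ y) * v₂ y) (𝓝[≠] x) (𝓝 0) := by
  have hcu₁ := (h₁.deriv_u x hx).continuousAt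
  have hcu₂ := (h₂.deriv_u x hx).continuousAt
  have hcv₁ := (h₁.deriv_v x hx).continuousAt
  have hcv₂ := (h₂.deriv_v x hx).continuousAt
  have hP : ∀ r, Tendsto (fun y => u₁ y / u₂ y) (𝓝[≠] x) (𝓝 r) →
      u₁ x * v₁ x - u₁ x * phip p r * v₂ x = 0 →
      Tendsto (fun y => u₁ y * v₁ y - u₁ y * phip p (u₁ y / u₂ y) * v₂ y) (𝓝[≠] x) (𝓝 0) := by
    intro r hr h0
    have hr' := ((phip_continuous hp).tendsto r).comp hr
    have hle : 𝓝[≠] x ≤ 𝓝 x := nhdsWithin_le_nhds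
    rw [← h0]
    exact ((hcu₁.tendsto.mono_left hle).mul (hcv₁.tendsto.mono_left hle)).sub
      (((hcu₁.tendsto.mono_left hle).mul hr').mul (hcv₂.tendsto.mono_left hle))
  have hsign : ∀ s : ℝ, s ≠ 0 → ∃ σ : ℝ, (σ = 1 ∨ σ = -1) ∧ 0 < σ * s := by
    intro s hs
    rcases lt_or_gt_of_ne hs with h | h
    · exact ⟨-1, Or.inr rfl, by linarith⟩
    · exact ⟨1, Or.inl rfl, by linarith⟩
  by_cases hu0 : u₁ x = 0
  · have hu0' : u₂ x = 0 := by
      rw [hu0, phip_zero, mul_zero] at hu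
      exact (phip_eq_zero_iff hp).1 hu
    have hv0 : v₁ x ≠ 0 := fun h => hne h hu0
    obtain ⟨σ, hσ, hσv⟩ := hsign _ hv0
    have hσv' : 0 < σ * v₂ x := by
      rw [hv]; have := mul_pos ht hσv; linarith
    have e₁ := eventually_sign_of_hasDerivAt_pos ((h₁.deriv_u x hx).const_mul σ)
      (by rw [← phip_sign_mul q hσ]; exact (phip_pos_iff hq).2 hσv) (by rw [hu0, mul_zero])
    have e₂ := eventually_sign_of_hasDerivAt_pos ((h₂.deriv_u x hx).const_mul σ)
      (by rw [← phip_sign_mul q hσ]; exact (phip_pos_iff hq).2 hσv') (by rw [hu0', mul_zero])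
    refine ⟨⟨σ, hσ, e₁.1.and e₂.1⟩, ⟨-σ, ?_, ?_⟩, ?_⟩
    · rcases hσ with rfl | rfl
      · exact Or.inr rfl
      · exact Or.inl (neg_neg 1)
    · filter_upwards [e₁.2, e₂.2] with y h1 h2
      constructor <;> linarith
    · refine hP (phip q (v₁ x) / phip q (v₂ x)) ?_ (by rw [hu0]; ring)
      have s₁ := hasDerivAt_iff_tendsto_slope.1 (h₁.deriv_u x hx)
      have s₂ := hasDerivAt_iff_tendsto_slope.1 (h₂.deriv_u x hx)
      have hw : phip q (v₂ x) ≠ 0 := fun h => by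
        rw [phip_eq_zero_iff hq] at h
        rw [h, mul_zero] at hσv'
        exact lt_irrefl _ hσv'
      refine (s₁.div s₂ hw).congr' ?_
      filter_upwards [self_mem_nhdsWithin] with y hy
      have hyx : y - x ≠ 0 := sub_ne_zero.2 hy
      simp only [Pi.div_apply]
      rw [slope_def_field, slope_def_field, hu0, hu0', sub_zero, sub_zero,
        div_div_div_cancel_right₀ hyx]
  · obtain ⟨σ, hσ, hσu⟩ := hsign _ hu0
    have hσu' : 0 < σ * u₂ x := by
      rw [← phip_pos_iff hp, phip_sign_mul p hσ, hu]
      have := (phip_pos_iff hp).2 hσu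
      rw [phip_sign_mul p hσ] at this
      have := mul_pos ht this
      linarith
    have hev : ∀ᶠ y in 𝓝 x, 0 < σ * u₁ y ∧ 0 < σ * u₂ y :=
      ((hcu₁.const_mul σ).eventually (lt_mem_nhds hσu)).and
        ((hcu₂.const_mul σ).eventually (lt_mem_nhds hσu'))
    have hu2 : u₂ x ≠ 0 := fun h => by rw [h, mul_zero] at hσu'; exact lt_irrefl _ hσu'
    refine ⟨⟨σ, hσ, hev.filter_mono nhdsWithin_le_nhds⟩,
      ⟨σ, hσ, hev.filter_mono nhdsWithin_le_nhds⟩, ?_⟩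
    refine hP (u₁ x / u₂ x) ((hcu₁.div hcu₂ hu2).tendsto.mono_left nhdsWithin_le_nhds) ?_
    have hk : phip p (u₁ x / u₂ x) * phip p (u₂ x) = phip p (u₁ x) := by
      rw [← phip_mul, div_mul_cancel₀ _ hu2]
    have h1 : phip p (u₁ x) ≠ 0 := fun h => hu0 ((phip_eq_zero_iff hp).1 h)
    have hk' : phip p (u₁ x / u₂ x) * t = 1 := by
      rw [hu] at hk
      have : (phip p (u₁ x / u₂ x) * t - 1) * phip p (u₁ x) = 0 := by linarith
      have := (mul_eq_zero.1 this).resolve_right h1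
      linarith
    rw [hv]
    linear_combination (-(u₁ x * v₁ x)) * hk'

/-- Sturm comparison: the angle at `1` is strictly increasing in the spectral parameter. -/
theorem angle_lt_angle (hpq : p.HolderConjugate q) (hν : ν = 1 ∨ ν = -1) {a α β : ℝ → ℝ}
    (ha : ∀ x ∈ Icc (0 : ℝ) 1, 0 < a x) {lam₁ lam₂ : ℝ} (hlam : lam₁ < lam₂)
    {u₁ v₁ u₂ v₂ θ₁ θ₂ : ℝ → ℝ}
    (h₁ : IsIVP (phip q) (halfRHS p a α β lam₁) ν u₁ v₁)
    (h₂ : IsIVP (phip q) (halfRHS p a α β lam₂) ν u₂ v₂)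
    (hθ₁ : IsAngle (fun x => ν * v₁ x) (fun x => ν * phip p (u₁ x)) θ₁)
    (hθ₂ : IsAngle (fun x => ν * v₂ x) (fun x => ν * phip p (u₂ x)) θ₂) : θ₁ 1 < θ₂ 1 := by
  have hp := hpq.lt
  have hν2 : ν * ν = 1 := by rcases hν with rfl | rfl <;> norm_num
  have hcont : ContinuousOn (fun x => θ₂ x - θ₁ x) (Icc 0 1) := hθ₂.1.sub hθ₁.1
  have hsin : ∀ y ∈ Icc (0 : ℝ) 1, ∃ r > 0,
      phip p (u₂ y) * v₁ y - phip p (u₁ y) * v₂ y = r * Real.sin (θ₂ y - θ₁ y) := by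
    intro y hy
    obtain ⟨r₁, hr₁, e1, e2⟩ := hθ₁.2.2 y hy
    obtain ⟨r₂, hr₂, e3, e4⟩ := hθ₂.2.2 y hy
    simp only at e1 e2 e3 e4
    refine ⟨r₁ * r₂, mul_pos hr₁ hr₂, ?_⟩
    rw [Real.sin_sub]
    have : phip p (u₂ y) * v₁ y - phip p (u₁ y) * v₂ y =
        (ν * phip p (u₂ y)) * (ν * v₁ y) - (ν * phip p (u₁ y)) * (ν * v₂ y) := by
      linear_combination (-(phip p (u₂ y) * v₁ y - phip p (u₁ y) * v₂ y)) * hν2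
    rw [this, e1, e2, e3, e4]; ring
  have hrel : ∀ y σ : ℝ, (σ = 1 ∨ σ = -1) → 0 < σ * u₁ y → 0 < σ * u₂ y →
      ∃ r > 0, phip p (u₂ y) * v₁ y - phip p (u₁ y) * v₂ y =
        r * (u₁ y * v₁ y - u₁ y * phip p (u₁ y / u₂ y) * v₂ y) := by
    intro y σ hσ s₁ s₂
    have hσ2 : σ * σ = 1 := by rcases hσ with rfl | rfl <;> norm_num
    have hu2 : u₂ y ≠ 0 := fun h => by rw [h, mul_zero] at s₂; exact lt_irrefl _ s₂
    have hu1 : u₁ y ≠ 0 := fun h => by rw [h, mul_zero] at s₁; exact lt_irrefl _ s₁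
    refine ⟨(σ * phip p (u₂ y)) / (σ * u₁ y), div_pos ?_ s₁, ?_⟩
    · rw [← phip_sign_mul p hσ]; exact (phip_pos_iff hp).2 s₂
    · have hk : phip p (u₁ y / u₂ y) * phip p (u₂ y) = phip p (u₁ y) := by
        rw [← phip_mul, div_mul_cancel₀ _ hu2]
      have hσ0 : σ ≠ 0 := fun h => by rw [h, zero_mul] at s₁; exact lt_irrefl _ s₁
      rw [← hk]
      field_simp
  have hmain := pos_of_upcrossing (f := fun x => θ₂ x - θ₁ x) hcont ?_ le_rfl
    (by rw [hθ₁.2.1, hθ₂.2.1, sub_zero]) zero_lt_one le_rfl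
  · exact sub_pos.1 hmain
  intro x hx h0
  obtain ⟨r₁, hr₁, e1, e2⟩ := hθ₁.2.2 x hx
  obtain ⟨r₂, hr₂, e3, e4⟩ := hθ₂.2.2 x hx
  rw [sub_eq_zero.1 h0] at e3 e4
  have hmulν : ∀ y : ℝ, ν * (ν * y) = y := fun y => by rw [← mul_assoc, hν2, one_mul]
  have hv : v₂ x = r₂ / r₁ * v₁ x := by
    rw [← hmulν (v₂ x), ← hmulν (v₁ x)]
    simp only at e1 e3
    rw [e1, e3]; field_simp
  have hu : phip p (u₂ x) = r₂ / r₁ * phip p (u₁ x) := by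
    rw [← hmulν (phip p (u₂ x)), ← hmulν (phip p (u₁ x))]
    simp only at e2 e4
    rw [e2, e4]; field_simp
  have hne : v₁ x = 0 → u₁ x ≠ 0 := by
    intro hv0 hu0
    have := hθ₁.sq_add_sq_pos hx
    simp only [hv0, hu0, phip_zero, mul_zero, add_zero] at this
    exact lt_irrefl _ this
  obtain ⟨⟨σ, hσ, hr⟩, ⟨τ, hτ, hl⟩, hP⟩ := exists_local_sign hp hpq.symm.lt h₁ h₂ hx
    (div_pos hr₂ hr₁) hv hu hne
  constructor
  · intro hx1
    refine eventually_pos_right_of_sin hcont hx h0 hx1 ?_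
    obtain ⟨z, hxz, hz⟩ := mem_nhdsGT_iff_exists_Ioo_subset.1
      (hr.and (Ioo_mem_nhdsGT hx1))
    filter_upwards [Ioo_mem_nhdsGT hxz] with y hy
    have hI : ∀ w ∈ Ioo x z, w ∈ Icc (0 : ℝ) 1 := fun w hw =>
      ⟨by linarith [hx.1, hw.1], (hz hw).2.2.le⟩
    have hpos := pos_of_deriv_pos_of_tendsto (fun w hw => picone hpq hlam h₁ h₂ (hI w hw)
      (ha w (hI w hw)) hσ (hz hw).1.1 (hz hw).1.2)
      (hP.mono_left (nhdsWithin_mono _ fun w (hw : x < w) => hw.ne')) hy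
    obtain ⟨r, hr0, er⟩ := hrel y σ hσ (hz hy).1.1 (hz hy).1.2
    obtain ⟨s, hs0, es⟩ := hsin y (hI y hy)
    have := mul_pos hr0 hpos
    rw [← er, es] at this
    exact (pos_iff_pos_of_mul_pos this).1 hs0
  · intro hx1
    refine eventually_neg_left_of_sin hcont hx h0 hx1 ?_
    obtain ⟨z, hxz, hz⟩ := mem_nhdsLT_iff_exists_Ioo_subset.1
      (hl.and (Ioo_mem_nhdsLT hx1))
    filter_upwards [Ioo_mem_nhdsLT hxz] with y hy
    have hI : ∀ w ∈ Ioo z x, w ∈ Icc (0 : ℝ) 1 := fun w hw =>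
      ⟨(hz hw).2.1.le, by linarith [hx.2, hw.2]⟩
    have hneg := neg_of_deriv_pos_of_tendsto (fun w hw => picone hpq hlam h₁ h₂ (hI w hw)
      (ha w (hI w hw)) hτ (hz hw).1.1 (hz hw).1.2)
      (hP.mono_left (nhdsWithin_mono _ fun w (hw : w < x) => hw.ne)) hy
    obtain ⟨r, hr0, er⟩ := hrel y τ hτ (hz hy).1.1 (hz hy).1.2
    obtain ⟨s, hs0, es⟩ := hsin y (hI y hy)
    have := mul_neg_of_pos_of_neg hr0 hneg
    rw [← er, es] at this
    exact neg_of_mul_neg_right this hs0.le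

end Comparison

section Counting

variable {p q : ℝ} {b : ℝ → ℝ} {f : ℝ → ℝ → ℝ} {ν : ℝ} {u v θ : ℝ → ℝ}

lemma IsIVP.angle_pos_of_level (hp : 1 < p) (hν : ν = 1 ∨ ν = -1) (h : IsIVP b f ν u v)
    (hb : ∀ x ∈ Icc (0 : ℝ) 1, v x ≠ 0 → 0 < b (v x) * v x)
    (hθ : IsAngle (fun x => ν * v x) (fun x => ν * phip p (u x)) θ) {m : ℤ} {x y : ℝ}
    (hx : 0 ≤ x) (h0 : θ x = m * Real.pi) (hxy : x < y) (hy : y ≤ 1) : m * Real.pi < θ y := by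
  have := pos_of_upcrossing (f := fun x => θ x - m * Real.pi) (hθ.1.sub continuousOn_const)
    (fun z hz hz0 => h.angle_upcrossing hp hν hb hθ m hz hz0) hx (sub_eq_zero.2 h0) hxy hy
  exact sub_pos.1 this

lemma IsAngle.eq_zero_iff (hp : 1 < p) (hν : ν = 1 ∨ ν = -1)
    (hθ : IsAngle (fun x => ν * v x) (fun x => ν * phip p (u x)) θ) {x : ℝ}
    (hx : x ∈ Icc (0 : ℝ) 1) : u x = 0 ↔ ∃ m : ℤ, m * Real.pi = θ x := by
  obtain ⟨r, hr, -, e⟩ := hθ.2.2 x hx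
  simp only at e
  have hν0 : ν ≠ 0 := by rcases hν with rfl | rfl <;> norm_num
  rw [← Real.sin_eq_zero_iff, ← phip_eq_zero_iff hp]
  constructor
  · intro h
    rw [h, mul_zero] at e
    exact (mul_eq_zero.1 e.symm).resolve_left hr.ne'
  · intro h
    rw [h, mul_zero] at e
    exact (mul_eq_zero.1 e).resolve_left hν0

/-- The zeros of `u` in `(0,1)` are counted by the angle at `1`. -/
lemma IsIVP.ncard_zeros (hp : 1 < p) (hν : ν = 1 ∨ ν = -1) (h : IsIVP b f ν u v)
    (hb : ∀ x ∈ Icc (0 : ℝ) 1, v x ≠ 0 → 0 < b (v x) * v x)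
    (hθ : IsAngle (fun x => ν * v x) (fun x => ν * phip p (u x)) θ) {k : ℕ} (hk : 1 ≤ k)
    (h1 : θ 1 = k * Real.pi) :
    {x ∈ Ioo (0 : ℝ) 1 | u x = 0}.Finite ∧ {x ∈ Ioo (0 : ℝ) 1 | u x = 0}.ncard = k - 1 := by
  set Z := {x ∈ Ioo (0 : ℝ) 1 | u x = 0} with hZ
  have hpi := Real.pi_pos
  have hlevel := fun (m : ℤ) (x y : ℝ) =>
    h.angle_pos_of_level hp hν hb hθ (m := m) (x := x) (y := y)
  have hZm : ∀ x ∈ Z, ∃ m : ℕ, m ∈ Finset.Icc 1 (k - 1) ∧ θ x = m * Real.pi := by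
    rintro x ⟨hx, hx0⟩
    obtain ⟨m, hm⟩ := (hθ.eq_zero_iff hp hν ⟨hx.1.le, hx.2.le⟩).1 hx0
    have hpos := hlevel 0 0 x le_rfl (by rw [hθ.2.1]; simp) hx.1 hx.2.le
    rw [Int.cast_zero, zero_mul, ← hm] at hpos
    have hm0 : (0 : ℝ) < m := (pos_iff_pos_of_mul_pos hpos).2 hpi
    have hlt := hlevel m x 1 hx.1.le hm.symm hx.2 le_rfl
    rw [h1] at hlt
    have hmk : (m : ℝ) < k := lt_of_mul_lt_mul_right hlt hpi.le
    have hm0' : 0 < m := by exact_mod_cast hm0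
    have hmk' : m < k := by exact_mod_cast hmk
    obtain ⟨n, rfl⟩ := Int.eq_ofNat_of_zero_le hm0'.le
    refine ⟨n, Finset.mem_Icc.2 ⟨by omega, by omega⟩, ?_⟩
    rw [← hm]; simp
  have hinj : InjOn θ Z := by
    intro x hx y hy hxy
    obtain ⟨m, -, hm⟩ := hZm x hx
    by_contra hne
    rcases lt_or_gt_of_ne hne with hlt | hlt
    · have := hlevel m x y hx.1.1.le (by rw [hm]; simp) hlt hy.1.2.le
      rw [← hxy, hm] at this
      simp at this
    · have := hlevel m y x hy.1.1.le (by rw [← hxy, hm]; simp) hlt hx.1.2.le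
      rw [hm] at this
      simp at this
  have himg : θ '' Z = (fun m : ℕ => (m : ℝ) * Real.pi) '' (Finset.Icc 1 (k - 1) : Finset ℕ) := by
    ext t
    constructor
    · rintro ⟨x, hx, rfl⟩
      obtain ⟨m, hm, e⟩ := hZm x hx
      exact ⟨m, hm, e.symm⟩
    · rintro ⟨m, hm, rfl⟩
      rw [Finset.mem_coe, Finset.mem_Icc] at hm
      have hm0 : (0 : ℝ) < m := by exact_mod_cast hm.1
      have hmk : (m : ℝ) < k := by exact_mod_cast (by omega : m < k)
      have hmem : (m : ℝ) * Real.pi ∈ Icc (θ 0) (θ 1) := by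
        rw [hθ.2.1, h1]
        exact ⟨by positivity, mul_le_mul_of_nonneg_right hmk.le hpi.le⟩
      obtain ⟨x, hx, e⟩ := intermediate_value_Icc zero_le_one hθ.1 hmem
      refine ⟨x, ⟨⟨lt_of_le_of_ne hx.1 ?_, lt_of_le_of_ne hx.2 ?_⟩, ?_⟩, e⟩
      · rintro rfl
        rw [hθ.2.1] at e
        have : 0 < (m : ℝ) * Real.pi := by positivity
        linarith
      · rintro rfl
        rw [h1] at e
        exact hmk.ne' (mul_right_cancel₀ hpi.ne' e)
      · exact (hθ.eq_zero_iff hp hν hx).2 ⟨m, by rw [e]; simp⟩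
  have hinj2 : Function.Injective fun m : ℕ => (m : ℝ) * Real.pi := by
    intro m n hmn
    have := mul_right_cancel₀ hpi.ne' hmn
    exact_mod_cast this
  constructor
  · refine Set.Finite.of_finite_image ?_ hinj
    rw [himg]
    exact (Finset.finite_toSet _).image _
  · rw [← hinj.ncard_image, himg, ncard_image_of_injective _ hinj2, ncard_coe_finset,
      Nat.card_Icc]
    omega

lemma IsIVP.angle_one_eq (hp : 1 < p) (hν : ν = 1 ∨ ν = -1) (h : IsIVP b f ν u v)
    (hb : ∀ x ∈ Icc (0 : ℝ) 1, v x ≠ 0 → 0 < b (v x) * v x)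
    (hθ : IsAngle (fun x => ν * v x) (fun x => ν * phip p (u x)) θ) {k : ℕ} (hk : 1 ≤ k)
    (h1 : u 1 = 0) (hc : {x ∈ Ioo (0 : ℝ) 1 | u x = 0}.ncard = k - 1) : θ 1 = k * Real.pi := by
  have hpi := Real.pi_pos
  obtain ⟨m, hm⟩ := (hθ.eq_zero_iff hp hν (x := 1) (by simp)).1 h1
  have hpos := h.angle_pos_of_level hp hν hb hθ (m := 0) le_rfl (by rw [hθ.2.1]; simp)
    zero_lt_one le_rfl
  rw [Int.cast_zero, zero_mul, ← hm] at hpos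
  have hm0 : (0 : ℝ) < m := (pos_iff_pos_of_mul_pos hpos).2 hpi
  have hm0' : 0 < m := by exact_mod_cast hm0
  obtain ⟨n, rfl⟩ := Int.eq_ofNat_of_zero_le hm0'.le
  have hn1 : 1 ≤ n := by omega
  have := (h.ncard_zeros hp hν hb hθ hn1 (by rw [← hm]; simp)).2
  rw [hc] at this
  have hkn : k = n := by omega
  rw [hkn, ← hm]; simp

end Counting

section Truncation

/-- Truncation of `s` to `[-t, t]`. -/
noncomputable def clamp (t s : ℝ) : ℝ := max (-t) (min t s)

lemma abs_clamp_le {t : ℝ} (ht : 0 ≤ t) (s : ℝ) : |clamp t s| ≤ t :=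
  abs_le.2 ⟨le_max_left _ _, max_le (by linarith) (min_le_left _ _)⟩

lemma clamp_eq {t s : ℝ} (h : |s| ≤ t) : clamp t s = s := by
  rw [abs_le] at h
  rw [clamp, min_eq_right h.2, max_eq_right h.1]

lemma abs_clamp_le_abs {t : ℝ} (ht : 0 ≤ t) (s : ℝ) : |clamp t s| ≤ |s| := by
  rcases le_total |s| t with h | h
  · rw [clamp_eq h]
  · exact (abs_clamp_le ht s).trans h

lemma clamp_clamp {t r : ℝ} (ht : 0 ≤ t) (htr : t ≤ r) (s : ℝ) :
    clamp t (clamp r s) = clamp t s := by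
  simp only [clamp]
  rcases le_total s (-r) with h | h
  · rw [min_eq_right (by linarith : s ≤ r), max_eq_left h, min_eq_right (by linarith),
      min_eq_right (by linarith), max_eq_left (by linarith), max_eq_left (by linarith)]
  · rcases le_total s r with h' | h'
    · rw [min_eq_right h', max_eq_right h]
    · rw [min_eq_left h', max_eq_right (by linarith : -r ≤ r), min_eq_left htr,
        min_eq_left (by linarith : t ≤ s)]

lemma Continuous.clamp {X : Type*} [TopologicalSpace X] {t s : X → ℝ} (ht : Continuous t)
    (hs : Continuous s) : Continuous fun x => clamp (t x) (s x) :=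
  ht.neg.max (ht.min hs)

variable {p q : ℝ} {a α β : ℝ → ℝ} {g : ℝ → ℝ → ℝ → ℝ}

/-- A continuous nonlinearity that agrees, after the normalisation `u ↦ u / d`, with the
right-hand side of the perturbed equation where `|lam| ≤ Λ` and `|d u| ≤ M min(x, 1 - x)`,
and that is half-linear for `d = 0`. -/
structure IsTruncation (p : ℝ) (a α β : ℝ → ℝ) (g : ℝ → ℝ → ℝ → ℝ) (Λ M C : ℝ)
    (G : (ℝ × ℝ) × ℝ × ℝ → ℝ) : Prop where
  continuous : Continuous G
  nonneg : 0 ≤ C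
  growth : ∀ π x s, |G (π, x, s)| ≤ C * |s| ^ (p - 1)
  half : ∀ lam, |lam| ≤ Λ → ∀ x ∈ Icc (0 : ℝ) 1, ∀ s,
    G ((lam, 0), x, s) = halfRHS p a α β lam x s
  pert : ∀ lam d, |lam| ≤ Λ → 0 < d → ∀ x ∈ Ioo (0 : ℝ) 1, ∀ s, |d * s| ≤ M * min x (1 - x) →
    phip p d * G ((lam, d), x, s) = halfRHS p a α β lam x (d * s) + g x (d * s) lam

lemma halfRHS_mul (p : ℝ) (a α β : ℝ → ℝ) {d : ℝ} (hd : 0 < d) (lam x s : ℝ) :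
    halfRHS p a α β lam x (d * s) = phip p d * halfRHS p a α β lam x s := by
  simp only [halfRHS]
  rw [phip_mul, phip_max_zero_of_pos p hd, phip_neg_min_zero_of_pos p hd]
  ring

lemma continuous_halfRHS (hp : 1 < p) (ha : Continuous a) (hα : Continuous α) (hβ : Continuous β) :
    Continuous fun z : ℝ × ℝ × ℝ => halfRHS p a α β z.1 z.2.1 z.2.2 := by
  have h := phip_continuous hp
  have h1 : Continuous fun z : ℝ × ℝ × ℝ => phip p z.2.2 := h.comp (by fun_prop)
  have h2 : Continuous fun z : ℝ × ℝ × ℝ => phip p (max z.2.2 0) := h.comp (by fun_prop)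
  have h3 : Continuous fun z : ℝ × ℝ × ℝ => phip p (-min z.2.2 0) := h.comp (by fun_prop)
  have h4 : Continuous fun z : ℝ × ℝ × ℝ => a z.2.1 := ha.comp (by fun_prop)
  have h5 : Continuous fun z : ℝ × ℝ × ℝ => α z.2.1 := hα.comp (by fun_prop)
  have h6 : Continuous fun z : ℝ × ℝ × ℝ => β z.2.1 := hβ.comp (by fun_prop)
  exact (((continuous_fst.mul h4).mul h1).add (h5.mul h2)).add (h6.mul h3)

lemma abs_halfRHS_le (hp : 1 < p) {A : ℝ} {x : ℝ} (ha : |a x| ≤ A) (hα : |α x| ≤ A)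
    (hβ : |β x| ≤ A) {lam Λ : ℝ} (hlam : |lam| ≤ Λ) (s : ℝ) :
    |halfRHS p a α β lam x s| ≤ (Λ * A + A + A) * |s| ^ (p - 1) := by
  have hA : 0 ≤ A := (abs_nonneg _).trans ha
  have hΛ : 0 ≤ Λ := (abs_nonneg _).trans hlam
  have hp1 : 0 ≤ p - 1 := by linarith
  have hs := Real.rpow_nonneg (abs_nonneg s) (p - 1)
  have h1 : |phip p (max s 0)| ≤ |s| ^ (p - 1) := by
    rw [abs_phip hp]
    refine Real.rpow_le_rpow (abs_nonneg _) ?_ hp1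
    rw [abs_of_nonneg (le_max_right _ _)]
    exact max_le (le_abs_self s) (abs_nonneg s)
  have h2 : |phip p (-min s 0)| ≤ |s| ^ (p - 1) := by
    rw [abs_phip hp, abs_neg]
    refine Real.rpow_le_rpow (abs_nonneg _) ?_ hp1
    rw [abs_of_nonpos (min_le_right _ _), ← max_neg_neg, neg_zero]
    exact max_le (neg_le_abs s) (abs_nonneg s)
  have e1 : |lam * a x * phip p s| ≤ Λ * A * |s| ^ (p - 1) := by
    rw [abs_mul, abs_mul, abs_phip hp]
    exact mul_le_mul_of_nonneg_right (mul_le_mul hlam ha (abs_nonneg _) hΛ) hs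
  have e2 : |α x * phip p (max s 0)| ≤ A * |s| ^ (p - 1) := by
    rw [abs_mul]; exact mul_le_mul hα h1 (abs_nonneg _) hA
  have e3 : |β x * phip p (-min s 0)| ≤ A * |s| ^ (p - 1) := by
    rw [abs_mul]; exact mul_le_mul hβ h2 (abs_nonneg _) hA
  calc |halfRHS p a α β lam x s|
      ≤ |lam * a x * phip p s| + |α x * phip p (max s 0)| + |β x * phip p (-min s 0)| := by
        rw [halfRHS]
        exact (abs_add_le _ _).trans (add_le_add_left (abs_add_le _ _) _)
    _ ≤ _ := by linarith

/-- Extension by constants of a continuous function on `[0,1]`, together with a bound. -/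
lemma exists_continuous_extension (ha : ContinuousOn a (Icc 0 1)) :
    ∃ a' : ℝ → ℝ, Continuous a' ∧ (∀ x ∈ Icc (0 : ℝ) 1, a' x = a x) ∧ ∃ A, ∀ x, |a' x| ≤ A := by
  have hmem : ∀ x : ℝ, max 0 (min 1 x) ∈ Icc (0 : ℝ) 1 := fun x =>
    ⟨le_max_left _ _, max_le zero_le_one (min_le_left _ _)⟩
  refine ⟨fun x => a (max 0 (min 1 x)), ha.comp_continuous (by fun_prop) hmem, fun x hx => ?_, ?_⟩
  · show a (max 0 (min 1 x)) = a x
    rw [min_eq_right hx.2, max_eq_right hx.1]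
  · obtain ⟨A, hA⟩ := isCompact_Icc.exists_bound_of_continuousOn ha
    exact ⟨A, fun x => hA _ (hmem x)⟩

/-- Truncation of the perturbation `g`. -/
noncomputable def truncPert (g : ℝ → ℝ → ℝ → ℝ) (Λ M x s lam : ℝ) : ℝ :=
  open Classical in
  if x ∈ Ioo (0 : ℝ) 1 then g x (clamp (M * min x (1 - x)) s) (clamp Λ lam) else 0

section Pert

variable {Λ M : ℝ}
  (hg : ContinuousOn (fun q : ℝ × ℝ × ℝ => g q.1 q.2.1 q.2.2)
    (Ioo (0 : ℝ) 1 ×ˢ (univ : Set (ℝ × ℝ))))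
  (hgo : ∀ C > (0 : ℝ), ∀ ε > (0 : ℝ), ∃ δ > (0 : ℝ), ∀ x ∈ Ioo (0 : ℝ) 1, ∀ s : ℝ,
    0 < |s| → |s| < δ → ∀ lam : ℝ, |lam| ≤ C → |g x s lam| ≤ ε * |phip p s|)

include hg hgo

lemma pert_zero (hp : 1 < p) {x : ℝ} (hx : x ∈ Ioo (0 : ℝ) 1) (lam : ℝ) : g x 0 lam = 0 := by
  obtain ⟨δ, hδ, h⟩ := hgo (|lam| + 1) (by positivity) 1 one_pos
  have hc : ContinuousAt (fun s : ℝ => g x s lam) 0 := by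
    have h1 : ContinuousAt (fun q : ℝ × ℝ × ℝ => g q.1 q.2.1 q.2.2) (x, 0, lam) :=
      hg.continuousAt (prod_mem_nhds (Ioo_mem_nhds hx.1 hx.2) univ_mem)
    have h2 : ContinuousAt (fun s : ℝ => ((x, s, lam) : ℝ × ℝ × ℝ)) 0 := by fun_prop
    exact ContinuousAt.comp (f := fun s : ℝ => ((x, s, lam) : ℝ × ℝ × ℝ)) h1 h2
  have h1 : Tendsto (fun s : ℝ => |g x s lam|) (𝓝[>] 0) (𝓝 |g x 0 lam|) :=
    (hc.tendsto.mono_left nhdsWithin_le_nhds).abs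
  have h2 : Tendsto (fun s : ℝ => 1 * |phip p s|) (𝓝[>] 0) (𝓝 0) := by
    have : Continuous fun s : ℝ => 1 * |phip p s| := continuous_const.mul (phip_continuous hp).abs
    have := (this.tendsto 0).mono_left (nhdsWithin_le_nhds (s := Ioi 0))
    simpa [phip_zero] using this
  have h3 : |g x 0 lam| ≤ 0 := by
    refine le_of_tendsto_of_tendsto h1 h2 ?_
    filter_upwards [Ioo_mem_nhdsGT hδ] with s hs
    exact h x hx s (abs_pos.2 hs.1.ne') (by rw [abs_of_pos hs.1]; exact hs.2) lam (by linarith)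
  exact abs_nonpos_iff.1 h3

lemma exists_truncPert_small (hp : 1 < p) (hΛ : 0 < Λ) {ε : ℝ} (hε : 0 < ε) :
    ∃ δ > 0, ∀ x s lam, |clamp (M * min x (1 - x)) s| < δ →
      |truncPert g Λ M x s lam| ≤ ε * |clamp (M * min x (1 - x)) s| ^ (p - 1) := by
  obtain ⟨δ, hδ, h⟩ := hgo Λ hΛ ε hε
  refine ⟨δ, hδ, fun x s lam hs => ?_⟩
  rw [truncPert]
  split_ifs with hx
  · rcases eq_or_ne (clamp (M * min x (1 - x)) s) 0 with h0 | h0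
    · rw [h0, pert_zero hg hgo hp hx, abs_zero, Real.zero_rpow (by linarith), mul_zero]
    · rw [← abs_phip hp]
      exact h x hx _ (abs_pos.2 h0) hs _ (abs_clamp_le hΛ.le _)
  · rw [abs_zero]
    exact mul_nonneg hε.le (Real.rpow_nonneg (abs_nonneg _) _)

lemma continuous_truncPert (hp : 1 < p) (hΛ : 0 < Λ) (hM : 0 ≤ M) :
    Continuous fun z : ℝ × ℝ × ℝ => truncPert g Λ M z.1 z.2.1 z.2.2 := by
  rw [continuous_iff_continuousAt]
  intro z
  by_cases hz : z.1 ∈ Ioo (0 : ℝ) 1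
  · have h1 : ContinuousAt (fun q : ℝ × ℝ × ℝ => g q.1 q.2.1 q.2.2)
        (z.1, clamp (M * min z.1 (1 - z.1)) z.2.1, clamp Λ z.2.2) :=
      hg.continuousAt (prod_mem_nhds (Ioo_mem_nhds hz.1 hz.2) univ_mem)
    have h2 : Continuous fun z : ℝ × ℝ × ℝ =>
        ((z.1, clamp (M * min z.1 (1 - z.1)) z.2.1, clamp Λ z.2.2) : ℝ × ℝ × ℝ) :=
      continuous_fst.prodMk ((Continuous.clamp (by fun_prop) (by fun_prop)).prodMk
        (Continuous.clamp (by fun_prop) (by fun_prop)))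
    have h3 := ContinuousAt.comp (f := fun z : ℝ × ℝ × ℝ =>
        ((z.1, clamp (M * min z.1 (1 - z.1)) z.2.1, clamp Λ z.2.2) : ℝ × ℝ × ℝ)) h1 h2.continuousAt
    refine h3.congr ?_
    filter_upwards [continuous_fst.continuousAt.preimage_mem_nhds (Ioo_mem_nhds hz.1 hz.2)]
      with y hy
    simp only [Function.comp, truncPert]
    rw [if_pos (show y.1 ∈ Ioo (0 : ℝ) 1 from hy)]
  · have hz0 : truncPert g Λ M z.1 z.2.1 z.2.2 = 0 := by rw [truncPert, if_neg hz]
    have hmin : max 0 (min z.1 (1 - z.1)) = 0 := by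
      refine max_eq_left ?_
      rcases le_or_gt z.1 0 with h | h
      · exact (min_le_left _ _).trans h
      · have : 1 ≤ z.1 := by by_contra! h'; exact hz ⟨h, h'⟩
        exact (min_le_right _ _).trans (by linarith)
    obtain ⟨δ, hδ, hsmall⟩ := exists_truncPert_small hg hgo (Λ := Λ) (M := M) hp hΛ one_pos
    have hcont : Continuous fun y : ℝ × ℝ × ℝ => M * max 0 (min y.1 (1 - y.1)) := by fun_prop
    have ht : Tendsto (fun y : ℝ × ℝ × ℝ => M * max 0 (min y.1 (1 - y.1))) (𝓝 z) (𝓝 0) := by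
      have := hcont.tendsto z
      rwa [hmin, mul_zero] at this
    have ht2 : Tendsto (fun y : ℝ × ℝ × ℝ => (M * max 0 (min y.1 (1 - y.1))) ^ (p - 1))
        (𝓝 z) (𝓝 0) := by
      have := ht.rpow_const (p := p - 1) (Or.inr (by linarith))
      rwa [Real.zero_rpow (by linarith)] at this
    rw [ContinuousAt, hz0]
    refine squeeze_zero_norm' ?_ ht2
    filter_upwards [ht.eventually (gt_mem_nhds hδ)] with y hy
    rw [Real.norm_eq_abs]
    by_cases hyI : y.1 ∈ Ioo (0 : ℝ) 1
    · have hpos : 0 ≤ min y.1 (1 - y.1) := le_min hyI.1.le (by linarith [hyI.2])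
      have hle : |clamp (M * min y.1 (1 - y.1)) y.2.1| ≤ M * max 0 (min y.1 (1 - y.1)) := by
        rw [max_eq_right hpos]
        exact abs_clamp_le (mul_nonneg hM hpos) _
      refine (hsmall _ _ _ (hle.trans_lt hy)).trans ?_
      rw [one_mul]
      exact Real.rpow_le_rpow (abs_nonneg _) hle (by linarith)
    · rw [truncPert, if_neg hyI, abs_zero]
      exact Real.rpow_nonneg (mul_nonneg hM (le_max_left _ _)) _

lemma exists_truncPert_le (hp : 1 < p) (hΛ : 0 < Λ) (hM : 0 ≤ M) :
    ∃ C, 0 ≤ C ∧ ∀ x s lam, |truncPert g Λ M x s lam| ≤ C * |s| ^ (p - 1) := by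
  obtain ⟨δ, hδ, hsmall⟩ := exists_truncPert_small hg hgo (Λ := Λ) (M := M) hp hΛ one_pos
  have hK : IsCompact (Icc (0 : ℝ) 1 ×ˢ Icc (-M) M ×ˢ Icc (-Λ) Λ) :=
    isCompact_Icc.prod (isCompact_Icc.prod isCompact_Icc)
  obtain ⟨B, hB⟩ := hK.exists_bound_of_continuousOn
    (continuous_truncPert hg hgo hp hΛ hM).continuousOn
  have hB0 : 0 ≤ B := (norm_nonneg _).trans (hB (0, 0, 0) (by simp [hM, hΛ.le]))
  have hδp := Real.rpow_pos_of_pos hδ (p - 1)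
  have hp1 : 0 ≤ p - 1 := by linarith
  refine ⟨1 + B / δ ^ (p - 1), by positivity, fun x s lam => ?_⟩
  have hs := Real.rpow_nonneg (abs_nonneg s) (p - 1)
  have hC1 : 0 ≤ B / δ ^ (p - 1) * |s| ^ (p - 1) := by positivity
  by_cases hx : x ∈ Ioo (0 : ℝ) 1
  · have hpos : 0 ≤ min x (1 - x) := le_min hx.1.le (by linarith [hx.2])
    have hτ : 0 ≤ M * min x (1 - x) := mul_nonneg hM hpos
    have hτM : M * min x (1 - x) ≤ M := by
      have : min x (1 - x) ≤ 1 := (min_le_left _ _).trans hx.2.le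
      nlinarith
    have hcs := abs_clamp_le_abs hτ s
    rcases lt_or_ge |clamp (M * min x (1 - x)) s| δ with h | h
    · refine (hsmall x s lam h).trans ?_
      have := Real.rpow_le_rpow (abs_nonneg _) hcs hp1
      linarith
    · have h1 : |truncPert g Λ M x s lam| ≤ B := by
        have e : truncPert g Λ M x s lam = truncPert g Λ M x (clamp M s) (clamp Λ lam) := by
          rw [truncPert, truncPert, if_pos hx, if_pos hx, clamp_clamp hτ hτM,
            clamp_clamp hΛ.le le_rfl]
        rw [e]
        exact hB (x, clamp M s, clamp Λ lam) ⟨⟨hx.1.le, hx.2.le⟩, abs_le.1 (abs_clamp_le hM _),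
          abs_le.1 (abs_clamp_le hΛ.le _)⟩
      have h2 : δ ^ (p - 1) ≤ |s| ^ (p - 1) := Real.rpow_le_rpow hδ.le (h.trans hcs) hp1
      have h3 : B ≤ B / δ ^ (p - 1) * |s| ^ (p - 1) := by
        rw [div_mul_eq_mul_div, le_div_iff₀ hδp]
        exact mul_le_mul_of_nonneg_left h2 hB0
      linarith
  · rw [truncPert, if_neg hx, abs_zero]
    linarith

theorem exists_isTruncation (hp : 1 < p) (ha : ContinuousOn a (Icc 0 1))
    (hα : ContinuousOn α (Icc 0 1)) (hβ : ContinuousOn β (Icc 0 1)) (hΛ : 0 < Λ) (hM : 0 ≤ M) :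
    ∃ C G, IsTruncation p a α β g Λ M C G := by
  obtain ⟨a', hac, hae, A₁, hA₁⟩ := exists_continuous_extension ha
  obtain ⟨α', hαc, hαe, A₂, hA₂⟩ := exists_continuous_extension hα
  obtain ⟨β', hβc, hβe, A₃, hA₃⟩ := exists_continuous_extension hβ
  obtain ⟨C₀, hC₀, hgC⟩ := exists_truncPert_le hg hgo (Λ := Λ) (M := M) hp hΛ hM
  set A := max A₁ (max A₂ A₃)
  have hA0 : 0 ≤ A := (abs_nonneg _).trans ((hA₁ 0).trans (le_max_left _ _))
  have hp1 : 0 < p - 1 := by linarith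
  have hgcont := continuous_truncPert hg hgo (Λ := Λ) (M := M) hp hΛ hM
  have hH := continuous_halfRHS hp hac hαc hβc
  have hhalf : ∀ lam x s, x ∈ Icc (0 : ℝ) 1 →
      halfRHS p a' α' β' lam x s = halfRHS p a α β lam x s := fun lam x s hx => by
    rw [halfRHS, halfRHS, hae x hx, hαe x hx, hβe x hx]
  have hbound : ∀ lam d x s : ℝ,
      |truncPert g Λ M x (|d| * s) lam / |d| ^ (p - 1)| ≤ C₀ * |s| ^ (p - 1) := by
    intro lam d x s
    rcases eq_or_ne d 0 with rfl | hd
    · rw [abs_zero, Real.zero_rpow hp1.ne', div_zero, abs_zero]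
      exact mul_nonneg hC₀ (Real.rpow_nonneg (abs_nonneg _) _)
    · have hdp := Real.rpow_pos_of_pos (abs_pos.2 hd) (p - 1)
      rw [abs_div, abs_of_pos hdp, div_le_iff₀ hdp]
      refine (hgC _ _ _).trans_eq ?_
      rw [abs_mul, abs_abs, Real.mul_rpow (abs_nonneg _) (abs_nonneg _)]
      ring
  have hquot : Continuous fun z : (ℝ × ℝ) × ℝ × ℝ =>
      truncPert g Λ M z.2.1 (|z.1.2| * z.2.2) z.1.1 / |z.1.2| ^ (p - 1) := by
    rw [continuous_iff_continuousAt]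
    rintro ⟨⟨lam, d⟩, x, s⟩
    have hnum : Continuous fun z : (ℝ × ℝ) × ℝ × ℝ =>
        truncPert g Λ M z.2.1 (|z.1.2| * z.2.2) z.1.1 :=
      hgcont.comp (g := fun z : ℝ × ℝ × ℝ => truncPert g Λ M z.1 z.2.1 z.2.2)
        (f := fun z : (ℝ × ℝ) × ℝ × ℝ => (z.2.1, |z.1.2| * z.2.2, z.1.1)) (by fun_prop)
    have hden : Continuous fun z : (ℝ × ℝ) × ℝ × ℝ => |z.1.2| ^ (p - 1) :=
      (by fun_prop : Continuous fun z : (ℝ × ℝ) × ℝ × ℝ => |z.1.2|).rpow_const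
        fun _ => Or.inr hp1.le
    rcases eq_or_ne d 0 with rfl | hd
    · rw [ContinuousAt]
      simp only
      rw [abs_zero, Real.zero_rpow hp1.ne', div_zero, Metric.tendsto_nhds]
      intro ε hε
      set S := (|s| + 1) ^ (p - 1) with hS
      have hS0 : 0 < S := Real.rpow_pos_of_pos (by positivity) _
      obtain ⟨δ, hδ, hsmall⟩ := exists_truncPert_small hg hgo (Λ := Λ) (M := M) hp hΛ
        (ε := ε / (2 * S)) (by positivity)
      have h1 : ∀ᶠ z : (ℝ × ℝ) × ℝ × ℝ in 𝓝 ((lam, 0), x, s), |z.2.2| < |s| + 1 := by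
        have : Continuous fun z : (ℝ × ℝ) × ℝ × ℝ => |z.2.2| := by fun_prop
        exact this.continuousAt.eventually (gt_mem_nhds (by simp))
      have h2 : ∀ᶠ z : (ℝ × ℝ) × ℝ × ℝ in 𝓝 ((lam, 0), x, s), |(|z.1.2| * z.2.2)| < δ := by
        have : Continuous fun z : (ℝ × ℝ) × ℝ × ℝ => |(|z.1.2| * z.2.2)| := by fun_prop
        exact this.continuousAt.eventually (gt_mem_nhds (by simpa using hδ))
      filter_upwards [h1, h2] with z hz1 hz2
      rw [Real.dist_eq, sub_zero]
      rcases eq_or_ne z.1.2 0 with h0 | h0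
      · rw [h0, abs_zero, Real.zero_rpow hp1.ne', div_zero, abs_zero]; exact hε
      · have hdp := Real.rpow_pos_of_pos (abs_pos.2 h0) (p - 1)
        rw [abs_div, abs_of_pos hdp, div_lt_iff₀ hdp]
        have hz3 : |truncPert g Λ M z.2.1 (|z.1.2| * z.2.2) z.1.1| ≤
            ε / (2 * S) * (|z.1.2| ^ (p - 1) * |z.2.2| ^ (p - 1)) := by
          by_cases hx : z.2.1 ∈ Ioo (0 : ℝ) 1
          · have hτ : 0 ≤ M * min z.2.1 (1 - z.2.1) :=
              mul_nonneg hM (le_min hx.1.le (by linarith [hx.2]))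
            have hcs := abs_clamp_le_abs hτ (|z.1.2| * z.2.2)
            refine (hsmall _ _ _ (hcs.trans_lt hz2)).trans ?_
            refine mul_le_mul_of_nonneg_left ?_ (by positivity)
            refine (Real.rpow_le_rpow (abs_nonneg _) hcs hp1.le).trans_eq ?_
            rw [abs_mul, abs_abs, Real.mul_rpow (abs_nonneg _) (abs_nonneg _)]
          · rw [truncPert, if_neg hx, abs_zero]
            have := Real.rpow_nonneg (abs_nonneg z.2.2) (p - 1)
            positivity
        have hz4 : |z.2.2| ^ (p - 1) ≤ S := Real.rpow_le_rpow (abs_nonneg _) hz1.le hp1.le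
        refine hz3.trans_lt ?_
        calc ε / (2 * S) * (|z.1.2| ^ (p - 1) * |z.2.2| ^ (p - 1))
            ≤ ε / (2 * S) * (|z.1.2| ^ (p - 1) * S) := by gcongr
          _ = ε / 2 * |z.1.2| ^ (p - 1) := by field_simp
          _ < ε * |z.1.2| ^ (p - 1) := by
            refine mul_lt_mul_of_pos_right ?_ hdp
            linarith
    · exact hnum.continuousAt.div hden.continuousAt (Real.rpow_pos_of_pos (abs_pos.2 hd) _).ne'
  refine ⟨Λ * A + A + A + C₀, fun z => halfRHS p a' α' β' (clamp Λ z.1.1) z.2.1 z.2.2 +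
    truncPert g Λ M z.2.1 (|z.1.2| * z.2.2) z.1.1 / |z.1.2| ^ (p - 1), ?_, ?_, ?_, ?_, ?_⟩
  · refine Continuous.add ?_ hquot
    exact hH.comp (g := fun z : ℝ × ℝ × ℝ => halfRHS p a' α' β' z.1 z.2.1 z.2.2)
      (f := fun z : (ℝ × ℝ) × ℝ × ℝ => (clamp Λ z.1.1, z.2.1, z.2.2))
      ((Continuous.clamp (by fun_prop) (by fun_prop)).prodMk (by fun_prop))
  · positivity
  · rintro ⟨lam, d⟩ x s
    refine (abs_add_le _ _).trans ?_
    have h1 := abs_halfRHS_le (a := a') (α := α') (β := β') hp (x := x) (A := A)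
      ((hA₁ x).trans (le_max_left _ _))
      ((hA₂ x).trans ((le_max_left _ _).trans (le_max_right _ _)))
      ((hA₃ x).trans ((le_max_right _ _).trans (le_max_right _ _)))
      (abs_clamp_le hΛ.le lam) s
    have h2 := hbound lam d x s
    linarith
  · intro lam hlam x hx s
    simp only
    rw [clamp_eq hlam, abs_zero, Real.zero_rpow hp1.ne', div_zero, add_zero, hhalf _ _ _ hx]
  · intro lam d hlam hd x hx s hs
    have hdp := Real.rpow_pos_of_pos hd (p - 1)
    simp only
    rw [clamp_eq hlam, abs_of_pos hd, hhalf _ _ _ ⟨hx.1.le, hx.2.le⟩, mul_add,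
      ← halfRHS_mul p a α β hd, truncPert, if_pos hx, clamp_eq hs, clamp_eq hlam,
      phip_of_pos hd, mul_div_cancel₀ _ hdp.ne']

end Pert

end Truncation

section Normalisation

variable {p q : ℝ} {f : ℝ → ℝ → ℝ} {ν : ℝ}

lemma phip_inv_mul_phip (p : ℝ) {d : ℝ} (hd : d ≠ 0) : phip p d⁻¹ * phip p d = 1 := by
  rw [← phip_mul, inv_mul_cancel₀ hd, phip_one]

/-- A `C¹` solution with `u'(0) = ν d` becomes, after division by `d`, a solution of the
normalised initial value problem. -/
theorem exists_isIVP_of_contDiff (hpq : p.HolderConjugate q) (hν : ν = 1 ∨ ν = -1)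
    (hf : Continuous fun z : ℝ × ℝ => f z.1 z.2) {U : ℝ → ℝ} (hU : ContDiff ℝ 1 U)
    (h0 : U 0 = 0) {d : ℝ} (hd : 0 < d) (hU0 : deriv U 0 = ν * d)
    (hder : ∀ x ∈ Ioo (0 : ℝ) 1,
      HasDerivAt (fun y => phip p (deriv U y)) (-(phip p d * f x (U x / d))) x) :
    ∃ u v, IsIVP (phip q) f ν u v ∧
      ∀ x ∈ Icc (0 : ℝ) 1, U x = d * u x ∧ deriv U x = d * phip q (v x) := by
  have hpc := phip_continuous hpq.lt
  have hqc := phip_continuous hpq.symm.lt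
  have hU1 : Continuous (deriv U) := hU.continuous_deriv le_rfl
  have hG : Continuous fun z : Unit × ℝ × ℝ => f z.2.1 z.2.2 :=
    hf.comp (continuous_snd : Continuous fun z : Unit × ℝ × ℝ => z.2)
  obtain ⟨T, hT⟩ := exists_isDelayMap (P := Unit) hqc hG ν
  have hu₀ : Continuous fun x => U x / d := hU.continuous.div_const d
  have hv₀ : Continuous fun x => phip p (d⁻¹ * deriv U x) := hpc.comp (hU1.const_mul _)
  let w : CI × CI :=
    (⟨fun x => U x / d, hu₀.comp continuous_subtype_val⟩,
      ⟨fun x => phip p (d⁻¹ * deriv U x), hv₀.comp continuous_subtype_val⟩)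
  have hw : T ((0, ()), w) = w := by
    refine hT.fixed_of_hasDerivAt (u := fun x => U x / d)
      (v := fun x => phip p (d⁻¹ * deriv U x)) hqc hG hu₀.continuousOn hv₀.continuousOn
      ?_ ?_ ?_ ?_ fun x => ⟨rfl, rfl⟩
    · intro x _
      have h := ((hU.differentiable (by norm_num)) x).hasDerivAt.div_const d
      refine h.congr_deriv ?_
      rw [phip_conj hpq]; ring
    · intro x hx
      have h := (hder x hx).const_mul (phip p d⁻¹)
      have e : (fun y => phip p (d⁻¹ * deriv U y)) =
          fun y => phip p d⁻¹ * phip p (deriv U y) := by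
        funext y; rw [phip_mul]
      rw [e]
      refine h.congr_deriv ?_
      rw [mul_neg, ← mul_assoc, phip_inv_mul_phip p hd.ne', one_mul]
    · simp [h0]
    · show phip p (d⁻¹ * deriv U 0) = ν
      rw [hU0, mul_left_comm, inv_mul_cancel₀ hd.ne', mul_one]
      rcases hν with rfl | rfl
      · exact phip_one p
      · rw [phip_neg, phip_one]
  obtain ⟨u, v, huv, hwe⟩ := hT.exists_isIVP hqc hG hw
  refine ⟨u, v, huv, fun x hx => ?_⟩
  have h := hwe ⟨x, hx⟩
  simp only [w, ContinuousMap.coe_mk] at h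
  rw [h.1, h.2, phip_conj hpq]
  constructor
  · rw [mul_div_cancel₀ _ hd.ne']
  · rw [← mul_assoc, mul_inv_cancel₀ hd.ne', one_mul]

lemma IsIVP.exists_contDiff {u v : ℝ → ℝ} (hq : 1 < q) (h : IsIVP (phip q) f ν u v) (d : ℝ) :
    ∃ U : ℝ → ℝ, ContDiff ℝ 1 U ∧
      ∀ x ∈ Icc (0 : ℝ) 1, U x = d * u x ∧ deriv U x = d * phip q (v x) := by
  have hmem : ∀ x : ℝ, max 0 (min 1 x) ∈ Icc (0 : ℝ) 1 := fun x =>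
    ⟨le_max_left _ _, max_le zero_le_one (min_le_left _ _)⟩
  have heq : ∀ x ∈ Icc (0 : ℝ) 1, max 0 (min 1 x) = x := fun x hx => by
    rw [min_eq_right hx.2, max_eq_right hx.1]
  set w : ℝ → ℝ := fun s => d * phip q (v (max 0 (min 1 s))) with hw
  have hwc : Continuous w := continuous_const.mul ((phip_continuous hq).comp
    (h.continuousOn_v.comp_continuous (by fun_prop) hmem))
  have hd : ∀ x, HasDerivAt (fun x => ∫ s in (0 : ℝ)..x, w s) (w x) x := fun x =>
    intervalIntegral.integral_hasDerivAt_right (hwc.intervalIntegrable _ _)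
      (hwc.stronglyMeasurableAtFilter _ _) hwc.continuousAt
  have hde : deriv (fun x => ∫ s in (0 : ℝ)..x, w s) = w := funext fun x => (hd x).deriv
  refine ⟨fun x => ∫ s in (0 : ℝ)..x, w s, ?_, fun x hx => ⟨?_, ?_⟩⟩
  · rw [contDiff_one_iff_deriv, hde]
    exact ⟨fun x => (hd x).differentiableAt, hwc⟩
  · have h1 : ∫ s in (0 : ℝ)..x, w s = d * u x - d * u 0 := by
      refine intervalIntegral.integral_eq_sub_of_hasDerivAt (f := fun s => d * u s)
        (fun s hs => ?_) (hwc.intervalIntegrable _ _)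
      rw [uIcc_of_le hx.1] at hs
      have hs' : s ∈ Icc (0 : ℝ) 1 := ⟨hs.1, hs.2.trans hx.2⟩
      simp only [hw]
      rw [heq s hs']
      exact (h.deriv_u s hs').const_mul d
    simpa [h.u_zero] using h1
  · rw [hde]
    simp only [hw]
    rw [heq x hx]

/-- A solution of the normalised initial value problem whose angle reaches `k π` gives rise to
elements of `S_k^ν`. -/
theorem IsIVP.exists_memS {u v θ : ℝ → ℝ} (hpq : p.HolderConjugate q) (hν : ν = 1 ∨ ν = -1)
    (h : IsIVP (phip q) f ν u v)
    (hθ : IsAngle (fun x => ν * v x) (fun x => ν * phip p (u x)) θ) {k : ℕ} (hk : 1 ≤ k)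
    (h1 : θ 1 = k * Real.pi) {d : ℝ} (hd : 0 < d) :
    ∃ U, MemS k ν U ∧ (∀ x ∈ Icc (0 : ℝ) 1, U x = d * u x ∧ deriv U x = d * phip q (v x)) ∧
      ∀ x ∈ Ioo (0 : ℝ) 1,
        HasDerivAt (fun y => phip p (deriv U y)) (-(phip p d * f x (u x))) x := by
  have hp := hpq.lt
  have hq := hpq.symm.lt
  obtain ⟨U, hU, hUe⟩ := h.exists_contDiff hq d
  have hz : ∀ x ∈ Icc (0 : ℝ) 1, (U x = 0 ↔ u x = 0) := fun x hx => by
    rw [(hUe x hx).1, mul_eq_zero, or_iff_right hd.ne']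
  have hset : {x ∈ Ioo (0 : ℝ) 1 | U x = 0} = {x ∈ Ioo (0 : ℝ) 1 | u x = 0} := by
    ext x
    exact and_congr_right fun hx => hz x (Ioo_subset_Icc_self hx)
  have hb : ∀ x ∈ Icc (0 : ℝ) 1, v x ≠ 0 → 0 < phip q (v x) * v x := fun x _ hv => by
    rw [phip_mul_self hq]
    exact Real.rpow_pos_of_pos (abs_pos.2 hv) _
  have hu1 : u 1 = 0 := (hθ.eq_zero_iff hp hν (right_mem_Icc.2 zero_le_one)).2
    ⟨k, by rw [h1]; simp⟩
  have hne : ∀ x ∈ Icc (0 : ℝ) 1, u x = 0 → v x ≠ 0 := fun x hx hux hvx => by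
    have := hθ.sq_add_sq_pos hx
    simp [hux, hvx, phip_zero] at this
  refine ⟨U, ⟨⟨hU, ?_, ?_⟩, ?_, ?_, ?_, ?_⟩, hUe, ?_⟩
  · exact (hz 0 (left_mem_Icc.2 zero_le_one)).2 h.u_zero
  · exact (hz 1 (right_mem_Icc.2 zero_le_one)).2 hu1
  · rw [hset]; exact (h.ncard_zeros hp hν hb hθ hk h1).1
  · rw [hset]; exact (h.ncard_zeros hp hν hb hθ hk h1).2
  · intro x hx hux
    rw [(hUe x hx).2]
    refine mul_ne_zero hd.ne' fun h0 => hne x hx ((hz x hx).1 hux) ?_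
    exact (phip_eq_zero_iff hq).1 h0
  · have hd0 : HasDerivAt (fun y => ν * u y) (ν * phip q ν) 0 := by
      have := (h.deriv_u 0 (left_mem_Icc.2 zero_le_one)).const_mul ν
      rwa [h.v_zero] at this
    have hpos : 0 < ν * phip q ν := by
      rcases hν with rfl | rfl <;> simp [phip_neg, phip_one]
    have hev := (eventually_sign_of_hasDerivAt_pos hd0 hpos (by simp [h.u_zero])).1
    obtain ⟨δ, hδ, hsub⟩ := (mem_nhdsGT_iff_exists_Ioo_subset' (zero_lt_one (α := ℝ))).1 hev
    refine ⟨min δ 1, lt_min hδ one_pos, fun x hx => ?_⟩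
    have hx1 : x ∈ Icc (0 : ℝ) 1 := ⟨hx.1.le, hx.2.le.trans (min_le_right _ _)⟩
    have hx2 : 0 < ν * u x := hsub ⟨hx.1, hx.2.trans_le (min_le_left _ _)⟩
    rw [(hUe x hx1).1, mul_left_comm]
    exact mul_pos hd hx2
  · intro x hx
    have h2 := (h.deriv_v x (Ioo_subset_Icc_self hx)).const_mul (phip p d)
    rw [mul_neg] at h2
    refine h2.congr_of_eventuallyEq ?_
    filter_upwards [Ioo_mem_nhds hx.1 hx.2] with y hy
    rw [(hUe y (Ioo_subset_Icc_self hy)).2, phip_mul, phip_conj hpq.symm]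

lemma exists_deriv_zero_of_memS {k : ℕ} {U : ℝ → ℝ} (hν : ν = 1 ∨ ν = -1) (hU : MemS k ν U) :
    ∃ d, 0 < d ∧ deriv U 0 = ν * d := by
  obtain ⟨⟨hC, h0, -⟩, -, -, hsimple, δ, hδ, hpos⟩ := hU
  have hν2 : ν * ν = 1 := by rcases hν with rfl | rfl <;> norm_num
  have hne := hsimple 0 (left_mem_Icc.2 zero_le_one) h0
  have hd : HasDerivAt U (deriv U 0) 0 := (hC.differentiable (by norm_num) 0).hasDerivAt
  refine ⟨ν * deriv U 0, ?_, by rw [← mul_assoc, hν2, one_mul]⟩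
  by_contra! hle
  have hlt : ν * deriv U 0 < 0 := lt_of_le_of_ne hle
    (mul_ne_zero (by rcases hν with rfl | rfl <;> norm_num) hne)
  have hd' : HasDerivAt (fun y => -(ν * U y)) (-(ν * deriv U 0)) 0 := (hd.const_mul ν).fun_neg
  have hev := (eventually_sign_of_hasDerivAt_pos hd' (by linarith) (by simp [h0])).1
  obtain ⟨x, hx, hx2⟩ := (hev.and (Ioo_mem_nhdsGT hδ)).exists
  linarith [hpos x hx2]

lemma abs_le_of_memE {U : ℝ → ℝ} (hU : MemE U) {M : ℝ}
    (hM : ∀ x ∈ Icc (0 : ℝ) 1, |deriv U x| ≤ M) {x : ℝ} (hx : x ∈ Icc (0 : ℝ) 1) :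
    |U x| ≤ M * min x (1 - x) := by
  have hM0 : 0 ≤ M := (abs_nonneg _).trans (hM x hx)
  have key : ∀ y ∈ Icc (0 : ℝ) 1, |U x - U y| ≤ M * |x - y| := fun y hy =>
    (convex_Icc (0 : ℝ) 1).norm_image_sub_le_of_norm_deriv_le
      (fun z _ => hU.1.differentiable (by norm_num) z) hM hy hx
  have h1 := key 0 (left_mem_Icc.2 zero_le_one)
  have h2 := key 1 (right_mem_Icc.2 zero_le_one)
  have e : |x - 1| = 1 - x := by rw [abs_sub_comm, abs_of_nonneg (by linarith [hx.2])]
  rw [hU.2.1, sub_zero, sub_zero, abs_of_nonneg hx.1] at h1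
  rw [hU.2.2, sub_zero, e] at h2
  rw [mul_min_of_nonneg _ _ hM0]
  exact le_min h1 h2

end Normalisation

section Model

/-- The pairs `(u, v)` with the initial values `u(0) = 0`, `v(0) = ν`. -/
def initialSet (ν : ℝ) : Set (CI × CI) := {w | w.1 0 = 0 ∧ w.2 0 = ν}

/-- The pairs in `initialSet ν` whose components have no common zero. -/
def regularSet (ν : ℝ) : Set (CI × CI) := {w ∈ initialSet ν | ∀ x, w.2 x = 0 → w.1 x ≠ 0}

/-- `θ` is a Prüfer angle of the pair `w = (u, v)`. -/
def IsPairAngle (p ν : ℝ) (w : CI × CI) (θ : ℝ → ℝ) : Prop :=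
  IsAngle (fun x => ν * ext w.2 x) (fun x => ν * phip p (ext w.1 x)) θ

/-- The value at `1` of the Prüfer angle of the pair `w = (u, v)`. -/
noncomputable def endAngle (p ν : ℝ) (w : CI × CI) : ℝ :=
  open Classical in if h : ∃ θ, IsPairAngle p ν w θ then h.choose 1 else 0

variable {p ν : ℝ}

lemma exists_isPairAngle (hp : 1 < p) (hν : ν = 1 ∨ ν = -1) {w : CI × CI}
    (hw : w ∈ regularSet ν) : ∃ θ, IsPairAngle p ν w θ := by
  have hν0 : ν ≠ 0 := by rcases hν with rfl | rfl <;> norm_num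
  have h0 : (0 : ℝ) ∈ Icc (0 : ℝ) 1 := left_mem_Icc.2 zero_le_one
  refine exists_isAngle (continuous_const.mul (continuous_ext _)).continuousOn
    (continuous_const.mul ((phip_continuous hp).comp (continuous_ext _))).continuousOn
    (fun x hx hv => ?_) ?_ ?_
  · rw [ext_apply _ hx] at hv ⊢
    refine mul_ne_zero hν0 fun h => ?_
    exact hw.2 ⟨x, hx⟩ ((mul_eq_zero.1 hv).resolve_left hν0) ((phip_eq_zero_iff hp).1 h)
  · have : ext w.2 0 = ν := (ext_apply _ h0).trans hw.1.2
    rw [this]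
    rcases hν with rfl | rfl <;> norm_num
  · have : ext w.1 0 = 0 := (ext_apply _ h0).trans hw.1.1
    rw [this, phip_zero, mul_zero]

/-- The pair `(ν v, ν φ_p(u))` whose angle is the Prüfer angle of `(u, v)`. -/
noncomputable def phasePair (hp : 1 < p) (ν : ℝ) (w : CI × CI) : CI × CI :=
  (ν • w.2, ν • (⟨phip p, phip_continuous hp⟩ : C(ℝ, ℝ)).comp w.1)

lemma continuous_phasePair (hp : 1 < p) (ν : ℝ) : Continuous (phasePair hp ν) := by
  refine (continuous_snd.const_smul ν).prodMk (Continuous.const_smul ?_ ν)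
  exact (ContinuousMap.continuous_postcomp _).comp continuous_fst

lemma IsPairAngle.isAngle_phasePair (hp : 1 < p) {w : CI × CI} {θ : ℝ → ℝ}
    (h : IsPairAngle p ν w θ) :
    IsAngle (ext (phasePair hp ν w).1) (ext (phasePair hp ν w).2) θ := by
  refine IsAngle.congr h (fun x hx => ?_) fun x hx => ?_
  · rw [ext_apply _ hx, ext_apply _ hx]; rfl
  · rw [ext_apply _ hx, ext_apply _ hx]; rfl

lemma IsPairAngle.endAngle_eq (hp : 1 < p) {w : CI × CI} {θ : ℝ → ℝ} (h : IsPairAngle p ν w θ) :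
    endAngle p ν w = θ 1 := by
  have hex : ∃ θ, IsPairAngle p ν w θ := ⟨θ, h⟩
  rw [endAngle, dif_pos hex]
  have ht := tendsto_angle (l := (atTop : Filter ℕ)) (F := fun _ => phasePair hp ν w)
    (f := phasePair hp ν w) (Θ := fun _ => hex.choose) (θ := θ) tendsto_const_nhds
    (Eventually.of_forall fun _ => hex.choose_spec.isAngle_phasePair hp) (h.isAngle_phasePair hp)
  exact tendsto_nhds_unique tendsto_const_nhds ht

lemma continuousOn_endAngle (hp : 1 < p) (hν : ν = 1 ∨ ν = -1) :
    ContinuousOn (endAngle p ν) (regularSet ν) := by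
  intro w hw
  obtain ⟨θ, hθ⟩ := exists_isPairAngle hp hν hw
  rw [ContinuousWithinAt, hθ.endAngle_eq hp]
  have hF : Tendsto (phasePair hp ν) (𝓝[regularSet ν] w) (𝓝 (phasePair hp ν w)) :=
    (continuous_phasePair hp ν).continuousAt.mono_left nhdsWithin_le_nhds
  choose! Θ hΘ using fun w (hw : w ∈ regularSet ν) => exists_isPairAngle hp hν hw
  have ht := tendsto_angle hF (Θ := Θ) (θ := θ)
    (eventually_mem_nhdsWithin.mono fun w' hw' => (hΘ w' hw').isAngle_phasePair hp)
    (hθ.isAngle_phasePair hp)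
  refine ht.congr' ?_
  filter_upwards [self_mem_nhdsWithin] with w' hw'
  exact ((hΘ w' hw').endAngle_eq hp).symm

lemma eventually_mem_regularSet {w : CI × CI} (hw : w ∈ regularSet ν) :
    ∀ᶠ w' in 𝓝 w, w' ∈ initialSet ν → w' ∈ regularSet ν := by
  have hcont : Continuous fun w : CI × CI => w.1 * w.1 + w.2 * w.2 := by fun_prop
  have hopen : IsOpen {φ : CI | MapsTo φ univ (Ioi 0)} :=
    ContinuousMap.isOpen_setOfPred_mapsTo isCompact_univ isOpen_Ioi
  have hmem : w.1 * w.1 + w.2 * w.2 ∈ {φ : CI | MapsTo φ univ (Ioi 0)} := by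
    intro x _
    have h1 := mul_self_nonneg (w.1 x)
    have h2 := mul_self_nonneg (w.2 x)
    show 0 < w.1 x * w.1 x + w.2 x * w.2 x
    rcases eq_or_ne (w.2 x) 0 with h | h
    · have := mul_self_pos.2 (hw.2 x h); linarith
    · have := mul_self_pos.2 h; linarith
  filter_upwards [hcont.continuousAt.eventually_mem (hopen.mem_nhds hmem)] with w' hw' hi
  refine ⟨hi, fun x h2 h1 => ?_⟩
  have : 0 < w'.1 x * w'.1 x + w'.2 x * w'.2 x := hw' (mem_univ x)
  simp [h1, h2] at this

/-- The element of `ℝ × E` with parameters `(λ, d)` and normalised profile `(u, v)`: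
`(λ, d u, d φ(v))`. -/
noncomputable def unscale (φ : C(ℝ, ℝ)) (y : (ℝ × ℝ) × (CI × CI)) : Xsp :=
  (y.1.1, y.1.2 • y.2.1, y.1.2 • φ.comp y.2.2)

lemma continuous_unscale (φ : C(ℝ, ℝ)) : Continuous (unscale φ) := by
  have h : Continuous fun y : (ℝ × ℝ) × (CI × CI) => φ.comp y.2.2 :=
    (ContinuousMap.continuous_postcomp φ).comp (by fun_prop)
  refine Continuous.prodMk (by fun_prop) (Continuous.prodMk (by fun_prop)
    (Continuous.fun_smul ?_ h))
  fun_prop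

/-- A compact family `T` of approximate solution operators whose fixed points at `h = 0`
describe the part of `Z` in the ball of radius `M`. -/
structure IsModel (p ν κ lamk M Λ : ℝ) (φ : C(ℝ, ℝ)) (Z : Set Xsp)
    (T : C((ℝ × ℝ × ℝ) × (CI × CI), CI × CI)) (K : Set (CI × CI)) : Prop where
  isCompact : IsCompact K
  mem : ∀ h, 0 ≤ h → ∀ π w, T ((h, π), w) ∈ K
  initial : ∀ h, 0 ≤ h → ∀ π w, T ((h, π), w) ∈ initialSet ν
  exists_fixed : ∀ h, 0 < h → ∃ S : ℝ × ℝ → CI × CI, Continuous S ∧ ∀ π, T ((h, π), S π) = S π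
  regular : ∀ π w, T ((0, π), w) = w → w ∈ regularSet ν
  lt : ∀ lam w, |lam| ≤ Λ → lam < lamk → T ((0, lam, 0), w) = w → endAngle p ν w < κ
  gt : ∀ lam w, |lam| ≤ Λ → lamk < lam → T ((0, lam, 0), w) = w → κ < endAngle p ν w
  exists_of_mem : ∀ z ∈ Z, ‖z‖ ≤ M → ∃ d ∈ Icc 0 M, ∃ w, T ((0, z.1, d), w) = w ∧
    endAngle p ν w = κ ∧ unscale φ ((z.1, d), w) = z
  mem_of_fixed : ∀ lam d w, |lam| ≤ Λ → 0 ≤ d → T ((0, lam, d), w) = w → endAngle p ν w = κ →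
    ‖unscale φ ((lam, d), w)‖ ≤ M → unscale φ ((lam, d), w) ∈ Z

variable {κ lamk M Λ : ℝ} {φ : C(ℝ, ℝ)} {Z : Set Xsp}
  {T : C((ℝ × ℝ × ℝ) × (CI × CI), CI × CI)} {K : Set (CI × CI)}

lemma IsModel.isCompact_inter (hm : IsModel p ν κ lamk M Λ φ Z T K) (hp : 1 < p)
    (hν : ν = 1 ∨ ν = -1) (hMΛ : M ≤ Λ) : IsCompact (Z ∩ Metric.closedBall 0 M) := by
  set F : Set ((ℝ × ℝ) × (CI × CI)) :=
    ((Icc (-Λ) Λ ×ˢ Icc 0 M) ×ˢ K) ∩ {y | T ((0, y.1), y.2) = y.2} with hF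
  have hFc : IsCompact F := by
    refine ((isCompact_Icc.prod isCompact_Icc).prod hm.isCompact).inter_right ?_
    exact isClosed_eq (T.continuous.comp (by fun_prop)) continuous_snd
  have hA : ContinuousOn (fun y : (ℝ × ℝ) × (CI × CI) => endAngle p ν y.2) F :=
    (continuousOn_endAngle hp hν).comp continuous_snd.continuousOn
      fun y hy => hm.regular y.1 y.2 hy.2
  have hF1 : IsCompact (F ∩ (fun y : (ℝ × ℝ) × (CI × CI) => endAngle p ν y.2) ⁻¹' {κ}) :=
    hFc.of_isClosed_subset (hA.preimage_isClosed_of_isClosed hFc.isClosed isClosed_singleton)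
      inter_subset_left
  have hF2 := hF1.inter_right ((Metric.isClosed_closedBall (x := (0 : Xsp))
    (ε := M)).preimage (continuous_unscale φ))
  convert hF2.image (continuous_unscale φ) using 1
  ext z
  simp only [mem_inter_iff, mem_image, mem_closedBall_zero_iff, mem_preimage, mem_singleton_iff]
  constructor
  · rintro ⟨hz, hzM⟩
    obtain ⟨d, hd, w, hw, hκ, he⟩ := hm.exists_of_mem z hz hzM
    have hz1 : |z.1| ≤ Λ := (norm_fst_le z).trans (hzM.trans hMΛ)
    refine ⟨((z.1, d), w), ⟨⟨⟨⟨⟨abs_le.1 hz1, hd⟩, ?_⟩, hw⟩, hκ⟩, ?_⟩, he⟩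
    · rw [← hw]; exact hm.mem 0 le_rfl _ _
    · rw [he]; exact hzM
  · rintro ⟨⟨⟨lam, d⟩, w⟩, ⟨⟨⟨⟨⟨h1, h2⟩, -⟩, hw⟩, hκ⟩, hn⟩, rfl⟩
    exact ⟨hm.mem_of_fixed lam d w (abs_le.2 h1) h2.1 hw hκ hn, hn⟩

lemma IsModel.eventually_fixed (hm : IsModel p ν κ lamk M Λ φ Z T K) {B : Set (ℝ × ℝ)}
    (hB : IsCompact B) {Q : (ℝ × ℝ) × (CI × CI) → Prop}
    (hQ : ∀ π ∈ B, ∀ w, T ((0, π), w) = w → ∀ᶠ y in 𝓝 (π, w), y.2 ∈ initialSet ν → Q y) :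
    ∀ᶠ h in 𝓝[>] (0 : ℝ), ∀ π ∈ B, ∀ w, T ((h, π), w) = w → Q (π, w) := by
  have hclaim : ∀ᶠ h in 𝓝 (0 : ℝ), ∀ y ∈ B ×ˢ K,
      T ((h, y.1), y.2) = y.2 → y.2 ∈ initialSet ν → Q y := by
    refine (hB.prod hm.isCompact).eventually_forall_of_forall_eventually ?_
    rintro ⟨π, w⟩ ⟨hπ, -⟩
    by_cases hw : T ((0, π), w) = w
    · have := (continuous_snd.tendsto ((0 : ℝ), (π, w))).eventually (hQ π hπ w hw)
      filter_upwards [this] with y hy _ hi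
      exact hy hi
    · have hopen : IsOpen {y : ℝ × (ℝ × ℝ) × (CI × CI) | T ((y.1, y.2.1), y.2.2) ≠ y.2.2} :=
        isOpen_ne_fun (T.continuous.comp (by fun_prop)) (by fun_prop)
      filter_upwards [hopen.mem_nhds (show ((0 : ℝ), (π, w)) ∈ _ from hw)] with y hy h
      exact absurd h hy
  filter_upwards [nhdsWithin_le_nhds hclaim, self_mem_nhdsWithin] with h hh h0 π hπ w hw
  have h0' : (0 : ℝ) ≤ h := le_of_lt h0
  refine hh (π, w) ⟨hπ, ?_⟩ hw ?_
  · show w ∈ K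
    rw [← hw]; exact hm.mem h h0' π w
  · show w ∈ initialSet ν
    rw [← hw]; exact hm.initial h h0' π w

lemma IsModel.eventually_of_endAngle (hm : IsModel p ν κ lamk M Λ φ Z T K) (hp : 1 < p)
    (hν : ν = 1 ∨ ν = -1) {π : ℝ × ℝ} {w : CI × CI} (hw : T ((0, π), w) = w) {s : Set ℝ}
    (hs : IsOpen s) (hws : endAngle p ν w ∈ s) :
    ∀ᶠ y : (ℝ × ℝ) × (CI × CI) in 𝓝 (π, w), y.2 ∈ initialSet ν → endAngle p ν y.2 ∈ s := by
  have hreg := hm.regular π w hw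
  have h1 := (continuousOn_endAngle hp hν w hreg).eventually (hs.mem_nhds hws)
  rw [eventually_nhdsWithin_iff] at h1
  have h2 := h1.and (eventually_mem_regularSet hreg)
  filter_upwards [(continuous_snd.tendsto (π, w)).eventually h2] with y hy hi
  exact hy.1 (hy.2 hi)

theorem IsModel.exists_mem_eq_half (hm : IsModel p ν κ lamk M Λ φ Z T K) (hp : 1 < p)
    (hν : ν = 1 ∨ ν = -1) (hφ : |φ ν| = 1) (hM : |lamk| < M)
    (hΛ : |lamk| + 2 * (M + |lamk|) ≤ Λ) {ψ : Xsp → ℝ} (hψ : Continuous ψ)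
    (hψ0 : ψ (lamk, 0) = 0) (hψ1 : ∀ z, M ≤ ‖z‖ → ψ z = 1) : ∃ z ∈ Z, ‖z‖ ≤ M ∧ ψ z = 1 / 2 := by
  by_contra! hno
  set R := 2 * (M + |lamk|) with hR
  have hl0 := abs_nonneg lamk
  have hR0 : 0 < R := by rw [hR]; linarith
  -- smallness near the trivial solution
  have hsmall : ∀ᶠ π in 𝓝 ((lamk, 0) : ℝ × ℝ), ∀ w ∈ K, ψ (unscale φ (π, w)) < 1 / 2 := by
    refine hm.isCompact.eventually_forall_of_forall_eventually fun w _ => ?_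
    refine (hψ.comp (continuous_unscale φ)).continuousAt.eventually (gt_mem_nhds ?_)
    have : unscale φ ((lamk, 0), w) = (lamk, 0) := by simp [unscale]
    simp only [Function.comp, this, hψ0]
    norm_num
  obtain ⟨ε₀, hε₀, hball⟩ := Metric.eventually_nhds_iff.1 hsmall
  set ε := min (ε₀ / 2) R with hε
  have hε0 : 0 < ε := lt_min (by linarith) hR0
  have hεR : ε ≤ R := min_le_right _ _
  set par : ℝ × ℝ → ℝ × ℝ := fun z => (lamk + z.1 * Real.cos z.2, z.1 * Real.sin z.2) with hpar
  have hparc : Continuous par := by rw [hpar]; fun_prop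
  set B : Set (ℝ × ℝ) := Icc (-Λ) Λ ×ˢ Icc 0 Λ with hBdef
  have hB : IsCompact B := isCompact_Icc.prod isCompact_Icc
  have hparB : ∀ z ∈ Icc ε R ×ˢ Icc 0 Real.pi, par z ∈ B := by
    rintro ⟨r, t⟩ ⟨⟨hr1, hr2⟩, ht⟩
    simp only at hr1 hr2
    have hr0 : 0 ≤ r := hε0.le.trans hr1
    have hs := Real.sin_nonneg_of_mem_Icc ht
    have hs1 := Real.sin_le_one t
    have hc1 : |r * Real.cos t| ≤ R := by
      rw [abs_mul, abs_of_nonneg hr0]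
      have := Real.abs_cos_le_one t
      nlinarith
    refine ⟨abs_le.1 ((abs_add_le _ _).trans (by linarith)), mul_nonneg hr0 hs, ?_⟩
    show r * Real.sin t ≤ Λ
    nlinarith
  have hE1 := hm.eventually_fixed hB (Q := fun y => y.2 ∈ regularSet ν) fun π _ w hw =>
    (continuous_snd.tendsto (π, w)).eventually (eventually_mem_regularSet (hm.regular π w hw))
  have hE2 := hm.eventually_fixed hB
    (Q := fun y => ¬(ψ (unscale φ y) = 1 / 2 ∧ endAngle p ν y.2 = κ)) fun π hπ w hw => by
      by_cases hκ : endAngle p ν w = κ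
      · have hne : ψ (unscale φ (π, w)) ≠ 1 / 2 := by
          by_cases hn : ‖unscale φ (π, w)‖ ≤ M
          · exact hno _ (hm.mem_of_fixed π.1 π.2 w (abs_le.2 hπ.1) hπ.2.1 hw hκ hn) hn
          · rw [hψ1 _ (not_le.1 hn).le]; norm_num
        have hopen : IsOpen {y | ψ (unscale φ y) ≠ 1 / 2} :=
          isOpen_ne_fun (hψ.comp (continuous_unscale φ)) continuous_const
        filter_upwards [hopen.mem_nhds (show (π, w) ∈ _ from hne)] with y hy _ h
        exact hy h.1
      · filter_upwards [hm.eventually_of_endAngle hp hν hw isOpen_ne hκ] with y hy hi h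
        exact hy hi h.2
  have hE3 := hm.eventually_fixed (isCompact_Icc (a := lamk + ε) (b := lamk + R) |>.prod
    (isCompact_singleton (x := (0 : ℝ))))
    (Q := fun y => endAngle p ν y.2 ∈ Ioi κ) fun π hπ w hw => by
      obtain ⟨lam, d⟩ := π
      obtain ⟨⟨h1, h2⟩, rfl⟩ := hπ
      simp only at h1 h2
      refine hm.eventually_of_endAngle hp hν hw isOpen_Ioi (hm.gt lam w ?_ (by linarith) hw)
      rw [abs_le]
      constructor <;> linarith [neg_abs_le lamk, le_abs_self lamk]
  have hE4 := hm.eventually_fixed (isCompact_Icc (a := lamk - R) (b := lamk - ε) |>.prod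
    (isCompact_singleton (x := (0 : ℝ))))
    (Q := fun y => endAngle p ν y.2 ∈ Iio κ) fun π hπ w hw => by
      obtain ⟨lam, d⟩ := π
      obtain ⟨⟨h1, h2⟩, rfl⟩ := hπ
      simp only at h1 h2
      refine hm.eventually_of_endAngle hp hν hw isOpen_Iio (hm.lt lam w ?_ (by linarith) hw)
      rw [abs_le]
      constructor <;> linarith [neg_abs_le lamk, le_abs_self lamk]
  obtain ⟨h, h1, h2, h3, h4, h0⟩ :=
    (hE1.and (hE2.and (hE3.and (hE4.and self_mem_nhdsWithin)))).exists
  have h0' : (0 : ℝ) < h := h0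
  obtain ⟨S, hS, hSfix⟩ := hm.exists_fixed h h0'
  have hSK : ∀ π, S π ∈ K := fun π => by rw [← hSfix π]; exact hm.mem h h0'.le _ _
  have hSν : ∀ π, (S π).2 0 = ν := fun π => by
    rw [← hSfix π]; exact (hm.initial h h0'.le _ _).2
  suffices hzero : ∃ z ∈ Icc ε R ×ˢ Icc 0 Real.pi,
      ψ (unscale φ (par z, S (par z))) - 1 / 2 = 0 ∧ endAngle p ν (S (par z)) - κ = 0 by
    obtain ⟨z, hz, hk, hh⟩ := hzero
    exact h2 (par z) (hparB z hz) _ (hSfix _) ⟨sub_eq_zero.1 hk, sub_eq_zero.1 hh⟩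
  refine exists_common_zero hεR Real.pi_pos.le
    (k := fun z => ψ (unscale φ (par z, S (par z))) - 1 / 2)
    (h := fun z => endAngle p ν (S (par z)) - κ) ?_ ?_ ?_ ?_ ?_ ?_
  · refine Continuous.continuousOn (Continuous.sub (hψ.comp ((continuous_unscale φ).comp ?_))
      continuous_const)
    exact hparc.prodMk (hS.comp hparc)
  · refine ContinuousOn.sub ?_ continuousOn_const
    exact (continuousOn_endAngle hp hν).comp (hS.comp hparc).continuousOn
      fun z hz => h1 _ (hparB z hz) _ (hSfix _)
  · intro t ht
    rw [sub_neg]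
    refine hball ?_ _ (hSK _)
    have hc := Real.abs_cos_le_one t
    have hs := Real.abs_sin_le_one t
    have hεε : ε < ε₀ := (min_le_left _ _).trans_lt (by linarith)
    rw [Prod.dist_eq, Real.dist_eq, Real.dist_eq]
    simp only [hpar, add_sub_cancel_left, sub_zero, abs_mul, abs_of_pos hε0]
    refine max_lt ?_ ?_ <;> nlinarith
  · intro t ht
    have hs0 := Real.sin_nonneg_of_mem_Icc ht
    have hsc := Real.sin_sq_add_cos_sq t
    rw [hψ1]
    · norm_num
    · by_cases hc : 1 / 2 ≤ |Real.cos t|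
      · refine le_trans ?_ (norm_fst_le _)
        show M ≤ |lamk + R * Real.cos t|
        have hRc : M + |lamk| ≤ |R * Real.cos t| := by
          rw [abs_mul, abs_of_pos hR0]; nlinarith
        have htri : |R * Real.cos t| ≤ |lamk + R * Real.cos t| + |lamk| := by
          have := abs_sub (lamk + R * Real.cos t) lamk
          rwa [add_sub_cancel_left] at this
        linarith
      · have hcs : 1 / 2 ≤ Real.sin t := by
          by_contra! hlt
          have := sq_abs (Real.cos t)
          nlinarith [abs_nonneg (Real.cos t)]
        set X := unscale φ (par (R, t), S (par (R, t))) with hX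
        have e1 : |X.2.2 0| = R * Real.sin t := by
          show |(R * Real.sin t) * φ ((S (par (R, t))).2 0)| = _
          rw [hSν, abs_mul, hφ, mul_one, abs_of_nonneg (mul_nonneg hR0.le hs0)]
        have e2 : |X.2.2 0| ≤ ‖X‖ :=
          (X.2.2.norm_coe_le_norm 0).trans ((norm_snd_le _).trans (norm_snd_le _))
        rw [e1] at e2
        refine le_trans ?_ e2
        nlinarith
  · intro r hr
    have e : par (r, 0) = (lamk + r, 0) := by simp [hpar]
    rw [sub_pos, e]
    exact h3 (lamk + r, 0) ⟨⟨by linarith [hr.1], by linarith [hr.2]⟩, rfl⟩ _ (hSfix _)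
  · intro r hr
    have e : par (r, Real.pi) = (lamk - r, 0) := by simp [hpar, sub_eq_add_neg]
    rw [sub_neg, e]
    exact h4 (lamk - r, 0) ⟨⟨by linarith [hr.2], by linarith [hr.1]⟩, rfl⟩ _ (hSfix _)

end Model

section Continuum

/-- If no continuous function can separate `z₀` from infinity along the locally compact set `Z`,
then the component of `z₀` in `Z` is unbounded. -/
theorem not_isBounded_connectedComponentIn {X : Type*} [NormedAddCommGroup X] {Z : Set X} {z₀ : X}
    (h₀ : z₀ ∈ Z) {M₀ : ℝ} (hc : ∀ M, M₀ < M → IsCompact (Z ∩ Metric.closedBall 0 M))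
    (hsep : ∀ M, M₀ < M → ∀ ψ : X → ℝ, Continuous ψ → ψ z₀ = 0 → (∀ z, M ≤ ‖z‖ → ψ z = 1) →
      ∃ z ∈ Z, ‖z‖ ≤ M ∧ ψ z = 1 / 2) :
    ¬ Bornology.IsBounded (connectedComponentIn Z z₀) := by
  intro hbd
  obtain ⟨M, hM, hball⟩ : ∃ M, M₀ < M ∧ ∀ z ∈ connectedComponentIn Z z₀, ‖z‖ < M := by
    obtain ⟨r, hr⟩ := hbd.exists_norm_le
    refine ⟨max r M₀ + 1, by linarith [le_max_right r M₀], fun z hz => ?_⟩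
    linarith [hr z hz, le_max_left r M₀]
  set Y := Z ∩ Metric.closedBall (0 : X) M with hY
  have hYc : IsCompact Y := hc M hM
  have : CompactSpace Y := isCompact_iff_compactSpace.1 hYc
  have hz₀ : z₀ ∈ Y :=
    ⟨h₀, mem_closedBall_zero_iff.2 (hball z₀ (mem_connectedComponentIn h₀)).le⟩
  let y₀ : Y := ⟨z₀, hz₀⟩
  set S : Set Y := {y | M ≤ ‖(y : X)‖} with hS
  have hSc : IsClosed S := isClosed_le continuous_const (by fun_prop)
  have hcomp : S ∩ ⋂ s : { s : Set Y // IsClopen s ∧ y₀ ∈ s }, (s : Set Y) = ∅ := by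
    rw [← connectedComponent_eq_iInter_isClopen]
    by_contra hne
    obtain ⟨y, hyS, hy⟩ := nonempty_iff_ne_empty.2 hne
    have hsub : Subtype.val '' connectedComponent y₀ ⊆ connectedComponentIn Z z₀ := by
      refine IsPreconnected.subset_connectedComponentIn
        (isPreconnected_connectedComponent.image _ continuous_subtype_val.continuousOn)
        ⟨y₀, mem_connectedComponent, rfl⟩ ?_
      rintro _ ⟨y, -, rfl⟩
      exact y.2.1
    exact not_lt.2 hyS (hball y (hsub ⟨y, hy, rfl⟩))
  obtain ⟨u, hu⟩ := hSc.isCompact.elim_finite_subfamily_closed _ (fun s => s.2.1.isClosed) hcomp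
  set A : Set Y := ⋂ s ∈ u, (s : Set Y) with hA
  have hAclopen : IsClopen A := isClopen_biInter_finset fun s _ => s.2.1
  have hAy : y₀ ∈ A := mem_iInter₂.2 fun s _ => s.2.2
  have hAcl : IsClosed (Subtype.val '' A) :=
    (hAclopen.isClosed.isCompact.image continuous_subtype_val).isClosed
  have hAcl' : IsClosed (Subtype.val '' Aᶜ ∪ {z : X | M ≤ ‖z‖}) :=
    ((hAclopen.compl.isClosed.isCompact.image continuous_subtype_val).isClosed).union
      (isClosed_le continuous_const continuous_norm)
  have hdisj : Disjoint (Subtype.val '' A) (Subtype.val '' Aᶜ ∪ {z : X | M ≤ ‖z‖}) := by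
    rw [disjoint_left]
    rintro _ ⟨y, hy, rfl⟩ (⟨y', hy', he⟩ | hn)
    · exact hy' (Subtype.val_injective he ▸ hy)
    · have : y ∈ S ∩ A := ⟨hn, hy⟩
      rw [hu] at this
      exact this
  obtain ⟨ψ, hψ0, hψ1, -⟩ := exists_continuous_zero_one_of_isClosed hAcl hAcl' hdisj
  obtain ⟨z, hz, hzM, hhalf⟩ := hsep M hM ψ ψ.continuous (hψ0 ⟨y₀, hAy, rfl⟩)
    fun z hz => hψ1 (Or.inr hz)
  have hzY : z ∈ Y := ⟨hz, mem_closedBall_zero_iff.2 hzM⟩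
  by_cases hzA : (⟨z, hzY⟩ : Y) ∈ A
  · have : ψ z = 0 := hψ0 ⟨_, hzA, rfl⟩
    norm_num [this] at hhalf
  · have : ψ z = 1 := hψ1 (Or.inl ⟨_, hzA, rfl⟩)
    norm_num [this] at hhalf

end Continuum

section Exact

variable {p q ν : ℝ} {a α β : ℝ → ℝ} {g : ℝ → ℝ → ℝ → ℝ} {Λ M C : ℝ}
  {G : (ℝ × ℝ) × ℝ × ℝ → ℝ} {u v θ : ℝ → ℝ} {w : CI × CI} {π : ℝ × ℝ}

/-- The function `φ_q` truncated at level `r`. -/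
noncomputable def clampPhip (q r s : ℝ) : ℝ := phip q (clamp r s)

/-- The nonlinearity `G` truncated at level `r` in its last variable. -/
noncomputable def clampRHS (G : (ℝ × ℝ) × ℝ × ℝ → ℝ) (r : ℝ) (z : (ℝ × ℝ) × ℝ × ℝ) : ℝ :=
  G (z.1, z.2.1, clamp r z.2.2)

lemma continuous_clampPhip (hq : 1 < q) (r : ℝ) : Continuous (clampPhip q r) :=
  (phip_continuous hq).comp (Continuous.clamp continuous_const continuous_id)

lemma continuous_clampRHS (hG : Continuous G) (r : ℝ) : Continuous (clampRHS G r) :=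
  hG.comp (continuous_fst.prodMk ((by fun_prop : Continuous fun z : (ℝ × ℝ) × ℝ × ℝ => z.2.1).prodMk
    (Continuous.clamp continuous_const (by fun_prop))))

lemma abs_clampPhip_le (hq : 1 < q) {r : ℝ} (hr : 0 ≤ r) (s : ℝ) :
    |clampPhip q r s| ≤ |s| ^ (q - 1) := by
  rw [clampPhip, abs_phip hq]
  exact Real.rpow_le_rpow (abs_nonneg _) (abs_clamp_le_abs hr s) (by linarith)

lemma abs_clampPhip_le_const (hq : 1 < q) {r : ℝ} (hr : 0 ≤ r) (s : ℝ) :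
    |clampPhip q r s| ≤ r ^ (q - 1) := by
  rw [clampPhip, abs_phip hq]
  exact Real.rpow_le_rpow (abs_nonneg _) (abs_clamp_le hr s) (by linarith)

namespace IsTruncation

lemma abs_clampRHS_le (hG : IsTruncation p a α β g Λ M C G) (hp : 1 < p) {r : ℝ} (hr : 0 ≤ r)
    (π : ℝ × ℝ) (x s : ℝ) : |clampRHS G r (π, x, s)| ≤ C * |s| ^ (p - 1) :=
  (hG.growth π x _).trans (mul_le_mul_of_nonneg_left
    (Real.rpow_le_rpow (abs_nonneg _) (abs_clamp_le_abs hr s) (by linarith)) hG.nonneg)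

lemma abs_clampRHS_le_const (hG : IsTruncation p a α β g Λ M C G) (hp : 1 < p) {r : ℝ}
    (hr : 0 ≤ r) (z : (ℝ × ℝ) × ℝ × ℝ) : |clampRHS G r z| ≤ C * r ^ (p - 1) :=
  (hG.growth z.1 z.2.1 _).trans (mul_le_mul_of_nonneg_left
    (Real.rpow_le_rpow (abs_nonneg _) (abs_clamp_le hr _) (by linarith)) hG.nonneg)

lemma isIVP_clamp_iff (hG : IsTruncation p a α β g Λ M C G) (hpq : p.HolderConjugate q)
    (hν : |ν| = 1) :
    IsIVP (clampPhip q (Real.exp (p + q * C)))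
      (fun x y => clampRHS G (Real.exp (p + q * C)) (π, x, y)) ν u v ↔
      IsIVP (phip q) (fun x y => G (π, x, y)) ν u v := by
  have hr := (Real.exp_pos (p + q * C)).le
  constructor
  · intro h
    have hb := fun x hx => h.abs_le (x := x) hpq hν hG.nonneg
      (fun x _ => abs_clampPhip_le hpq.symm.lt hr _)
      (fun x _ => hG.abs_clampRHS_le hpq.lt hr _ _ _) hx
    refine h.congr (fun x hx => ?_) fun x hx => ?_
    · rw [clampPhip, clamp_eq (hb x hx).2]
    · simp only [clampRHS]; rw [clamp_eq (hb x hx).1]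
  · intro h
    have hb := fun x hx => h.abs_le (x := x) hpq hν hG.nonneg
      (fun x _ => (abs_phip hpq.symm.lt _).le) (fun x _ => hG.growth _ _ _) hx
    refine h.congr (fun x hx => ?_) fun x hx => ?_
    · rw [clampPhip, clamp_eq (hb x hx).2]
    · simp only [clampRHS]; rw [clamp_eq (hb x hx).1]

variable {T : C((ℝ × ℝ × ℝ) × (CI × CI), CI × CI)}

lemma fixed_iff (hG : IsTruncation p a α β g Λ M C G) (hpq : p.HolderConjugate q) (hν : |ν| = 1)
    (hT : IsDelayMap (clampPhip q (Real.exp (p + q * C))) (clampRHS G (Real.exp (p + q * C))) ν T) :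
    T ((0, π), w) = w ↔ ∃ u v, IsIVP (phip q) (fun x y => G (π, x, y)) ν u v ∧
      ∀ x : Icc (0 : ℝ) 1, u x = w.1 x ∧ v x = w.2 x := by
  have hbc := continuous_clampPhip hpq.symm.lt (Real.exp (p + q * C))
  have hGc := continuous_clampRHS hG.continuous (Real.exp (p + q * C))
  constructor
  · intro hw
    obtain ⟨u, v, huv, he⟩ := hT.exists_isIVP hbc hGc hw
    exact ⟨u, v, (hG.isIVP_clamp_iff hpq hν).1 huv, he⟩
  · rintro ⟨u, v, huv, he⟩
    have h := (hG.isIVP_clamp_iff hpq hν).2 huv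
    exact hT.fixed_of_hasDerivAt hbc hGc h.continuousOn_u h.continuousOn_v
      (fun x hx => h.deriv_u x (Ioo_subset_Icc_self hx))
      (fun x hx => h.deriv_v x (Ioo_subset_Icc_self hx)) h.u_zero h.v_zero he

lemma mem_regularSet (hG : IsTruncation p a α β g Λ M C G) (hpq : p.HolderConjugate q)
    (hν : |ν| = 1) (h : IsIVP (phip q) (fun x y => G (π, x, y)) ν u v)
    (he : ∀ x : Icc (0 : ℝ) 1, u x = w.1 x ∧ v x = w.2 x) : w ∈ regularSet ν := by
  refine ⟨⟨?_, ?_⟩, fun x hx => ?_⟩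
  · rw [← (he 0).1]; exact h.u_zero
  · rw [← (he 0).2]; exact h.v_zero
  · rw [← (he x).1]
    exact h.ne_zero hpq hν hG.nonneg (fun x _ => (abs_phip hpq.symm.lt _).le)
      (fun x _ => hG.growth _ _ _) x.2 ((he x).2.trans hx)

end IsTruncation

lemma IsPairAngle.isAngle (h : IsPairAngle p ν w θ)
    (he : ∀ x : Icc (0 : ℝ) 1, u x = w.1 x ∧ v x = w.2 x) :
    IsAngle (fun x => ν * v x) (fun x => ν * phip p (u x)) θ := by
  refine IsAngle.congr h (fun x hx => ?_) fun x hx => ?_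
  · rw [ext_apply _ hx, ← (he ⟨x, hx⟩).2]
  · rw [ext_apply _ hx, ← (he ⟨x, hx⟩).1]

namespace IsTruncation

variable {T : C((ℝ × ℝ × ℝ) × (CI × CI), CI × CI)} {k : ℕ} {lamk : ℝ}

/-- A `C¹` solution in `S_k^ν` corresponds to a fixed point with end angle `k π`. -/
lemma exists_fixed_of_memS (hG : IsTruncation p a α β g Λ M C G) (hpq : p.HolderConjugate q)
    (hν : ν = 1 ∨ ν = -1)
    (hT : IsDelayMap (clampPhip q (Real.exp (p + q * C))) (clampRHS G (Real.exp (p + q * C))) ν T)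
    (hk : 1 ≤ k) {U : ℝ → ℝ} (hU : MemS k ν U) {d : ℝ} (hd : 0 < d) (hU0 : deriv U 0 = ν * d)
    (hder : ∀ x ∈ Ioo (0 : ℝ) 1,
      HasDerivAt (fun y => phip p (deriv U y)) (-(phip p d * G (π, x, U x / d))) x) :
    ∃ w, T ((0, π), w) = w ∧ endAngle p ν w = k * Real.pi ∧
      ∀ x : Icc (0 : ℝ) 1, U x = d * w.1 x ∧ deriv U x = d * phip q (w.2 x) := by
  have hν' : |ν| = 1 := by rcases hν with rfl | rfl <;> simp
  have hf : Continuous fun z : ℝ × ℝ => G (π, z.1, z.2) := hG.continuous.comp (by fun_prop)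
  obtain ⟨u, v, huv, he⟩ := exists_isIVP_of_contDiff (f := fun x y => G (π, x, y)) hpq hν hf
    hU.1.1 hU.1.2.1 hd hU0 hder
  let w : CI × CI := (⟨fun x => u x, huv.continuousOn_u.comp_continuous continuous_subtype_val
    fun x => x.2⟩, ⟨fun x => v x, huv.continuousOn_v.comp_continuous continuous_subtype_val
    fun x => x.2⟩)
  have hw : ∀ x : Icc (0 : ℝ) 1, u x = w.1 x ∧ v x = w.2 x := fun x => ⟨rfl, rfl⟩
  refine ⟨w, (hG.fixed_iff hpq hν' hT).2 ⟨u, v, huv, hw⟩, ?_, fun x => he x x.2⟩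
  obtain ⟨θ, hθ⟩ := exists_isPairAngle hpq.lt hν (hG.mem_regularSet hpq hν' huv hw)
  rw [hθ.endAngle_eq hpq.lt]
  have hz : ∀ x ∈ Icc (0 : ℝ) 1, (U x = 0 ↔ u x = 0) := fun x hx => by
    rw [(he x hx).1, mul_eq_zero, or_iff_right hd.ne']
  have hset : {x ∈ Ioo (0 : ℝ) 1 | u x = 0} = {x ∈ Ioo (0 : ℝ) 1 | U x = 0} := by
    ext x
    exact and_congr_right fun hx => (hz x (Ioo_subset_Icc_self hx)).symm
  refine huv.angle_one_eq hpq.lt hν (fun x _ hv => ?_) (hθ.isAngle hw) hk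
    ((hz 1 (right_mem_Icc.2 zero_le_one)).1 hU.1.2.2) (by rw [hset]; exact hU.2.2.1)
  rw [phip_mul_self hpq.symm.lt]
  exact Real.rpow_pos_of_pos (abs_pos.2 hv) _

lemma endAngle_lt_endAngle (hG : IsTruncation p a α β g Λ M C G) (hpq : p.HolderConjugate q)
    (hν : ν = 1 ∨ ν = -1)
    (hT : IsDelayMap (clampPhip q (Real.exp (p + q * C))) (clampRHS G (Real.exp (p + q * C))) ν T)
    (ha : ∀ x ∈ Icc (0 : ℝ) 1, 0 < a x) {lam₁ lam₂ : ℝ} (h₁ : |lam₁| ≤ Λ) (h₂ : |lam₂| ≤ Λ)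
    (hlam : lam₁ < lam₂) {w₁ w₂ : CI × CI} (hw₁ : T ((0, lam₁, 0), w₁) = w₁)
    (hw₂ : T ((0, lam₂, 0), w₂) = w₂) : endAngle p ν w₁ < endAngle p ν w₂ := by
  have hν' : |ν| = 1 := by rcases hν with rfl | rfl <;> simp
  obtain ⟨u₁, v₁, hu₁, he₁⟩ := (hG.fixed_iff hpq hν' hT).1 hw₁
  obtain ⟨u₂, v₂, hu₂, he₂⟩ := (hG.fixed_iff hpq hν' hT).1 hw₂
  obtain ⟨θ₁, hθ₁⟩ := exists_isPairAngle hpq.lt hν (hG.mem_regularSet hpq hν' hu₁ he₁)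
  obtain ⟨θ₂, hθ₂⟩ := exists_isPairAngle hpq.lt hν (hG.mem_regularSet hpq hν' hu₂ he₂)
  rw [hθ₁.endAngle_eq hpq.lt, hθ₂.endAngle_eq hpq.lt]
  exact angle_lt_angle hpq hν ha hlam
    (hu₁.congr (fun _ _ => rfl) fun x hx => (hG.half lam₁ h₁ x hx _).symm)
    (hu₂.congr (fun _ _ => rfl) fun x hx => (hG.half lam₂ h₂ x hx _).symm)
    (hθ₁.isAngle he₁) (hθ₂.isAngle he₂)

end IsTruncation

/-- The solutions of the perturbed problem in `S_k^ν`, together with the point `(λ_k^ν, 0)`. -/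
def solutionSet (p : ℝ) (a α β : ℝ → ℝ) (g : ℝ → ℝ → ℝ → ℝ) (k : ℕ) (ν lamk : ℝ) : Set Xsp :=
  {z | ∃ u, IsPertSol p a α β g z.1 u ∧ MemS k ν u ∧ ReprE u z.2} ∪ {(lamk, 0)}

theorem exists_isModel (hpq : p.HolderConjugate q) (hν : ν = 1 ∨ ν = -1)
    (ha : ContinuousOn a (Icc 0 1)) (hapos : ∀ x ∈ Icc (0 : ℝ) 1, 0 < a x)
    (hα : ContinuousOn α (Icc 0 1)) (hβ : ContinuousOn β (Icc 0 1))
    (hg : ContinuousOn (fun q : ℝ × ℝ × ℝ => g q.1 q.2.1 q.2.2)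
      (Ioo (0 : ℝ) 1 ×ˢ (univ : Set (ℝ × ℝ))))
    (hgo : ∀ C > (0 : ℝ), ∀ ε > (0 : ℝ), ∃ δ > (0 : ℝ), ∀ x ∈ Ioo (0 : ℝ) 1, ∀ s : ℝ,
      0 < |s| → |s| < δ → ∀ lam : ℝ, |lam| ≤ C → |g x s lam| ≤ ε * |phip p s|)
    {k : ℕ} (hk : 1 ≤ k) {lamk : ℝ} (hlamk : ∃ u, IsHalfSol p a α β lamk u ∧ MemS k ν u)
    (hM : |lamk| < M) (hMΛ : M ≤ Λ) :
    ∃ T K, IsModel p ν (k * Real.pi) lamk M Λ ⟨phip q, phip_continuous hpq.symm.lt⟩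
      (solutionSet p a α β g k ν lamk) T K := by
  have hp := hpq.lt
  have hq := hpq.symm.lt
  have hν' : |ν| = 1 := by rcases hν with rfl | rfl <;> simp
  have hM0 : 0 < M := (abs_nonneg _).trans_lt hM
  obtain ⟨C, G, hG⟩ := exists_isTruncation hg hgo hp ha hα hβ (hM0.trans_le hMΛ) hM0.le
  set r := Real.exp (p + q * C) with hr
  have hr0 : 0 ≤ r := (Real.exp_pos _).le
  have hbc := continuous_clampPhip hq r
  have hGc := continuous_clampRHS hG.continuous r
  obtain ⟨T, hT⟩ := exists_isDelayMap hbc hGc ν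
  obtain ⟨K, hK, hmem⟩ := hT.exists_isCompact hbc hGc (B := max (r ^ (q - 1)) (C * r ^ (p - 1)))
    (fun s => (abs_clampPhip_le_const hq hr0 s).trans (le_max_left _ _))
    (fun z => (hG.abs_clampRHS_le_const hp hr0 z).trans (le_max_right _ _))
  have hlamΛ : |lamk| ≤ Λ := hM.le.trans hMΛ
  obtain ⟨wk, hwk, hwkκ⟩ : ∃ w, T ((0, lamk, 0), w) = w ∧ endAngle p ν w = k * Real.pi := by
    obtain ⟨U, hU, hUS⟩ := hlamk
    obtain ⟨d, hd, hd0⟩ := exists_deriv_zero_of_memS hν hUS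
    obtain ⟨w, hw, hκ, -⟩ := hG.exists_fixed_of_memS (π := (lamk, 0)) hpq hν hT hk hUS hd hd0
      fun x hx => by
        refine (hU.2 x hx).congr_deriv ?_
        rw [hG.half lamk hlamΛ x (Ioo_subset_Icc_self hx), ← halfRHS_mul p a α β hd,
          mul_div_cancel₀ _ hd.ne', halfRHS]
    exact ⟨w, hw, hκ⟩
  have hlt : ∀ lam w, |lam| ≤ Λ → lam < lamk → T ((0, lam, 0), w) = w →
      endAngle p ν w < k * Real.pi := fun lam w h1 h2 hw => by
    rw [← hwkκ]
    exact hG.endAngle_lt_endAngle hpq hν hT hapos h1 hlamΛ h2 hw hwk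
  have hgt : ∀ lam w, |lam| ≤ Λ → lamk < lam → T ((0, lam, 0), w) = w →
      k * Real.pi < endAngle p ν w := fun lam w h1 h2 hw => by
    rw [← hwkκ]
    exact hG.endAngle_lt_endAngle hpq hν hT hapos hlamΛ h1 h2 hwk hw
  refine ⟨T, K, hK, hmem, fun h hh π w => ?_, fun h hh => hT.exists_fixed hh, fun π w hw => ?_,
    hlt, hgt, ?_, ?_⟩
  · have e : max (((0 : Icc (0 : ℝ) 1) : ℝ) - h) 0 = 0 := max_eq_right (by simpa using hh)
    refine ⟨?_, ?_⟩
    · rw [(hT h π w 0).1, e, intervalIntegral.integral_same]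
    · rw [(hT h π w 0).2, e, intervalIntegral.integral_same, sub_zero]
  · obtain ⟨u, v, huv, he⟩ := (hG.fixed_iff hpq hν' hT).1 hw
    exact hG.mem_regularSet hpq hν' huv he
  · rintro z (⟨U, hU, hUS, hUr⟩ | rfl) hzM
    · obtain ⟨d, hd, hd0⟩ := exists_deriv_zero_of_memS hν hUS
      have hz1 : |z.1| ≤ Λ := ((norm_fst_le z).trans hzM).trans hMΛ
      have hUM : ∀ x ∈ Icc (0 : ℝ) 1, |deriv U x| ≤ M := fun x hx => by
        rw [← hUr.2 ⟨x, hx⟩]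
        exact (z.2.2.norm_coe_le_norm _).trans
          ((norm_snd_le z.2).trans ((norm_snd_le z).trans hzM))
      have hdM : d ≤ M := by
        have := hUM 0 (left_mem_Icc.2 zero_le_one)
        rwa [hd0, abs_mul, hν', one_mul, abs_of_pos hd] at this
      obtain ⟨w, hw, hκ, he⟩ := hG.exists_fixed_of_memS (π := (z.1, d)) hpq hν hT hk hUS hd hd0
        fun x hx => by
          have hx' := Ioo_subset_Icc_self hx
          refine (hU.2 x hx).congr_deriv ?_
          have hc : d * (U x / d) = U x := mul_div_cancel₀ _ hd.ne'
          rw [hG.pert z.1 d hz1 hd x hx _ (by rw [hc]; exact abs_le_of_memE hUS.1 hUM hx'), hc,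
            halfRHS]
      refine ⟨d, ⟨hd.le, hdM⟩, w, hw, hκ, ?_⟩
      refine Prod.ext rfl (Prod.ext (ContinuousMap.ext fun x => ?_) (ContinuousMap.ext fun x => ?_))
      · rw [hUr.1 x, (he x).1]; rfl
      · rw [hUr.2 x, (he x).2]; rfl
    · exact ⟨0, ⟨le_rfl, hM0.le⟩, wk, hwk, hwkκ, by simp [unscale]⟩
  · intro lam d w hlam hd hw hκ hn
    rcases hd.eq_or_lt with rfl | hd
    · right
      rcases lt_trichotomy lam lamk with h | rfl | h
      · exact absurd hκ (hlt lam w hlam h hw).ne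
      · simp [unscale]
      · exact absurd hκ (hgt lam w hlam h hw).ne'
    · left
      obtain ⟨u, v, huv, he⟩ := (hG.fixed_iff hpq hν' hT).1 hw
      obtain ⟨θ, hθ⟩ := exists_isPairAngle hp hν (hG.mem_regularSet hpq hν' huv he)
      rw [hθ.endAngle_eq hp] at hκ
      obtain ⟨U, hUS, hUe, hUder⟩ := huv.exists_memS hpq hν (hθ.isAngle he) hk hκ hd
      have hUM : ∀ x ∈ Icc (0 : ℝ) 1, |deriv U x| ≤ M := fun x hx => by
        rw [(hUe x hx).2, (he ⟨x, hx⟩).2]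
        exact ((unscale ⟨phip q, phip_continuous hq⟩
          ((lam, d), w)).2.2.norm_coe_le_norm ⟨x, hx⟩).trans
          ((norm_snd_le _).trans ((norm_snd_le _).trans hn))
      refine ⟨U, ⟨hUS.1, fun x hx => ?_⟩, hUS, fun x => ?_, fun x => ?_⟩
      · have hx' := Ioo_subset_Icc_self hx
        refine (hUder x hx).congr_deriv ?_
        have hb := abs_le_of_memE hUS.1 hUM hx'
        rw [(hUe x hx').1] at hb ⊢
        rw [hG.pert lam d hlam hd x hx _ hb, halfRHS]
        rfl
      · rw [(hUe x x.2).1, (he x).1]; rfl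
      · rw [(hUe x x.2).2, (he x).2]; rfl

end Exact

section Final

variable {p ν : ℝ} {a α β : ℝ → ℝ} {g : ℝ → ℝ → ℝ → ℝ} {k : ℕ} {lamk : ℝ}

lemma nontriv_of_memS {u : ℝ → ℝ} (h : MemS k ν u) : Nontriv u := by
  obtain ⟨-, -, -, -, δ, hδ, hpos⟩ := h
  refine ⟨min (δ / 2) 1, ⟨by positivity, min_le_right _ _⟩, fun h0 => ?_⟩
  have := hpos (min (δ / 2) 1) ⟨by positivity, (min_le_left _ _).trans_lt (half_lt_self hδ)⟩
  simp [h0] at this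

theorem not_isBounded_component_solutionSet (hp : 1 < p) (hν : ν = 1 ∨ ν = -1)
    (ha : ContinuousOn a (Icc 0 1)) (hapos : ∀ x ∈ Icc (0 : ℝ) 1, 0 < a x)
    (hα : ContinuousOn α (Icc 0 1)) (hβ : ContinuousOn β (Icc 0 1))
    (hg : ContinuousOn (fun q : ℝ × ℝ × ℝ => g q.1 q.2.1 q.2.2)
      (Ioo (0 : ℝ) 1 ×ˢ (univ : Set (ℝ × ℝ))))
    (hgo : ∀ C > (0 : ℝ), ∀ ε > (0 : ℝ), ∃ δ > (0 : ℝ), ∀ x ∈ Ioo (0 : ℝ) 1, ∀ s : ℝ,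
      0 < |s| → |s| < δ → ∀ lam : ℝ, |lam| ≤ C → |g x s lam| ≤ ε * |phip p s|)
    (hk : 1 ≤ k) (hlamk : ∃ u, IsHalfSol p a α β lamk u ∧ MemS k ν u) :
    ¬ Bornology.IsBounded (connectedComponentIn (solutionSet p a α β g k ν lamk) (lamk, 0)) := by
  have hpq := Real.HolderConjugate.conjExponent hp
  refine not_isBounded_connectedComponentIn (M₀ := |lamk|) (Or.inr rfl) (fun M hM => ?_)
    fun M hM ψ hψ hψ0 hψ1 => ?_
  · obtain ⟨T, K, hm⟩ := exists_isModel hpq hν ha hapos hα hβ hg hgo hk hlamk hM le_rfl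
    exact hm.isCompact_inter hp hν le_rfl
  · have hΛ : M ≤ |lamk| + 2 * (M + |lamk|) := by linarith [abs_nonneg lamk]
    obtain ⟨T, K, hm⟩ := exists_isModel hpq hν ha hapos hα hβ hg hgo hk hlamk hM hΛ
    refine hm.exists_mem_eq_half hp hν ?_ hM le_rfl hψ hψ0 hψ1
    rw [ContinuousMap.coe_mk, phip_sign _ hν]
    rcases hν with rfl | rfl <;> simp

lemma normE_nonneg (u : ℝ → ℝ) : 0 ≤ normE u :=
  add_nonneg (Real.iSup_nonneg fun _ => abs_nonneg _) (Real.iSup_nonneg fun _ => abs_nonneg _)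

lemma normE_le_of_reprE {u : ℝ → ℝ} {w : CI × CI} (h : ReprE u w) :
    normE u ≤ ‖w.1‖ + ‖w.2‖ :=
  add_le_add (ciSup_le fun x => by rw [← h.1 x]; exact w.1.norm_coe_le_norm x)
    (ciSup_le fun x => by rw [← h.2 x]; exact w.2.norm_coe_le_norm x)

end Final

end HalfEigen

/-- **Theorem 3.1**: `(λ_k^ν, 0)` is a bifurcation point of the perturbed problem, and an
unbounded continuum `𝒟_k^ν ⊆ (ℝ × S_k^ν) ∪ {(λ_k^ν, 0)}` of nontrivial solutions emanates
from it. -/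
theorem stmt8 (p : ℝ) (hp : 1 < p)
    (a α β : ℝ → ℝ)
    (ha : ContinuousOn a (Icc 0 1)) (hapos : ∀ x ∈ Icc (0:ℝ) 1, 0 < a x)
    (hα : ContinuousOn α (Icc 0 1)) (hβ : ContinuousOn β (Icc 0 1))
    (g : ℝ → ℝ → ℝ → ℝ)
    (hg : ContinuousOn (fun q : ℝ × ℝ × ℝ => g q.1 q.2.1 q.2.2)
      (Ioo (0:ℝ) 1 ×ˢ (univ : Set (ℝ × ℝ))))
    -- |g(x,u,λ)/φ_p(u)| → 0 as |u| → 0, uniformly in x and on bounded λ intervals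
    (hgo : ∀ C > (0:ℝ), ∀ ε > (0:ℝ), ∃ δ > (0:ℝ), ∀ x ∈ Ioo (0:ℝ) 1, ∀ s : ℝ,
      0 < |s| → |s| < δ → ∀ lam : ℝ, |lam| ≤ C → |g x s lam| ≤ ε * |phip p s|)
    (k : ℕ) (hk : 1 ≤ k) (ν : ℝ) (hν : ν = 1 ∨ ν = -1)
    -- λ_k^ν : the k-th half-eigenvalue
    (lamk : ℝ) (hlamk : ∃ u, IsHalfSol p a α β lamk u ∧ MemS k ν u) :
    -- (λ_k^ν, 0) is a bifurcation point
    (∃ lamn : ℕ → ℝ, ∃ un : ℕ → ℝ → ℝ,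
      (∀ n : ℕ, IsPertSol p a α β g (lamn n) (un n) ∧ Nontriv (un n)) ∧
      Tendsto lamn atTop (𝓝 lamk) ∧
      Tendsto (fun n => normE (un n)) atTop (𝓝 0)) ∧
    -- the unbounded continuum
    (let SolX : Set Xsp := {z | ∃ u, IsPertSol p a α β g z.1 u ∧ Nontriv u ∧ ReprE u z.2}
     let SkX : Set Xsp := {z | ∃ u, MemS k ν u ∧ ReprE u z.2}
     ∃ D : Set Xsp,
       D ⊆ closure SolX ∧ (lamk, (0 : CI × CI)) ∈ D ∧ IsConnected D ∧
       ¬ Bornology.IsBounded D ∧ D ⊆ SkX ∪ {(lamk, (0 : CI × CI))}) := by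

  set z₀ : Xsp := (lamk, 0) with hz₀
  set Z := HalfEigen.solutionSet p a α β g k ν lamk with hZ
  set D := connectedComponentIn Z z₀ with hD
  set SolX : Set Xsp := {z | ∃ u, IsPertSol p a α β g z.1 u ∧ Nontriv u ∧ ReprE u z.2} with hSol
  have hz₀Z : z₀ ∈ Z := Or.inr rfl
  have hz₀D : z₀ ∈ D := mem_connectedComponentIn hz₀Z
  have hconn : IsConnected D := isConnected_connectedComponentIn_iff.2 hz₀Z
  have hunb : ¬ Bornology.IsBounded D :=
    HalfEigen.not_isBounded_component_solutionSet hp hν ha hapos hα hβ hg hgo hk hlamk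
  have hDZ : D ⊆ Z := connectedComponentIn_subset Z z₀
  have hDsol : D \ {z₀} ⊆ SolX := by
    rintro z ⟨hz, hne⟩
    obtain ⟨u, hu, hS, hr⟩ := (hDZ hz).resolve_right hne
    exact ⟨u, hu, HalfEigen.nontriv_of_memS hS, hr⟩
  have hnt : D.Nontrivial := by
    by_contra h
    exact hunb (Set.not_nontrivial_iff.1 h).finite.isBounded
  have hacc : z₀ ∈ closure SolX :=
    closure_mono hDsol (accPt_principal_iff_clusterPt.1
      (hconn.isPreconnected.preperfect_of_nontrivial hnt z₀ hz₀D)).mem_closure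
  refine ⟨?_, D, fun z hz => ?_, hz₀D, hconn, hunb, fun z hz => ?_⟩
  · obtain ⟨z, hz, hlim⟩ := mem_closure_iff_seq_limit.1 hacc
    choose u hu hnt hr using hz
    have hlim2 : Tendsto (fun n => (z n).2) atTop (𝓝 0) := (continuous_snd.tendsto z₀).comp hlim
    refine ⟨fun n => (z n).1, u, fun n => ⟨hu n, hnt n⟩, (continuous_fst.tendsto z₀).comp hlim, ?_⟩
    have h0 : Tendsto (fun n => ‖(z n).2.1‖ + ‖(z n).2.2‖) atTop (𝓝 0) := by
      have hc : Continuous fun w : CI × CI => ‖w.1‖ + ‖w.2‖ := by fun_prop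
      simpa [Function.comp_def] using (hc.tendsto 0).comp hlim2
    exact squeeze_zero (fun n => HalfEigen.normE_nonneg _)
      (fun n => HalfEigen.normE_le_of_reprE (hr n)) h0
  · by_cases h : z = z₀
    · exact h ▸ hacc
    · exact subset_closure (hDsol ⟨hz, h⟩)
  · exact (hDZ hz).imp (fun ⟨u, _, hS, hr⟩ => ⟨u, hS, hr⟩) id
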